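/- For every pair of exponents 3/4 ≤ δ ≤ β < 1 satisfying β < (1+δ)/2, there exist a finitely generated group Γ with a finite symmetric generating set and a symmetric, finitely supported random walk X_n on Γ (whose step distribution has support generating Γ) such that E|X_n| ≍ n^β and H(X_n) ≍ n^δ. -/

import Mathlib

open scoped BigOperators Classical

/-- Convolution of two measures (given as weight functions) on a group. -/
noncomputable def conv {G : Type*} [Group G] (μ ν : G → ℝ) : G → ℝ :=
  fun g => ∑' h, μ h * ν (h⁻¹ * g)

/-- The `n`-fold convolution power of `μ`; `convPow μ n` is the distribution of `X_n`. -/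
noncomputable def convPow {G : Type*} [Group G] (μ : G → ℝ) : ℕ → G → ℝ
  | 0 => fun g => if g = 1 then 1 else 0
  | n + 1 => conv (convPow μ n) μ

/-- Shannon entropy of a measure on a countable group:
`H(μ) = -∑ μ(g) log μ(g)` (with `0 log 0 = 0`). -/
noncomputable def entropy {G : Type*} (μ : G → ℝ) : ℝ :=
  ∑' g, Real.negMulLog (μ g)

/-- Word length with respect to a generating set `S`. -/
noncomputable def wordLength {G : Type*} [Group G] (S : Set G) (g : G) : ℕ :=
  sInf {n | ∃ l : List G, l.length = n ∧ (∀ x ∈ l, x ∈ S) ∧ l.prod = g}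

/-- Rate of escape: `E|X_n| = ∑ μ^{*n}(g) |g|`. -/
noncomputable def speed {G : Type*} [Group G] (S : Set G) (μ : G → ℝ) (n : ℕ) : ℝ :=
  ∑' g, convPow μ n g * (wordLength S g : ℝ)

/-- `μ` is a symmetric, finitely supported probability measure whose support generates `G`. -/
structure IsStepDist {G : Type*} [Group G] (μ : G → ℝ) : Prop where
  nonneg : ∀ g, 0 ≤ μ g
  total : ∑' g, μ g = 1
  symm : ∀ g, μ g⁻¹ = μ g
  finSupp : (Function.support μ).Finite
  gen : Subgroup.closure (Function.support μ) = ⊤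

/-- `S` is a finite symmetric generating set of `G`. -/
structure IsGenSet {G : Type*} [Group G] (S : Set G) : Prop where
  finite : S.Finite
  symm : ∀ s ∈ S, s⁻¹ ∈ S
  gen : Subgroup.closure S = ⊤

set_option linter.all false

/-! ## Part P1 -/
namespace SE

/-! ### Uniform expectation over words -/

/-- Expectation of `F` over a uniform word of length `n`. -/
noncomputable def EE {α : Type*} [Fintype α] : ℕ → (List α → ℝ) → ℝ
  | 0, F => F []
  | n + 1, F => (∑ a : α, EE n (fun l => F (a :: l))) / Fintype.card α

section EEbasic
variable {α : Type*} [Fintype α]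

theorem EE_zero (F : List α → ℝ) : EE 0 F = F [] := rfl

theorem EE_succ (n : ℕ) (F : List α → ℝ) :
    EE (n + 1) F = (∑ a : α, EE n (fun l => F (a :: l))) / Fintype.card α := rfl

theorem EE_add (n : ℕ) : ∀ (F G : List α → ℝ), EE n (fun l => F l + G l) = EE n F + EE n G := by
  induction n with
  | zero => intro F G; rfl
  | succ n ih => intro F G; simp only [EE_succ, ih, Finset.sum_add_distrib, add_div]

theorem EE_smul (n : ℕ) (c : ℝ) : ∀ (F : List α → ℝ), EE n (fun l => c * F l) = c * EE n F := by
  induction n with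
  | zero => intro F; rfl
  | succ n ih => intro F; simp only [EE_succ, ih, ← Finset.mul_sum, mul_div_assoc]

theorem EE_div (n : ℕ) (c : ℝ) (F : List α → ℝ) : EE n (fun l => F l / c) = EE n F / c := by
  simp only [div_eq_inv_mul, EE_smul]

theorem EE_mul_const (n : ℕ) (c : ℝ) (F : List α → ℝ) :
    EE n (fun l => F l * c) = EE n F * c := by
  simp only [mul_comm _ c, EE_smul]

theorem EE_sub (n : ℕ) (F G : List α → ℝ) : EE n (fun l => F l - G l) = EE n F - EE n G := by
  have h := EE_add n F (fun l => (-1) * G l)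
  rw [EE_smul] at h
  simp only [sub_eq_add_neg]
  simpa using h

theorem EE_const [Nonempty α] (n : ℕ) (c : ℝ) : EE n (fun _ : List α => c) = c := by
  induction n with
  | zero => rfl
  | succ n ih =>
    rw [EE_succ, ih]
    simp [Finset.sum_const, Finset.card_univ]

theorem EE_sum {ι : Type*} (n : ℕ) (s : Finset ι) (F : ι → List α → ℝ) [Nonempty α] :
    EE n (fun l => ∑ i ∈ s, F i l) = ∑ i ∈ s, EE n (F i) := by
  induction s using Finset.induction_on with
  | empty => simp [EE_const]
  | insert a s ha ih => simp only [Finset.sum_insert ha, EE_add, ih]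

theorem EE_congr {n : ℕ} : ∀ {F G : List α → ℝ}, (∀ l, l.length = n → F l = G l) →
    EE n F = EE n G := by
  induction n with
  | zero => intro F G h; exact h [] rfl
  | succ n ih =>
    intro F G h
    rw [EE_succ, EE_succ]
    congr 1
    refine Finset.sum_congr rfl fun a _ => ih fun l hl => h _ (by simp [hl])

theorem EE_mono {n : ℕ} : ∀ {F G : List α → ℝ}, (∀ l, l.length = n → F l ≤ G l) →
    EE n F ≤ EE n G := by
  induction n with
  | zero => intro F G h; exact h [] rfl
  | succ n ih =>
    intro F G h
    rw [EE_succ, EE_succ]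
    refine div_le_div_of_nonneg_right ?_ (by positivity)
    exact Finset.sum_le_sum fun a _ => ih fun l hl => h _ (by simp [hl])

theorem EE_nonneg [Nonempty α] {n : ℕ} {F : List α → ℝ} (h : ∀ l, l.length = n → 0 ≤ F l) :
    0 ≤ EE n F := by
  have := EE_mono (n := n) (F := fun _ => 0) (G := F) h
  rwa [EE_const] at this

theorem EE_le_const [Nonempty α] {n : ℕ} {F : List α → ℝ} {c : ℝ}
    (h : ∀ l, l.length = n → F l ≤ c) : EE n F ≤ c := by
  have := EE_mono (n := n) (F := F) (G := fun _ => c) h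
  rwa [EE_const] at this

theorem EE_append (m n : ℕ) : ∀ (F : List α → ℝ),
    EE (m + n) F = EE n (fun l₂ => EE m (fun l₁ => F (l₁ ++ l₂))) := by
  induction m with
  | zero => intro F; simp [EE_zero]
  | succ m ih =>
    intro F
    rw [show m + 1 + n = (m + n) + 1 by ring, EE_succ]
    simp only [ih, EE_succ, List.cons_append]
    rw [EE_div]
    congr 1
    rcases isEmpty_or_nonempty α with h | h
    · cases n with
      | zero => simp [EE_zero]
      | succ n => simp [EE_succ]
    · rw [EE_sum]

/-- average over one letter -/
noncomputable def av (f : α → ℝ) : ℝ := (∑ a : α, f a) / Fintype.card α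

theorem EE_succ_av (n : ℕ) (F : List α → ℝ) :
    EE (n + 1) F = av (fun a => EE n (fun l => F (a :: l))) := rfl

theorem EE_succ' (n : ℕ) (F : List α → ℝ) :
    EE (n + 1) F = EE n (fun l => av fun a => F (a :: l)) := by
  rw [show n + 1 = 1 + n by ring, EE_append]
  rfl

theorem EE_step_le {n : ℕ} {F c : List α → ℝ}
    (h : ∀ l, l.length = n → av (fun a => F (a :: l)) ≤ F l + c l) :
    EE (n + 1) F ≤ EE n F + EE n c := by
  rw [EE_succ', ← EE_add]; exact EE_mono h

theorem EE_step_ge {n : ℕ} {F c : List α → ℝ}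
    (h : ∀ l, l.length = n → F l + c l ≤ av (fun a => F (a :: l))) :
    EE n F + EE n c ≤ EE (n + 1) F := by
  rw [EE_succ', ← EE_add]; exact EE_mono h

/-- linear growth from one step bound -/
theorem EE_growth [Nonempty α] {F : List α → ℝ} {c : ℝ}
    (h : ∀ l, av (fun a => F (a :: l)) ≤ F l + c) (n : ℕ) :
    EE n F ≤ F [] + n * c := by
  induction n with
  | zero => simp [EE_zero]
  | succ n ih =>
    have := EE_step_le (n := n) (F := F) (c := fun _ => c) (fun l _ => h l)
    rw [EE_const] at this
    push_cast; linarith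

theorem av_const [Nonempty α] (c : ℝ) : av (fun _ : α => c) = c := by
  simp [av, Finset.sum_const, Finset.card_univ]

theorem av_add (f g : α → ℝ) : av (fun a => f a + g a) = av f + av g := by
  simp [av, Finset.sum_add_distrib, add_div]

theorem av_smul (c : ℝ) (f : α → ℝ) : av (fun a => c * f a) = c * av f := by
  simp [av, ← Finset.mul_sum, mul_div_assoc]

theorem av_mono {f g : α → ℝ} (h : ∀ a, f a ≤ g a) : av f ≤ av g :=
  div_le_div_of_nonneg_right (Finset.sum_le_sum fun a _ => h a) (by positivity)

theorem av_prod {β : Type*} [Fintype β] (f : α × β → ℝ) :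
    av f = av (fun a => av (fun b => f (a, b))) := by
  simp only [av, Fintype.sum_prod_type, Fintype.card_prod, Nat.cast_mul, ← Finset.sum_div, div_div]
  rw [mul_comm (Fintype.card α : ℝ)]

theorem av_comm {β : Type*} [Fintype β] (f : α → β → ℝ) :
    av (fun a => av (fun b => f a b)) = av (fun b => av (fun a => f a b)) := by
  simp only [av, ← Finset.sum_div, div_div]
  rw [Finset.sum_comm, mul_comm (Fintype.card α : ℝ)]

theorem av_equiv {β : Type*} [Fintype β] (e : α ≃ β) (f : β → ℝ) :
    av (fun a => f (e a)) = av f := by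
  simp only [av, Fintype.card_congr e, Equiv.sum_comp e f]

theorem EE_av {β : Type*} [Fintype β] (n : ℕ) : ∀ (F : β → List α → ℝ),
    EE n (fun l => av fun b => F b l) = av fun b => EE n (F b) := by
  induction n with
  | zero => intro F; rfl
  | succ n ih =>
    intro F
    have h1 : ∀ G : List α → ℝ, EE (n+1) G = av (fun a => EE n (fun l => G (a :: l))) :=
      fun G => rfl
    rw [h1]; simp only [ih, h1]; rw [av_comm]

theorem EE_prod {β : Type*} [Fintype β] (n : ℕ) : ∀ (F : List (α × β) → ℝ),
    EE n F = EE n (fun la : List α => EE n (fun lb : List β => F (la.zip lb))) := by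
  induction n with
  | zero => intro F; rfl
  | succ n ih =>
    intro F
    rw [EE_succ_av, av_prod, EE_succ_av]
    refine congrArg av (funext fun a => ?_)
    simp only [ih]
    rw [← EE_av]
    rfl

theorem hasSum_EE {H : Type*} (n : ℕ) : ∀ (F : H → List α → ℝ) (S : List α → ℝ),
    (∀ l, HasSum (fun h => F h l) (S l)) → HasSum (fun h => EE n (F h)) (EE n S) := by
  induction n with
  | zero => intro F S h; exact h []
  | succ n ih =>
    intro F S h
    simp only [EE_succ]
    exact (hasSum_sum fun a _ => ih (fun h l => F h (a :: l)) _ fun l => h _).div_const _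

theorem EE_map {β : Type*} [Fintype β] (e : α ≃ β) (n : ℕ) : ∀ (F : List β → ℝ),
    EE n (fun l : List α => F (l.map e)) = EE n F := by
  induction n with
  | zero => intro F; rfl
  | succ n ih =>
    intro F
    rw [EE_succ_av, EE_succ_av]
    simp only [List.map_cons]
    rw [← av_equiv e]
    exact congrArg av (funext fun a => ih (fun l => F (e a :: l)))

end EEbasic

/-! ### Walks -/
section Walk
variable {G : Type*} [Group G] {α : Type*} [Fintype α] (at' : α → G)

/-- position after a word of steps (head of the list is the latest step) -/
def XX : List α → G
  | [] => 1
  | a :: l => XX l * at' a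

theorem XX_append (l₁ l₂ : List α) : XX at' (l₁ ++ l₂) = XX at' l₂ * XX at' l₁ := by
  induction l₁ with
  | nil => simp [XX]
  | cons a l ih => simp [XX, ih, mul_assoc]

/-- step distribution -/
noncomputable def mu (g : G) : ℝ := av fun a => if at' a = g then (1:ℝ) else 0

theorem hasSum_ind (x : G) (ψ : G → ℝ) :
    HasSum (fun h => (if x = h then (1:ℝ) else 0) * ψ h) (ψ x) := by
  have h := hasSum_single (f := fun h => (if x = h then (1:ℝ) else 0) * ψ h) x
    (fun b hb => by simp [Ne.symm hb])
  simpa using h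

theorem convPow_mu (n : ℕ) : ∀ g, convPow (mu at') n g =
    EE n (fun l => if XX at' l = g then (1:ℝ) else 0) := by
  induction n with
  | zero => intro g; simp only [convPow, EE_zero, XX]; split_ifs <;> simp_all
  | succ n ih =>
    intro g
    simp only [convPow, conv, ih]
    have h := hasSum_EE n (fun h (l : List α) => (if XX at' l = h then (1:ℝ) else 0) *
      mu at' (h⁻¹ * g)) (fun l => mu at' ((XX at' l)⁻¹ * g))
      (fun l => hasSum_ind (XX at' l) (fun h => mu at' (h⁻¹ * g)))
    simp only [EE_mul_const] at h
    rw [h.tsum_eq, EE_succ']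
    refine EE_congr fun l _ => ?_
    unfold mu
    refine congrArg av (funext fun a => ?_)
    have : (at' a = (XX at' l)⁻¹ * g) ↔ XX at' (a :: l) = g := by
      simp only [XX]; rw [eq_inv_mul_iff_mul_eq]
    split_ifs <;> simp_all

theorem tsum_convPow (n : ℕ) (ψ : G → ℝ) :
    HasSum (fun g => convPow (mu at') n g * ψ g) (EE n (fun l => ψ (XX at' l))) := by
  have h := hasSum_EE n (fun h (l : List α) => (if XX at' l = h then (1:ℝ) else 0) * ψ h)
    (fun l => ψ (XX at' l)) (fun l => hasSum_ind (XX at' l) ψ)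
  simpa only [EE_mul_const, ← convPow_mu] using h

theorem speed_eq (S : Set G) (n : ℕ) :
    speed S (mu at') n = EE n (fun l => (wordLength S (XX at' l) : ℝ)) :=
  (tsum_convPow at' n _).tsum_eq

theorem convPow_nonneg [Nonempty α] (n : ℕ) (g : G) : 0 ≤ convPow (mu at') n g := by
  rw [convPow_mu]; exact EE_nonneg fun l _ => by split_ifs <;> norm_num

theorem mu_isStepDist [Nonempty α] (inv : α → α) (hinv : ∀ a, inv (inv a) = a)
    (hat : ∀ a, at' (inv a) = (at' a)⁻¹)
    (hgen : Subgroup.closure (Set.range at') = ⊤) : IsStepDist (mu at') where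
  nonneg g := by
    unfold mu av; exact div_nonneg (Finset.sum_nonneg fun a _ => by split_ifs <;> norm_num)
      (by positivity)
  total := by
    have := (tsum_convPow at' 1 (fun _ => 1)).tsum_eq
    rw [EE_const] at this
    rw [← this]
    congr 1; ext g
    simp only [mul_one, convPow_mu, EE_succ', EE_zero, XX, one_mul, mu]
  symm g := by
    unfold mu
    rw [← av_equiv (⟨inv, inv, hinv, hinv⟩ : α ≃ α)]
    simp only [Equiv.coe_fn_mk, hat, inv_inj]
  finSupp := by
    refine (Set.finite_range at').subset fun g hg => ?_
    by_contra hn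
    apply hg
    have : ∀ a, at' a ≠ g := fun a ha => hn ⟨a, ha⟩
    simp [mu, av, this]
  gen := by
    rw [← top_le_iff, ← hgen]
    refine Subgroup.closure_mono ?_
    rintro _ ⟨a, rfl⟩
    rw [Function.mem_support]
    unfold mu av
    have h1 : (0:ℝ) < Fintype.card α := by exact_mod_cast Fintype.card_pos
    refine (div_pos ?_ h1).ne'
    exact Finset.sum_pos' (fun b _ => by split_ifs <;> norm_num) ⟨a, Finset.mem_univ _, by simp⟩

theorem convPow_support_finite (n : ℕ) [Nonempty α] :
    ∃ s : Finset G, ∀ g, g ∉ s → convPow (mu at') n g = 0 := by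
  have hf : (Set.range fun v : List.Vector α n => XX at' v.1).Finite := Set.finite_range _
  refine ⟨hf.toFinset, fun g hg => ?_⟩
  rw [convPow_mu]
  refine (EE_congr (G := fun _ => 0) fun l hl => if_neg fun h => hg ?_).trans (EE_const n 0)
  rw [Set.Finite.mem_toFinset]
  exact ⟨⟨l, hl⟩, h⟩

end Walk

end SE

/-! ## Part P1E -/
namespace SE

theorem kraft {At : Type*} [Fintype At] [Nonempty At] (T : Finset (List At)) :
    ∑ w ∈ T, ((2 * (Fintype.card At : ℝ)) ^ w.length)⁻¹ ≤ 2 := by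
  have hN : (0:ℝ) < Fintype.card At := by exact_mod_cast Fintype.card_pos
  set N : ℝ := (Fintype.card At : ℝ) with hNdef
  obtain ⟨M, hM⟩ : ∃ M, ∀ w ∈ T, w.length < M :=
    ⟨T.sup List.length + 1, fun w hw => Nat.lt_succ_of_le (Finset.le_sup (f := List.length) hw)⟩
  have h1 : ∑ w ∈ T, ((2 * N) ^ w.length)⁻¹ =
      ∑ m ∈ Finset.range M, ∑ w ∈ T with w.length = m, ((2 * N) ^ w.length)⁻¹ :=
    (Finset.sum_fiberwise_of_maps_to (fun w hw => Finset.mem_range.2 (hM w hw)) _).symm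
  rw [h1]
  have h2 : ∀ m ∈ Finset.range M, ∑ w ∈ T with w.length = m, ((2 * N) ^ w.length)⁻¹ ≤ (1/2)^m := by
    intro m _
    have hc : (Finset.filter (fun w => w.length = m) T).card ≤ Fintype.card At ^ m := by
      rw [← card_vector, ← Finset.card_univ]
      have : (Finset.filter (fun w => w.length = m) T) ⊆
          (Finset.univ : Finset (List.Vector At m)).image (fun v => v.toList) := by
        intro w hw
        rw [Finset.mem_filter] at hw
        exact Finset.mem_image.2 ⟨⟨w, hw.2⟩, Finset.mem_univ _, rfl⟩
      exact (Finset.card_le_card this).trans Finset.card_image_le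
    calc ∑ w ∈ T with w.length = m, ((2 * N) ^ w.length)⁻¹
        = ∑ w ∈ T with w.length = m, ((2 * N) ^ m)⁻¹ :=
          Finset.sum_congr rfl fun w hw => by rw [(Finset.mem_filter.1 hw).2]
      _ = (Finset.filter (fun w => w.length = m) T).card * ((2 * N) ^ m)⁻¹ := by
          rw [Finset.sum_const, nsmul_eq_mul]
      _ ≤ N ^ m * ((2 * N) ^ m)⁻¹ := by
          gcongr
          rw [hNdef]; exact_mod_cast hc
      _ = (1/2)^m := by rw [mul_pow, one_div, inv_pow]; field_simp
  refine (Finset.sum_le_sum h2).trans ?_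
  have := (summable_geometric_two).sum_le_tsum (Finset.range M) (fun i _ => by positivity)
  rw [tsum_geometric_two] at this
  exact this

theorem gibbs_pt {p x : ℝ} (hp : 0 ≤ p) (hx : 0 < x) :
    Real.negMulLog p ≤ p * (- Real.log x) + (x - p) := by
  rcases hp.eq_or_lt with h | h
  · rw [← h]; simp [hx.le]
  · have h1 := Real.log_le_sub_one_of_pos (div_pos hx h)
    rw [Real.log_div hx.ne' h.ne'] at h1
    have h2 := mul_le_mul_of_nonneg_left h1 hp
    have h3 : p * (x / p - 1) = x - p := by field_simp
    rw [h3] at h2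
    unfold Real.negMulLog
    linarith

section
variable {G : Type*} [Group G] {α : Type*} [Fintype α] (at' : α → G)

theorem entropy_upper [Nonempty α] {At : Type*} [Fintype At] [Nonempty At] (val : At → G) (n : ℕ)
    (W : List α → ℝ)
    (h : ∀ l, l.length = n → ∃ w : List At, (w.map val).prod = XX at' l ∧ (w.length : ℝ) ≤ W l) :
    entropy (convPow (mu at') n) ≤ Real.log (2 * Fintype.card At) * EE n W + 1 := by
  set N : ℝ := (Fintype.card At : ℝ) with hNdef
  have hN : (1:ℝ) ≤ N := by rw [hNdef]; exact_mod_cast Fintype.card_pos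
  set p := convPow (mu at') n with hp
  have hp0 : ∀ g, 0 ≤ p g := fun g => convPow_nonneg at' n g
  obtain ⟨s0, hs0⟩ := convPow_support_finite at' n
  set s := s0.filter (fun g => p g ≠ 0) with hs
  have hps : ∀ g, g ∉ s → p g = 0 := by
    intro g hg
    by_contra hne
    exact hg (Finset.mem_filter.2 ⟨by by_contra hh; exact hne (hs0 g hh), hne⟩)
  -- minimal words
  let P : G → ℕ → Prop := fun g m => ∃ w : List At, w.length = m ∧ (w.map val).prod = g
  let len : G → ℕ := fun g => sInf {m | P g m}
  have hmin : ∀ w : List At, len ((w.map val).prod) ≤ w.length := fun w => Nat.sInf_le ⟨w, rfl, rfl⟩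
  have hrep : ∀ g ∈ s, ∃ w : List At, w.length = len g ∧ (w.map val).prod = g := by
    intro g hg
    have hne := (Finset.mem_filter.1 hg).2
    have : ∃ l : List α, l.length = n ∧ XX at' l = g := by
      by_contra hcon
      push Not at hcon
      apply hne
      rw [hp, convPow_mu]
      exact (EE_congr (G := fun _ => 0) fun l hl => if_neg (hcon l hl)).trans (EE_const n 0)
    obtain ⟨l, hl, rfl⟩ := this
    obtain ⟨w, hw, _⟩ := h l hl
    have hne : {m | P (XX at' l) m}.Nonempty := ⟨w.length, w, rfl, hw⟩
    exact Nat.sInf_mem hne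
  choose! rep hrep1 hrep2 using hrep
  have hinj : Set.InjOn rep s := fun a ha b hb hab => by
    rw [← hrep2 a ha, ← hrep2 b hb, hab]
  have hq : ∑ g ∈ s, ((2 * N) ^ len g)⁻¹ ≤ 2 := by
    have := kraft (s.image rep)
    rw [Finset.sum_image hinj] at this
    refine le_trans (le_of_eq (Finset.sum_congr rfl fun g hg => ?_)) this
    rw [hrep1 g hg]
  have hH : entropy p = ∑ g ∈ s, Real.negMulLog (p g) :=
    tsum_eq_sum fun g hg => by rw [hps g hg]; simp
  have h1 : ∑ g ∈ s, p g = 1 := by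
    have := tsum_convPow at' n (fun _ => 1)
    rw [EE_const] at this
    rw [← this.tsum_eq, tsum_eq_sum (s := s)]
    · simp [hp]
    · intro g hg; rw [← hp, hps g hg]; simp
  have h2 : ∑ g ∈ s, p g * (len g : ℝ) = EE n (fun l => (len (XX at' l) : ℝ)) := by
    have := tsum_convPow at' n (fun g => (len g : ℝ))
    rw [← this.tsum_eq, tsum_eq_sum (s := s)]
    · intro g hg; rw [← hp, hps g hg]; simp
  have h3 : EE n (fun l => (len (XX at' l) : ℝ)) ≤ EE n W := by
    refine EE_mono fun l hl => ?_
    obtain ⟨w, hw, hw2⟩ := h l hl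
    refine le_trans ?_ hw2
    rw [← hw]
    exact_mod_cast hmin w
  have hlog : 0 ≤ Real.log (2 * N) := Real.log_nonneg (by linarith)
  rw [hH]
  calc ∑ g ∈ s, Real.negMulLog (p g)
      ≤ ∑ g ∈ s, (p g * (len g * Real.log (2 * N)) + (((2 * N) ^ len g)⁻¹ - p g)) := by
        refine Finset.sum_le_sum fun g _ => ?_
        have := gibbs_pt (hp0 g) (x := ((2 * N) ^ len g)⁻¹) (by positivity)
        rwa [Real.log_inv, neg_neg, Real.log_pow] at this
    _ = Real.log (2 * N) * (∑ g ∈ s, p g * len g) + (∑ g ∈ s, ((2 * N) ^ len g)⁻¹) - ∑ g ∈ s, p g := by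
        rw [Finset.mul_sum, ← Finset.sum_add_distrib, ← Finset.sum_sub_distrib]
        exact Finset.sum_congr rfl fun g _ => by ring
    _ ≤ Real.log (2 * N) * EE n W + 2 - 1 := by
        rw [h1, h2]
        have := mul_le_mul_of_nonneg_left h3 hlog
        linarith
    _ = _ := by ring

end
end SE

/-! ## Part P2 -/
namespace SE

/-- one level of the construction: a finite group `Y` acting on `K`, with two copies of `V` -/
structure Lev (V : Type) [CommGroup V] where
  Y : Type
  K : Type
  gY : Group Y
  fY : Fintype Y
  fK : Fintype K
  act : MulAction Y K
  o : K
  A : V →* Y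
  B : V →* Y
  hA : ∀ v, A v • o = o

attribute [instance] Lev.gY Lev.fY Lev.fK Lev.act

section Site
variable {V : Type} [CommGroup V]

/-- lamp configuration together with a group element: semidirect product -/
@[ext] structure Site (E : Lev V) (L : Type) where
  φ : E.K → L
  y : E.Y

variable {E : Lev V} {L : Type} [CommGroup L]

noncomputable instance : Mul (Site E L) := ⟨fun f g => ⟨fun κ => f.φ κ * g.φ (f.y⁻¹ • κ), f.y * g.y⟩⟩
noncomputable instance : One (Site E L) := ⟨⟨fun _ => 1, 1⟩⟩
noncomputable instance : Inv (Site E L) := ⟨fun f => ⟨fun κ => (f.φ (f.y • κ))⁻¹, f.y⁻¹⟩⟩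

@[simp] theorem Site.mul_φ (f g : Site E L) (κ : E.K) : (f * g).φ κ = f.φ κ * g.φ (f.y⁻¹ • κ) := rfl
@[simp] theorem Site.mul_y (f g : Site E L) : (f * g).y = f.y * g.y := rfl
@[simp] theorem Site.one_φ (κ : E.K) : (1 : Site E L).φ κ = 1 := rfl
@[simp] theorem Site.one_y : (1 : Site E L).y = 1 := rfl
@[simp] theorem Site.inv_φ (f : Site E L) (κ : E.K) : (f⁻¹).φ κ = (f.φ (f.y • κ))⁻¹ := rfl
@[simp] theorem Site.inv_y (f : Site E L) : (f⁻¹).y = f.y⁻¹ := rfl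

noncomputable instance : Group (Site E L) := Group.ofLeftAxioms
  (fun a b c => by ext κ <;> simp [mul_assoc, mul_smul])
  (fun a => by ext κ <;> simp)
  (fun a => by ext κ <;> simp)

/-- edits -/
abbrev DD (V L : Type) := V × V × L

/-- the `A`-letter and the lamp letter -/
noncomputable def sAC : DD V L →* Site E L where
  toFun d := ⟨Pi.mulSingle E.o d.2.2, E.A d.1⟩
  map_one' := by ext κ <;> simp
  map_mul' d e := by
    ext κ
    · simp only [Site.mul_φ, Prod.snd_mul, Pi.mulSingle_apply]
      have : ((E.A d.1)⁻¹ • κ = E.o) ↔ κ = E.o := by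
        rw [inv_smul_eq_iff, E.hA]
      simp only [this]
      split_ifs <;> simp
    · simp

/-- the `B`-letter -/
noncomputable def sB : DD V L →* Site E L where
  toFun d := ⟨1, E.B d.2.1⟩
  map_one' := by ext κ <;> simp
  map_mul' d e := by ext κ <;> simp

theorem sAC_φ (d : DD V L) (κ : E.K) : (sAC d : Site E L).φ κ = if κ = E.o then d.2.2 else 1 := by
  simp [sAC, Pi.mulSingle_apply]
theorem sAC_y (d : DD V L) : (sAC d : Site E L).y = E.A d.1 := rfl
theorem sB_φ (d : DD V L) (κ : E.K) : (sB d : Site E L).φ κ = 1 := rfl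
theorem sB_y (d : DD V L) : (sB d : Site E L).y = E.B d.2.1 := rfl

/-- one stage -/
noncomputable def st (E : Lev V) (d : DD V L) : Site E L := sAC d * sB d

def pA (d : DD V L) : DD V L := (d.1, 1, d.2.2)
def pB (d : DD V L) : DD V L := (1, d.2.1, 1)

theorem sAC_pA (d : DD V L) : (sAC (pA d) : Site E L) = sAC d := rfl
theorem sB_pB (d : DD V L) : (sB (pB d) : Site E L) = sB d := rfl
theorem sAC_pB (d : DD V L) : (sAC (pB d) : Site E L) = 1 := by
  ext κ <;> simp [sAC, pB]
theorem sB_pA (d : DD V L) : (sB (pA d) : Site E L) = 1 := by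
  ext κ <;> simp [sB, pA]

end Site

section Global
variable {V L : Type} [CommGroup V] [CommGroup L]

/-- global group: all levels share a cursor -/
@[ext] structure GG (lev : ℕ → Lev V) (L : Type) where
  κ : ∀ s, ℤ → Site (lev s) L
  c : ℤ

variable {lev : ℕ → Lev V}

noncomputable instance : Mul (GG lev L) := ⟨fun f g => ⟨fun s x => f.κ s x * g.κ s (x - f.c), f.c + g.c⟩⟩
noncomputable instance : One (GG lev L) := ⟨⟨fun _ _ => 1, 0⟩⟩
noncomputable instance : Inv (GG lev L) := ⟨fun f => ⟨fun s x => (f.κ s (x + f.c))⁻¹, - f.c⟩⟩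

@[simp] theorem GG.mul_κ (f g : GG lev L) (s) (x : ℤ) : (f * g).κ s x = f.κ s x * g.κ s (x - f.c) := rfl
@[simp] theorem GG.mul_c (f g : GG lev L) : (f * g).c = f.c + g.c := rfl
@[simp] theorem GG.one_κ (s) (x : ℤ) : (1 : GG lev L).κ s x = 1 := rfl
@[simp] theorem GG.one_c : (1 : GG lev L).c = 0 := rfl
@[simp] theorem GG.inv_κ (f : GG lev L) (s) (x : ℤ) : (f⁻¹).κ s x = (f.κ s (x + f.c))⁻¹ := rfl
@[simp] theorem GG.inv_c (f : GG lev L) : (f⁻¹).c = - f.c := rfl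

theorem GG.ext' {f g : GG lev L} (h : ∀ s x, f.κ s x = g.κ s x) (hc : f.c = g.c) : f = g :=
  GG.ext (funext fun s => funext fun x => h s x) hc

noncomputable instance : Group (GG lev L) := Group.ofLeftAxioms
  (fun a b c => by
    refine GG.ext' (fun s x => ?_) ?_
    · simp [mul_assoc, sub_sub]
    · simp [add_assoc])
  (fun a => by refine GG.ext' (fun s x => ?_) ?_ <;> simp)
  (fun a => by refine GG.ext' (fun s x => ?_) ?_ <;> simp)

/-- embedding of one level -/
noncomputable def inLev (s : ℕ) : (ℤ → Site (lev s) L) →* GG lev L where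
  toFun γ := ⟨Pi.mulSingle s γ, 0⟩
  map_one' := by refine GG.ext' (fun s x => ?_) ?_ <;> simp
  map_mul' f g := by refine GG.ext' (fun s x => ?_) ?_ <;> simp [Pi.mulSingle_mul]

/-- pure elements -/
noncomputable def pure : (∀ s, ℤ → Site (lev s) L) →* GG lev L where
  toFun γ := ⟨γ, 0⟩
  map_one' := rfl
  map_mul' f g := by refine GG.ext' (fun s x => ?_) ?_ <;> simp

/-- translation -/
noncomputable def Tz (m : ℤ) : GG lev L := ⟨fun _ _ => 1, m⟩
@[simp] theorem Tz_κ (m : ℤ) (s) (x : ℤ) : (Tz m : GG lev L).κ s x = 1 := rfl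
@[simp] theorem Tz_c (m : ℤ) : (Tz m : GG lev L).c = m := rfl
theorem Tz_add (m n : ℤ) : (Tz (m + n) : GG lev L) = Tz m * Tz n := by
  refine GG.ext' (fun s x => ?_) ?_ <;> simp
theorem Tz_zero : (Tz 0 : GG lev L) = 1 := rfl
theorem Tz_neg (m : ℤ) : (Tz (-m) : GG lev L) = (Tz m)⁻¹ := by
  refine GG.ext' (fun s x => ?_) ?_ <;> simp

variable (k : ℕ → ℕ)

noncomputable def layA : (ℤ → DD V L) →* GG lev L where
  toFun P := ⟨fun s x => sAC (P x), 0⟩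
  map_one' := by refine GG.ext' (fun s x => ?_) ?_ <;> simp
  map_mul' f g := by refine GG.ext' (fun s x => ?_) ?_ <;> simp

noncomputable def layB : (ℤ → DD V L) →* GG lev L where
  toFun P := ⟨fun s x => sB (P (x - k s)), 0⟩
  map_one' := by refine GG.ext' (fun s x => ?_) ?_ <;> simp
  map_mul' f g := by refine GG.ext' (fun s x => ?_) ?_ <;> simp

@[simp] theorem layA_κ (P : ℤ → DD V L) (s) (x : ℤ) :
    (layA P : GG lev L).κ s x = sAC (P x) := rfl
@[simp] theorem layA_c (P : ℤ → DD V L) : (layA P : GG lev L).c = 0 := rfl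
@[simp] theorem layB_κ (P : ℤ → DD V L) (s) (x : ℤ) :
    (layB k P : GG lev L).κ s x = sB (P (x - k s)) := rfl
@[simp] theorem layB_c (P : ℤ → DD V L) : (layB k P : GG lev L).c = 0 := rfl

/-- the elementary edit at the cursor -/
noncomputable def Ed (d : DD V L) : GG lev L := layA (Pi.mulSingle 0 d) * layB k (Pi.mulSingle 0 d)

theorem Ed_κ (d : DD V L) (s) (x : ℤ) :
    (Ed k d : GG lev L).κ s x = sAC ((Pi.mulSingle 0 d : ℤ → DD V L) x) *
      sB ((Pi.mulSingle 0 d : ℤ → DD V L) (x - k s)) := by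
  simp [Ed]
@[simp] theorem Ed_c (d : DD V L) : (Ed k d : GG lev L).c = 0 := by simp [Ed]

theorem Ed_mul (hk : ∀ s, 0 < k s) (d e : DD V L) :
    (Ed k (d * e) : GG lev L) = Ed k d * Ed k e := by
  refine GG.ext' (fun s x => ?_) (by simp)
  have := hk s
  simp only [GG.mul_κ, Ed_κ, Ed_c, sub_zero, Pi.mulSingle_apply]
  by_cases h : x = 0
  · subst h
    have h2 : (0:ℤ) - k s ≠ 0 := by omega
    simp only [h2, if_false, map_one, mul_one, if_true, map_mul]
  · simp [h]
    split_ifs <;> simp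

theorem Ed_one : (Ed k (1 : DD V L) : GG lev L) = 1 := by simp [Ed]

theorem Ed_inv (hk : ∀ s, 0 < k s) (d : DD V L) : (Ed k d⁻¹ : GG lev L) = (Ed k d)⁻¹ := by
  rw [eq_inv_iff_mul_eq_one, ← Ed_mul k hk]; simp [Ed_one]

theorem Ed_pA (d : DD V L) : (Ed k (pA d) : GG lev L) = layA (Pi.mulSingle 0 d) := by
  refine GG.ext' (fun s x => ?_) (by simp)
  simp only [Ed_κ, layA_κ, Pi.mulSingle_apply]
  split_ifs <;> simp [sAC_pA, sB_pA]

theorem Ed_pB (d : DD V L) : (Ed k (pB d) : GG lev L) = layB k (Pi.mulSingle 0 d) := by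
  refine GG.ext' (fun s x => ?_) (by simp)
  simp only [Ed_κ, layB_κ, Pi.mulSingle_apply]
  split_ifs <;> simp [sAC_pB, sB_pB]

/-! ### Representations -/

/-- atoms: a move or an edit -/
abbrev Atm (V L : Type) := Bool ⊕ DD V L

noncomputable def aval : Atm V L → GG lev L
  | .inl b => if b then Tz 1 else Tz (-1)
  | .inr d => Ed k d

def anm (nm : L → ℕ) : Atm V L → ℕ
  | .inl _ => 0
  | .inr d => nm d.2.2

variable (nm : L → ℕ)

def Rep (w j : ℕ) (g : GG lev L) : Prop :=
  ∃ l : List (Atm V L), l.length ≤ w ∧ (l.map (anm nm)).sum ≤ j ∧ (l.map (aval k)).prod = g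

/-- path starting with cursor at `p`, ending with cursor at `q`, doing the edits `g` -/
def Rp (p q : ℤ) (w j : ℕ) (g : GG lev L) : Prop := Rep k nm w j (Tz (-p) * g * Tz q)

variable {k nm}

theorem Rep.mul {w w' j j' : ℕ} {g g' : GG lev L} (h : Rep k nm w j g) (h' : Rep k nm w' j' g') :
    Rep k nm (w + w') (j + j') (g * g') := by
  obtain ⟨l, h1, h2, h3⟩ := h
  obtain ⟨l', h1', h2', h3'⟩ := h'
  exact ⟨l ++ l', by simp; omega, by simp; omega, by simp [h3, h3']⟩

theorem Rep.mono {w w' j j' : ℕ} {g : GG lev L} (h : Rep k nm w j g) (hw : w ≤ w') (hj : j ≤ j') :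
    Rep k nm w' j' g := by
  obtain ⟨l, h1, h2, h3⟩ := h
  exact ⟨l, h1.trans hw, h2.trans hj, h3⟩

theorem Rp.mono {p q : ℤ} {w w' j j' : ℕ} {g : GG lev L} (h : Rp k nm p q w j g) (hw : w ≤ w')
    (hj : j ≤ j') : Rp k nm p q w' j' g := Rep.mono h hw hj

theorem Rp.mul {p q r : ℤ} {w w' j j' : ℕ} {g g' : GG lev L} (h : Rp k nm p q w j g)
    (h' : Rp k nm q r w' j' g') : Rp k nm p r (w + w') (j + j') (g * g') := by
  have := Rep.mul h h'
  unfold Rp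
  convert this using 1
  rw [Tz_neg q]; group

theorem Rep_Tz (m : ℤ) : Rep k nm m.natAbs 0 (Tz m : GG lev L) := by
  have h1 : ∀ n : ℕ, ∀ b : Bool, Rep k nm n 0 (Tz (if b then (n:ℤ) else -n) : GG lev L) := by
    intro n b
    induction n with
    | zero => exact ⟨[], by simp, by simp, by cases b <;> simp [Tz_zero]⟩
    | succ n ih =>
      have h2 : Rep k nm 1 0 (Tz (if b then 1 else -1) : GG lev L) :=
        ⟨[.inl b], by simp, by simp [anm], by simp [aval]; split_ifs <;> rfl⟩
      have := ih.mul h2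
      rw [← Tz_add] at this
      convert this using 2
      cases b <;> simp <;> ring
  rcases le_total 0 m with h | h
  · have := h1 m.natAbs true
    simpa [abs_of_nonneg h] using this
  · have := h1 m.natAbs false
    simpa [abs_of_nonpos h] using this

theorem Rp.move (p q : ℤ) : Rp k nm p q (q - p).natAbs 0 (1 : GG lev L) := by
  have := Rep_Tz (k := k) (nm := nm) (lev := lev) (L := L) (q - p)
  unfold Rp
  convert this using 1
  rw [mul_one, ← Tz_add]; congr 1; ring

theorem Rp.move' {p q r : ℤ} {w j : ℕ} {g : GG lev L} (h : Rp k nm p q w j g) :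
    Rp k nm p r (w + (r - q).natAbs) j g := by
  simpa using h.mul (Rp.move q r)

theorem Rp.editA (p : ℤ) (d : DD V L) :
    Rp k nm p p 1 (nm d.2.2) (layA (Pi.mulSingle p d) : GG lev L) := by
  refine ⟨[.inr (pA d)], by simp, by simp [anm, pA], ?_⟩
  simp only [List.map_cons, List.map_nil, List.prod_cons, List.prod_nil, mul_one, aval, Ed_pA]
  refine GG.ext' (fun s x => ?_) (by simp)
  simp only [GG.mul_κ, layA_κ, Tz_κ, one_mul, mul_one, Tz_c, Pi.mulSingle_apply, GG.mul_c]
  congr 1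
  have : x = 0 ↔ x - -p = p := by constructor <;> intro h <;> omega
  simp only [this]

theorem Rp.editB (hnm : nm 1 = 0) (p : ℤ) (d : DD V L) :
    Rp k nm p p 1 0 (layB k (Pi.mulSingle p d) : GG lev L) := by
  refine ⟨[.inr (pB d)], by simp, by simp [anm, pB, hnm], ?_⟩
  simp only [List.map_cons, List.map_nil, List.prod_cons, List.prod_nil, mul_one, aval, Ed_pB]
  refine GG.ext' (fun s x => ?_) (by simp)
  simp only [GG.mul_κ, layB_κ, Tz_κ, one_mul, mul_one, Tz_c, Pi.mulSingle_apply, GG.mul_c]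
  congr 1
  have : x - k s = 0 ↔ x - -p - k s = p := by constructor <;> intro h <;> omega
  simp only [this]

theorem mulIndicator_succ (P : ℤ → DD V L) (a : ℤ) (h : ℕ) :
    Set.mulIndicator (Set.Ico a (a + (h + 1 : ℕ))) P =
      Set.mulIndicator (Set.Ico a (a + h)) P * Pi.mulSingle (a + h) (P (a + h)) := by
  funext x
  simp only [Set.mulIndicator_apply, Pi.mul_apply, Pi.mulSingle_apply, Set.mem_Ico]
  push_cast
  by_cases h1 : x = a + h
  · subst h1
    simp
  · have : (a ≤ x ∧ x < a + (h + 1)) ↔ (a ≤ x ∧ x < a + h) := by omega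
    simp [h1, this]

theorem Rp.sweepA (P : ℤ → DD V L) (a : ℤ) (h : ℕ) :
    Rp k nm a (a + h) (2 * h) (∑ i ∈ Finset.range h, nm (P (a + i)).2.2)
      (layA (Set.mulIndicator (Set.Ico a (a + h)) P) : GG lev L) := by
  induction h with
  | zero =>
    have h0 : Set.mulIndicator (Set.Ico a (a + (0 : ℕ))) P = 1 := by funext x; simp
    rw [h0, map_one]
    simpa using Rp.move (k := k) (nm := nm) (lev := lev) (L := L) a a
  | succ h ih =>
    rw [mulIndicator_succ, map_mul, Finset.sum_range_succ]
    have := (ih.mul (Rp.editA (a + h) (P (a + h)))).move' (r := a + (h + 1 : ℕ))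
    refine this.mono ?_ le_rfl
    have : (a + ↑(h + 1) - (a + (h:ℤ))).natAbs = 1 := by push_cast; omega
    omega

theorem Rp.sweepB (hnm : nm 1 = 0) (P : ℤ → DD V L) (a : ℤ) (h : ℕ) :
    Rp k nm a (a + h) (2 * h) 0
      (layB k (Set.mulIndicator (Set.Ico a (a + h)) P) : GG lev L) := by
  induction h with
  | zero =>
    have h0 : Set.mulIndicator (Set.Ico a (a + (0 : ℕ))) P = 1 := by funext x; simp
    rw [h0, map_one]
    simpa using Rp.move (k := k) (nm := nm) (lev := lev) (L := L) a a
  | succ h ih =>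
    rw [mulIndicator_succ, map_mul]
    have := (ih.mul (Rp.editB hnm (a + h) (P (a + h)))).move' (r := a + (h + 1 : ℕ))
    refine this.mono ?_ le_rfl
    have : (a + ↑(h + 1) - (a + (h:ℤ))).natAbs = 1 := by push_cast; omega
    omega

end Global
end SE

/-! ## Part P3 -/
namespace SE

section
variable {V L : Type} [CommGroup V] [CommGroup L]

theorem getD_prod {M N : Type*} [Monoid M] [One N] (f : N → M) (hf : f 1 = 1) (l : List N) :
    ∀ ℓ, l.length ≤ ℓ → ((List.range ℓ).map (fun i => f (l.getD i 1))).prod = (l.map f).prod := by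
  induction l with
  | nil =>
    intro ℓ _
    simp [hf]
  | cons a l ih =>
    intro ℓ hℓ
    obtain ⟨m, rfl⟩ : ∃ m, ℓ = m + 1 := ⟨ℓ - 1, by simp at hℓ; omega⟩
    rw [List.range_succ_eq_map]
    simp only [List.map_cons, List.map_map, List.prod_cons]
    have := ih m (by simp at hℓ; omega)
    rw [← this]
    simp [Function.comp_def]

theorem getD_sum {N : Type*} [One N] (f : N → ℕ) (hf : f 1 = 0) (l : List N) :
    ∀ ℓ, l.length ≤ ℓ → ((List.range ℓ).map (fun i => f (l.getD i 1))).sum = (l.map f).sum :=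
  fun ℓ hℓ => by
    have := getD_prod (M := Multiplicative ℕ) (fun n => Multiplicative.ofAdd (f n)) (by simp [hf]) l ℓ hℓ
    have h := congrArg Multiplicative.toAdd this
    simpa [toAdd_list_sum, Function.comp_def] using h

/-- a history of edits with trivial total -/
def NullHist (E : Lev V) (nm : L → ℕ) (ℓ j : ℕ) (γ : Site E L) : Prop :=
  ∃ t : List (DD V L), t.length ≤ ℓ ∧ t.prod = 1 ∧ (t.map (st E)).prod = γ ∧
    (t.map (fun d => nm d.2.2)).sum ≤ j

theorem st_one (E : Lev V) : st E (1 : DD V L) = 1 := by simp [st]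

theorem NullHist.one (E : Lev V) (nm : L → ℕ) (ℓ j : ℕ) : NullHist E nm ℓ j (1 : Site E L) :=
  ⟨[], by simp, by simp, by simp, by simp⟩

variable {lev : ℕ → Lev V} (k : ℕ → ℕ) (nm : L → ℕ)

/-- stage for level `s` -/
noncomputable def stg (s : ℕ) (P : ℤ → DD V L) : GG lev L := layA P * layB k (fun x => P (x + k s))

theorem prod_κ (l : List (GG lev L)) (hl : ∀ g ∈ l, g.c = 0) :
    l.prod.c = 0 ∧ ∀ s x, l.prod.κ s x = (l.map (fun g => g.κ s x)).prod := by
  induction l with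
  | nil => simp
  | cons g l ih =>
    have h1 := ih fun g hg => hl g (List.mem_cons_of_mem _ hg)
    have h2 := hl g List.mem_cons_self
    simp [h1.1, h2, h1.2]

theorem stg_prod (s h : ℕ) (a : ℤ) (hk : ∀ s', s' ≠ s → (h : ℤ) ≤ |(k s' : ℤ) - k s|)
    (Ps : List (ℤ → DD V L)) (hsupp : ∀ P ∈ Ps, ∀ x, x ∉ Set.Ico a (a + h) → P x = 1)
    (hprod : Ps.prod = 1) :
    (Ps.map (stg k s)).prod =
      (inLev s (fun x => (Ps.map (fun P => st (lev s) (P x))).prod) : GG lev L) := by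
  have hc : ∀ g ∈ Ps.map (stg (lev := lev) k s), g.c = 0 := by
    intro g hg; obtain ⟨P, _, rfl⟩ := List.mem_map.1 hg; simp [stg]
  have h1 := prod_κ _ hc
  have hp : ∀ x, (Ps.map (fun P => P x)).prod = 1 := by
    intro x
    have h3 : Ps.prod x = (Ps.map (fun P => P x)).prod := Pi.list_prod_apply x Ps
    rw [← h3, hprod]; rfl
  refine GG.ext' (fun s' x => ?_) (by rw [h1.1]; rfl)
  rw [h1.2, List.map_map]
  by_cases hs : s' = s
  · subst hs
    simp only [inLev, MonoidHom.coe_mk, OneHom.coe_mk, Pi.mulSingle_eq_same]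
    congr 2
    funext P
    simp [stg, st]
  · simp only [inLev, MonoidHom.coe_mk, OneHom.coe_mk, Pi.mulSingle_eq_of_ne hs, Pi.one_apply]
    by_cases hx : x ∈ Set.Ico a (a + h)
    · have hx2 : x - k s' + k s ∉ Set.Ico a (a + h) := by
        intro hx2
        have := hk s' hs
        rw [Set.mem_Ico] at hx hx2
        rcases abs_cases ((k s' : ℤ) - k s) with h | h <;> omega
      have : Ps.map ((fun g : GG lev L => g.κ s' x) ∘ stg k s) =
          (Ps.map (fun P => P x)).map (sAC (E := lev s')) := by
        rw [List.map_map]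
        refine List.map_congr_left fun P hP => ?_
        simp [stg, hsupp P hP _ hx2]
      rw [this, ← map_list_prod, hp, map_one]
    · have : Ps.map ((fun g : GG lev L => g.κ s' x) ∘ stg k s) =
          (Ps.map (fun P => P (x - k s' + k s))).map (sB (E := lev s')) := by
        rw [List.map_map]
        refine List.map_congr_left fun P hP => ?_
        simp [stg, hsupp P hP _ hx]
      rw [this, ← map_list_prod, hp, map_one]

variable {k nm}

theorem Rp_stg (hnm : nm 1 = 0) (s h : ℕ) (a : ℤ) (hkh : k s ≤ 2 * h) (P : ℤ → DD V L)
    (hsupp : ∀ x, x ∉ Set.Ico a (a + h) → P x = 1) :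
    Rp k nm a a (10 * h) (∑ i ∈ Finset.range h, nm (P (a + i)).2.2) (stg k s P : GG lev L) := by
  have h1 : Set.mulIndicator (Set.Ico a (a + h)) P = P := by
    funext x; by_cases hx : x ∈ Set.Ico a (a + h)
    · simp [Set.mulIndicator_of_mem hx]
    · rw [Set.mulIndicator_of_notMem hx, hsupp x hx]
  have h2 : Set.mulIndicator (Set.Ico (a - k s) (a - k s + h)) (fun x => P (x + k s))
      = (fun x => P (x + k s)) := by
    funext x; by_cases hx : x ∈ Set.Ico (a - k s) (a - k s + h)
    · simp [Set.mulIndicator_of_mem hx]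
    · rw [Set.mulIndicator_of_notMem hx, hsupp]
      intro hx2; apply hx; rw [Set.mem_Ico] at *; omega
  have hA := (Rp.sweepA (k := k) (nm := nm) (lev := lev) P a h).move' (r := a - k s)
  have hB := (Rp.sweepB (k := k) (nm := nm) (lev := lev) hnm (fun x => P (x + k s)) (a - k s) h).move'
    (r := a)
  have := hA.mul hB
  rw [h1, h2] at this
  refine this.mono ?_ (by simp)
  omega

theorem Rp.listProd {p : ℤ} {w : ℕ} (l : List (GG lev L)) (f : GG lev L → ℕ)
    (h : ∀ g ∈ l, Rp k nm p p w (f g) g) :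
    Rp k nm p p (w * l.length) (l.map f).sum l.prod := by
  induction l with
  | nil => simpa using Rp.move (k := k) (nm := nm) (lev := lev) (L := L) p p
  | cons g l ih =>
    have := (h g List.mem_cons_self).mul (ih fun g hg => h g (List.mem_cons_of_mem _ hg))
    simp only [List.prod_cons, List.map_cons, List.sum_cons, List.length_cons]
    exact this.mono (by ring_nf; rfl) le_rfl

theorem Rp.listProd' {ι : Type*} {p : ℤ} {w : ℕ} (l : List ι) (F : ι → GG lev L) (f : ι → ℕ)
    (h : ∀ g ∈ l, Rp k nm p p w (f g) (F g)) :
    Rp k nm p p (w * l.length) (l.map f).sum (l.map F).prod := by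
  induction l with
  | nil => simpa using Rp.move (k := k) (nm := nm) (lev := lev) (L := L) p p
  | cons g l ih =>
    have := (h g List.mem_cons_self).mul (ih fun g hg => h g (List.mem_cons_of_mem _ hg))
    simp only [List.prod_cons, List.map_cons, List.sum_cons, List.length_cons]
    exact this.mono (by ring_nf; rfl) le_rfl

theorem Rp_block (hnm : nm 1 = 0) (s h ℓ : ℕ) (a : ℤ) (hkh : k s ≤ 2 * h)
    (hk : ∀ s', s' ≠ s → (h : ℤ) ≤ |(k s' : ℤ) - k s|)
    (γ : ℤ → Site (lev s) L) (j : ℤ → ℕ)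
    (hγ : ∀ x ∈ Set.Ico a (a + h), NullHist (lev s) nm ℓ (j x) (γ x)) :
    Rp k nm a a (10 * h * ℓ) (∑ i ∈ Finset.range h, j (a + i))
      (inLev s (Set.mulIndicator (Set.Ico a (a + h)) γ) : GG lev L) := by
  have h0 : ∀ x, ∃ t : List (DD V L), t.length ≤ ℓ ∧ t.prod = 1 ∧
      (t.map (st (lev s))).prod = Set.mulIndicator (Set.Ico a (a + h)) γ x ∧
      (x ∈ Set.Ico a (a + h) → (t.map (fun d => nm d.2.2)).sum ≤ j x) ∧
      (x ∉ Set.Ico a (a + h) → t = []) := by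
    intro x
    by_cases hx : x ∈ Set.Ico a (a + h)
    · obtain ⟨t, h1, h2, h3, h4⟩ := hγ x hx
      exact ⟨t, h1, h2, by rw [Set.mulIndicator_of_mem hx, h3], fun _ => h4, fun h => absurd hx h⟩
    · exact ⟨[], by simp, by simp, by simp [Set.mulIndicator_of_notMem hx], fun h => absurd h hx,
        fun _ => rfl⟩
  choose t ht1 ht2 ht3 ht4 ht5 using h0
  let P : ℕ → ℤ → DD V L := fun i x => (t x).getD i 1
  let Ps : List (ℤ → DD V L) := (List.range ℓ).map P
  have hsupp : ∀ P ∈ Ps, ∀ x, x ∉ Set.Ico a (a + h) → P x = 1 := by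
    intro Q hQ x hx
    obtain ⟨i, _, rfl⟩ := List.mem_map.1 hQ
    simp [P, ht5 x hx]
  have hprod : Ps.prod = 1 := by
    funext x
    rw [Pi.list_prod_apply, List.map_map]
    have := getD_prod (fun d : DD V L => d) rfl (t x) ℓ (ht1 x)
    simp only [Function.comp_def, P]
    rw [this]; simpa using ht2 x
  have hS := stg_prod (lev := lev) k s h a hk Ps hsupp hprod
  have hγ' : (fun x => (Ps.map (fun P => st (lev s) (P x))).prod) =
      Set.mulIndicator (Set.Ico a (a + h)) γ := by
    funext x
    rw [List.map_map, ← ht3 x]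
    exact getD_prod (st (lev s)) (st_one _) (t x) ℓ (ht1 x)
  rw [hγ'] at hS
  rw [← hS]
  have := Rp.listProd' (k := k) (nm := nm) (lev := lev) (p := a) (w := 10 * h) Ps (stg k s)
    (fun P => ∑ i ∈ Finset.range h, nm (P (a + i)).2.2)
    (fun P hP => Rp_stg hnm s h a hkh P (hsupp P hP))
  refine this.mono (by simp [Ps]) ?_
  have hsum : (Ps.map (fun P => ∑ i ∈ Finset.range h, nm (P (a + i)).2.2)).sum =
      ∑ i ∈ Finset.range h, (Ps.map (fun P => nm (P (a + i)).2.2)).sum := by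
    clear_value Ps
    clear this hγ' hS hprod hsupp
    induction Ps with
    | nil => simp
    | cons P Ps ih => simp [ih, Finset.sum_add_distrib]
  rw [hsum]
  refine Finset.sum_le_sum fun i hi => ?_
  rw [List.map_map]
  have h6 := getD_sum (fun d : DD V L => nm d.2.2) hnm (t (a + i)) ℓ (ht1 _)
  have h7 := ht4 (a + i) (by rw [Finset.mem_range] at hi; rw [Set.mem_Ico]; omega)
  simp only [Function.comp_def, P]
  rw [h6]; exact h7

theorem Rp_level (hnm : nm 1 = 0) (s h : ℕ) (a : ℤ) (hkh : k s ≤ 2 * h)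
    (hk : ∀ s', s' ≠ s → (h : ℤ) ≤ |(k s' : ℤ) - k s|)
    (γ : ℤ → Site (lev s) L) (j : ℤ → ℕ) (ℓ : ℕ → ℕ) (J : ℕ)
    (hγ : ∀ i < J, ∀ x ∈ Set.Ico (a + (i * h : ℕ)) (a + (i * h : ℕ) + h),
      NullHist (lev s) nm (ℓ i) (j x) (γ x)) :
    Rp k nm a (a + (J * h : ℕ)) (∑ i ∈ Finset.range J, (10 * h * ℓ i + h))
      (∑ i ∈ Finset.range (J * h), j (a + i))
      (inLev s (Set.mulIndicator (Set.Ico a (a + (J * h : ℕ))) γ) : GG lev L) := by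
  induction J with
  | zero =>
    have h0 : Set.mulIndicator (Set.Ico a (a + (0 * h : ℕ))) γ = 1 := by funext x; simp
    rw [h0, map_one]
    simpa using Rp.move (k := k) (nm := nm) (lev := lev) (L := L) a a
  | succ J ih =>
    have h1 := ih fun i hi => hγ i (by omega)
    have h2 := Rp_block (lev := lev) (k := k) hnm s h (ℓ J) (a + (J * h : ℕ)) hkh hk γ j (hγ J (by omega))
    have h3 := (h1.mul h2).move' (r := a + ((J+1) * h : ℕ))
    have h4 : Set.mulIndicator (Set.Ico a (a + ((J + 1) * h : ℕ))) γ =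
        Set.mulIndicator (Set.Ico a (a + (J * h : ℕ))) γ *
        Set.mulIndicator (Set.Ico (a + (J * h : ℕ)) (a + (J * h : ℕ) + h)) γ := by
      have hu : Set.Ico a (a + ((J + 1) * h : ℕ)) = Set.Ico a (a + (J * h : ℕ)) ∪
          Set.Ico (a + (J * h : ℕ)) (a + (J * h : ℕ) + h) := by
        rw [Set.Ico_union_Ico_eq_Ico (by omega) (by omega)]
        congr 1; push_cast; ring
      rw [hu, Set.mulIndicator_union_of_disjoint]
      · rfl
      · rw [Set.disjoint_left]; intro x hx hx2; rw [Set.mem_Ico] at hx hx2; omega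
    rw [h4, map_mul]
    refine h3.mono ?_ ?_
    · rw [Finset.sum_range_succ]
      have : (a + ((J + 1) * h : ℕ) - (a + (J * h : ℕ)) : ℤ) = h := by push_cast; ring
      rw [this]; simp; omega
    · rw [show (J + 1) * h = J * h + h by ring, Finset.sum_range_add]
      refine add_le_add le_rfl (le_of_eq (Finset.sum_congr rfl fun i _ => ?_))
      congr 1; push_cast; ring

end
end SE

/-! ## Part P3T -/
namespace SE

section
variable {V L : Type} [CommGroup V] [CommGroup L] (E : Lev V)

/-- extended finite group -/
abbrev ZZ := E.Y × V × V

/-- letter without lamp -/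
noncomputable def zt (p : V × V) : ZZ E := (E.A p.1 * E.B p.2, p.1, p.2)

noncomputable def visF : ZZ E → List (V × V) → Finset (ZZ E)
  | z, [] => {z}
  | z, p :: l => insert z (visF (z * zt E p) l)

theorem visF_start (z : ZZ E) (l : List (V × V)) : z ∈ visF E z l := by
  cases l <;> simp [visF]

theorem visF_append (l₁ l₂ : List (V × V)) : ∀ z : ZZ E,
    visF E z (l₁ ++ l₂) = visF E z l₁ ∪ visF E (z * (l₁.map (zt E)).prod) l₂ := by
  induction l₁ with
  | nil =>
    intro z
    simp only [List.nil_append, List.map_nil, List.prod_nil, mul_one, visF]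
    rw [eq_comm, Finset.union_eq_right]
    simpa using visF_start E z l₂
  | cons p l ih =>
    intro z
    simp [visF, ih, mul_assoc]

theorem visF_split (l : List (V × V)) : ∀ z f : ZZ E, f ∈ visF E z l →
    ∃ l₁ l₂, l = l₁ ++ l₂ ∧ z * (l₁.map (zt E)).prod = f := by
  induction l with
  | nil => intro z f h; simp [visF] at h; exact ⟨[], [], rfl, by simp [h]⟩
  | cons p l ih =>
    intro z f h
    rw [visF, Finset.mem_insert] at h
    rcases h with h | h
    · exact ⟨[], p :: l, rfl, by simp [h]⟩
    · obtain ⟨l₁, l₂, h1, h2⟩ := ih _ _ h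
      exact ⟨p :: l₁, l₂, by simp [h1], by simp [← h2, mul_assoc]⟩

theorem detour (p : V × V) : zt E p * zt E (1, p.2⁻¹) * zt E (p.1⁻¹, 1) = 1 := by
  simp [zt, Prod.ext_iff, mul_assoc]

theorem tour_exists [Fintype V] : ∃ l : List (V × V), (l.map (zt E)).prod = 1 ∧
    l.length ≤ 3 * Fintype.card (ZZ E) ∧
    ∀ z ∈ visF E 1 l, ∀ p, z * zt E p ∈ visF E 1 l := by
  let P : ℕ → Prop := fun m => ∃ l : List (V × V), (l.map (zt E)).prod = 1 ∧ l.length ≤ 3 * m ∧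
    m ≤ (visF E 1 l).card
  have hP0 : P 0 := ⟨[], by simp, by simp, by simp⟩
  set m := Nat.findGreatest P (Fintype.card (ZZ E)) with hm
  have hPm : P m := Nat.findGreatest_spec (Nat.zero_le _) hP0
  obtain ⟨l, h1, h2, h3⟩ := hPm
  have hmle : m ≤ Fintype.card (ZZ E) := Nat.findGreatest_le _
  refine ⟨l, h1, by omega, ?_⟩
  intro z hz p
  by_contra hn
  obtain ⟨l₁, l₂, rfl, hz2⟩ := visF_split E l 1 z hz
  rw [one_mul] at hz2
  have hd := detour E p
  set d : List (V × V) := [p, (1, p.2⁻¹), (p.1⁻¹, 1)] with hddef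
  have hdp : (d.map (zt E)).prod = 1 := by simp [hddef, ← mul_assoc, hd]
  have hPm1 : P (m + 1) := by
    refine ⟨l₁ ++ (d ++ l₂), ?_, ?_, ?_⟩
    · simp only [List.map_append, List.prod_append, hdp, one_mul]
      simpa using h1
    · simp [hddef] at h2 ⊢; omega
    · have hsub : insert (z * zt E p) (visF E 1 (l₁ ++ l₂)) ⊆ visF E 1 (l₁ ++ (d ++ l₂)) := by
        intro f hf
        rw [Finset.mem_insert] at hf
        rw [visF_append, visF_append, hdp]
        simp only [mul_one, one_mul, hz2]
        rcases hf with rfl | hf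
        · simp [hddef, visF]
        · rw [visF_append] at hf
          simp only [one_mul, hz2] at hf
          simp only [Finset.mem_union] at hf ⊢
          tauto
      have := Finset.card_le_card hsub
      rw [Finset.card_insert_of_notMem hn] at this
      omega
  have hcard : m + 1 ≤ Fintype.card (ZZ E) := by
    obtain ⟨l', _, _, h5⟩ := hPm1
    exact h5.trans (Finset.card_le_univ _)
  have := Nat.le_findGreatest hcard hPm1
  omega

/-- write the lamps along a tour -/
noncomputable def wr : ZZ E → (E.K → L) → List (V × V) → List (DD V L)
  | z, ψ, [] => [(1, 1, ψ (z.1 • E.o))]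
  | z, ψ, p :: l => (p.1, p.2, ψ (z.1 • E.o)) ::
      wr (z * zt E p) (Function.update ψ (z.1 • E.o) 1) l

theorem wr_length (l : List (V × V)) : ∀ (z : ZZ E) (ψ : E.K → L), (wr E z ψ l).length = l.length + 1 := by
  induction l with
  | nil => intro z ψ; rfl
  | cons p l ih => intro z ψ; simp [wr, ih]

theorem st_step (y : E.Y) (d : DD V L) : (⟨fun _ => 1, y⟩ : Site E L) * st E d =
    ⟨Pi.mulSingle (y • E.o) d.2.2, 1⟩ * ⟨fun _ => 1, y * (E.A d.1 * E.B d.2.1)⟩ := by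
  ext κ
  · simp [st, sAC, sB, Pi.mulSingle_apply, inv_smul_eq_iff]
  · simp [st, sAC, sB, mul_assoc]

theorem wr_prod (l : List (V × V)) : ∀ (z : ZZ E) (ψ : E.K → L),
    (∀ κ, ψ κ ≠ 1 → ∃ f ∈ visF E z l, f.1 • E.o = κ) →
    (⟨fun _ => 1, z.1⟩ : Site E L) * ((wr E z ψ l).map (st E)).prod =
      ⟨ψ, (z * (l.map (zt E)).prod).1⟩ := by
  induction l with
  | nil =>
    intro z ψ h
    simp only [wr, List.map_cons, List.map_nil, List.prod_cons, List.prod_nil, mul_one]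
    rw [st_step]
    ext κ
    · simp only [Site.mul_φ, mul_one, Pi.mulSingle_apply]
      split_ifs with h1
      · rw [h1]
      · by_contra hne
        obtain ⟨f, hf, hf2⟩ := h κ (Ne.symm hne)
        simp [visF] at hf
        exact h1 (by rw [← hf2, hf])
    · simp
  | cons p l ih =>
    intro z ψ h
    simp only [wr, List.map_cons, List.prod_cons]
    rw [← mul_assoc, st_step, mul_assoc]
    have := ih (z * zt E p) (Function.update ψ (z.1 • E.o) 1) ?_
    · simp only [zt, Prod.fst_mul] at this ⊢
      rw [this]
      ext κ
      · simp only [Site.mul_φ, Pi.mulSingle_apply, inv_one, one_smul, Function.update_apply]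
        split_ifs with h1
        · simp [h1]
        · simp
      · simp [mul_assoc]
    · intro κ hκ
      rw [Function.update_apply] at hκ
      split_ifs at hκ with h1
      · exact absurd rfl hκ
      · obtain ⟨f, hf, hf2⟩ := h κ hκ
        rw [visF, Finset.mem_insert] at hf
        rcases hf with hf | hf
        · exact absurd (by rw [← hf2, hf]) h1
        · exact ⟨f, hf, hf2⟩

theorem wr_nm (nm : L → ℕ) (hnm : nm 1 = 0) (l : List (V × V)) : ∀ (z : ZZ E) (ψ : E.K → L),
    ((wr E z ψ l).map (fun d => nm d.2.2)).sum ≤ ∑ κ, nm (ψ κ) := by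
  have key : ∀ (ψ : E.K → L) κ₀, nm (ψ κ₀) + ∑ κ, nm (Function.update ψ κ₀ 1 κ) = ∑ κ, nm (ψ κ) := by
    intro ψ κ₀
    rw [← Finset.add_sum_erase _ _ (Finset.mem_univ κ₀),
      ← Finset.add_sum_erase Finset.univ (fun κ => nm (ψ κ)) (Finset.mem_univ κ₀)]
    simp only [Function.update_self, hnm, zero_add]
    congr 1
    refine Finset.sum_congr rfl fun κ hκ => ?_
    rw [Function.update_of_ne (Finset.ne_of_mem_erase hκ)]
  induction l with
  | nil =>
    intro z ψ
    have := key ψ (z.1 • E.o)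
    simp [wr]; omega
  | cons p l ih =>
    intro z ψ
    have h1 := key ψ (z.1 • E.o)
    have h2 := ih (z * zt E p) (Function.update ψ (z.1 • E.o) 1)
    simp only [wr, List.map_cons, List.sum_cons]
    omega

theorem wr_V (l : List (V × V)) : ∀ (z : ZZ E) (ψ : E.K → L),
    ((wr E z ψ l).prod.1, (wr E z ψ l).prod.2.1) = ((l.map (zt E)).prod).2 := by
  induction l with
  | nil => intro z ψ; simp [wr]
  | cons p l ih =>
    intro z ψ
    have := ih (z * zt E p) (Function.update ψ (z.1 • E.o) 1)
    simp only [wr, List.prod_cons, List.map_cons, Prod.snd_mul, ← this]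
    ext <;> simp [zt]

/-- total lamp -/
noncomputable def totL : Site E L →* L where
  toFun f := ∏ κ, f.φ κ
  map_one' := by simp
  map_mul' f g := by
    simp only [Site.mul_φ, Finset.prod_mul_distrib]
    congr 1
    exact Equiv.prod_comp (MulAction.toPerm (f.y⁻¹) : Equiv.Perm E.K) g.φ

theorem totL_st (d : DD V L) : totL E (st E d) = d.2.2 := by
  simp only [totL, MonoidHom.coe_mk, OneHom.coe_mk, st, Site.mul_φ, sAC_φ, sB_φ, mul_one]
  simp

theorem totL_list (t : List (DD V L)) : totL E (t.map (st E)).prod = t.prod.2.2 := by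
  induction t with
  | nil => simp
  | cons d t ih => simp [totL_st, ih]

theorem hist_supp (F : Finset (ZZ E)) (hF : ∀ z ∈ F, ∀ p, z * zt E p ∈ F) (t : List (DD V L)) :
    ∀ z ∈ F, (∀ κ, ((⟨fun _ => 1, z.1⟩ : Site E L) * (t.map (st E)).prod).φ κ ≠ 1 →
      ∃ f ∈ F, f.1 • E.o = κ) ∧ z * ((t.map (fun d => zt E (d.1, d.2.1))).prod) ∈ F := by
  induction t with
  | nil => intro z hz; simp [hz]
  | cons d t ih =>
    intro z hz
    have h1 := ih (z * zt E (d.1, d.2.1)) (hF z hz _)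
    constructor
    · intro κ hκ
      simp only [List.map_cons, List.prod_cons] at hκ
      rw [← mul_assoc, st_step, mul_assoc, Site.mul_φ] at hκ
      by_cases h2 : κ = z.1 • E.o
      · exact ⟨z, hz, h2.symm⟩
      · simp only [Pi.mulSingle_apply, h2, if_false, one_mul, inv_one, one_smul] at hκ
        exact h1.1 κ hκ
    · have := h1.2
      simpa [mul_assoc] using this

theorem hist_zt (t : List (DD V L)) : (t.map (fun d => zt E (d.1, d.2.1))).prod =
    ((t.map (st E)).prod.y, t.prod.1, t.prod.2.1) := by
  induction t with
  | nil => rfl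
  | cons d t ih =>
    simp only [List.map_cons, List.prod_cons, ih]
    ext <;> simp [zt, st, sAC_y, sB_y]

theorem NullHist.tour [Fintype V] {nm : L → ℕ} (hnm : nm 1 = 0) {ℓ j : ℕ} {γ : Site E L}
    (h : NullHist E nm ℓ j γ) :
    NullHist E nm (7 * Fintype.card (ZZ E)) (∑ κ, nm (γ.φ κ)) γ := by
  obtain ⟨t, _, ht1, ht2, _⟩ := h
  obtain ⟨l, hl1, hl2, hl3⟩ := tour_exists E
  have hs := hist_supp E (visF E 1 l) hl3 t 1 (visF_start E 1 l)
  rw [hist_zt, ht1, ht2, one_mul] at hs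
  have h1s : (⟨fun _ => 1, (1 : ZZ E).1⟩ : Site E L) = 1 := rfl
  rw [h1s, one_mul] at hs
  obtain ⟨l₁, l₂, hl, hl4⟩ := visF_split E l 1 _ hs.2
  rw [one_mul] at hl4
  have hprod : ((l ++ l₁).map (zt E)).prod = (γ.y, 1, 1) := by
    rw [List.map_append, List.prod_append, hl1, one_mul, hl4]; rfl
  have hw := wr_prod E (l ++ l₁) 1 γ.φ ?_
  · rw [h1s, one_mul, one_mul, hprod] at hw
    refine ⟨wr E 1 γ.φ (l ++ l₁), ?_, ?_, hw, wr_nm E nm hnm _ _ _⟩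
    · rw [wr_length, List.length_append]
      have : l₁.length ≤ l.length := by rw [hl]; simp
      have : 0 < Fintype.card (ZZ E) := Fintype.card_pos
      omega
    · have hv := wr_V E (l ++ l₁) 1 γ.φ
      rw [hprod] at hv
      have ht := totL_list E (wr E 1 γ.φ (l ++ l₁))
      have ht' := totL_list E t
      rw [ht2, ht1] at ht'
      rw [hw] at ht
      have h5 : (wr E 1 γ.φ (l ++ l₁)).prod.2.2 = 1 := by
        rw [← ht]; exact ht'
      simp only [Prod.mk.injEq] at hv
      ext
      · exact hv.1
      · exact hv.2
      · exact h5
  · intro κ hκ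
    obtain ⟨f, hf, hf2⟩ := hs.1 κ hκ
    exact ⟨f, by rw [visF_append]; exact Finset.mem_union_left _ hf, hf2⟩

end
end SE

/-! ## Part P4 -/
namespace SE

section
variable {V L : Type} [CommGroup V] [CommGroup L]

/-- cursor -/
def cu : List (Atm V L) → ℤ
  | [] => 0
  | .inl b :: u => cu u + (if b then 1 else -1)
  | .inr _ :: u => cu u

/-- maximal modulus of the cursor -/
def Ru : List (Atm V L) → ℕ
  | [] => 0
  | a :: u => max (Ru u) (cu (a :: u)).natAbs

/-- total edit at every site -/
noncomputable def Pt : List (Atm V L) → ℤ → DD V L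
  | [] => 1
  | .inl _ :: u => Pt u
  | .inr d :: u => Pt u * Pi.mulSingle (cu u) d

def edH (c : ℤ) (d : DD V L) : List (ℤ × (ℤ → DD V L)) → List (ℤ × (ℤ → DD V L))
  | [] => []
  | (ρ, P) :: l => (ρ, P * Pi.mulSingle c d) :: l

def mvH (r : ℕ) (c : ℤ) : List (ℤ × (ℤ → DD V L)) → List (ℤ × (ℤ → DD V L))
  | [] => []
  | (ρ, P) :: l => if |c - ρ| < r then (ρ, P) :: l else (c, 1) :: (ρ, P) :: l

/-- segments of the trajectory at scale `r` -/
noncomputable def sg (r : ℕ) : List (Atm V L) → List (ℤ × (ℤ → DD V L))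
  | [] => [(0, 1)]
  | .inl b :: u => mvH r (cu (V := V) (L := L) (.inl b :: u)) (sg r u)
  | .inr d :: u => edH (cu u) d (sg r u)

variable {lev : ℕ → Lev V} (k : ℕ → ℕ)

theorem XX_c (u : List (Atm V L)) : (XX (aval (lev := lev) k) u).c = cu u := by
  induction u with
  | nil => rfl
  | cons a u ih =>
    rcases a with b | d
    · simp only [XX, GG.mul_c, ih, cu, aval]; split_ifs <;> simp
    · simp [XX, ih, cu, aval]

theorem XX_κ_move (b : Bool) (u : List (Atm V L)) (s x) :
    (XX (aval (lev := lev) k) (.inl b :: u)).κ s x = (XX (aval (lev := lev) k) u).κ s x := by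
  simp only [XX, GG.mul_κ, aval]; split_ifs <;> simp

theorem XX_κ_edit (d : DD V L) (u : List (Atm V L)) (s x) :
    (XX (aval (lev := lev) k) (.inr d :: u)).κ s x = (XX (aval (lev := lev) k) u).κ s x *
      (sAC ((Pi.mulSingle (cu u) d : ℤ → DD V L) x) *
        sB ((Pi.mulSingle (cu u) d : ℤ → DD V L) (x - k s))) := by
  simp only [XX, GG.mul_κ, aval, Ed_κ, XX_c, Pi.mulSingle_apply]
  have h1 : x - cu u = 0 ↔ x = cu u := by omega
  have h2 : x - cu u - k s = 0 ↔ x - k s = cu u := by omega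
  simp only [h1, h2]

theorem Ru_cu (u : List (Atm V L)) : (cu u).natAbs ≤ Ru u := by
  cases u with
  | nil => simp [cu]
  | cons a u => simp [Ru]

theorem Ru_mono (a : Atm V L) (u : List (Atm V L)) : Ru u ≤ Ru (a :: u) := by simp [Ru]

theorem Pt_supp (u : List (Atm V L)) : ∀ x : ℤ, Ru u < x.natAbs → Pt u x = 1 := by
  induction u with
  | nil => intro x _; rfl
  | cons a u ih =>
    intro x hx
    have h1 := ih x (lt_of_le_of_lt (Ru_mono a u) hx)
    rcases a with b | d
    · exact h1
    · have : x ≠ cu u := by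
        rintro rfl
        have := Ru_cu u
        have := Ru_mono (.inr d) u
        omega
      simp [Pt, h1, Pi.mulSingle_eq_of_ne this]

/-- sites which see only one side -/
theorem κ_common (hk : ∀ s, 0 < k s) (u : List (Atm V L)) (s) (x : ℤ)
    (h : Ru u < x.natAbs ∨ Ru u < (x - k s).natAbs) :
    (XX (aval (lev := lev) k) u).κ s x = sB (Pt u (x - k s)) * sAC (Pt u x) := by
  induction u with
  | nil => simp [XX, Pt]
  | cons a u ih =>
    have hm := Ru_mono a u
    have h1 := ih (by omega)
    rcases a with b | d
    · rw [XX_κ_move, h1]; rfl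
    · rw [XX_κ_edit, h1]
      have hc := Ru_cu u
      have hks := hk s
      by_cases hx : x = cu u
      · have hx2 : x - k s ≠ cu u := by omega
        simp only [Pt, Pi.mul_apply, Pi.mulSingle_eq_of_ne hx2, map_one, mul_one, map_mul, mul_assoc]
      · simp only [Pt, Pi.mul_apply, Pi.mulSingle_eq_of_ne hx, map_one, mul_one, one_mul, map_mul]
        by_cases hx2 : x - k s = cu u
        · have hx3 : Pt u x = 1 := Pt_supp u x (by rw [hx2] at h; omega)
          rw [hx3]; simp
        · simp [Pi.mulSingle_eq_of_ne hx2]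

/-- the site edit produced by a segment -/
def mix (m : ℕ) (P : ℤ → DD V L) (x : ℤ) : DD V L := ((P x).1, (P (x - m)).2.1, (P x).2.2)

theorem st_mix (E : Lev V) (m : ℕ) (P : ℤ → DD V L) (x : ℤ) :
    st E (mix m P x) = sAC (P x) * sB (P (x - m)) := rfl

theorem sg_inv (r : ℕ) (hr : 0 < r) (u : List (Atm V L)) :
    ∃ ρ P l, sg r u = (ρ, P) :: l ∧ |cu u - ρ| < r ∧
      ∀ p ∈ sg r u, ∀ x : ℤ, (r : ℤ) ≤ |x - p.1| → p.2 x = 1 := by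
  induction u with
  | nil =>
    refine ⟨0, 1, [], rfl, by simp [cu, hr], ?_⟩
    intro p hp x _; simp [sg] at hp; simp [hp]
  | cons a u ih =>
    obtain ⟨ρ, P, l, h1, h2, h3⟩ := ih
    rcases a with b | d
    · by_cases hh : |cu (V := V) (L := L) (.inl b :: u) - ρ| < r
      · have : sg r (.inl b :: u) = (ρ, P) :: l := by simp [sg, h1, mvH, hh]
        exact ⟨ρ, P, l, this, hh, by rw [this, ← h1]; exact h3⟩
      · have : sg r (.inl b :: u) = (cu (V := V) (L := L) (.inl b :: u), 1) :: (ρ, P) :: l := by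
          simp [sg, h1, mvH, hh]
        refine ⟨_, _, _, this, by simp [hr], ?_⟩
        rw [this, ← h1]
        intro p hp x hx
        rcases List.mem_cons.1 hp with rfl | hp
        · rfl
        · exact h3 p hp x hx
    · have : sg r (.inr d :: u) = (ρ, P * Pi.mulSingle (cu u) d) :: l := by simp [sg, h1, edH]
      refine ⟨_, _, _, this, h2, ?_⟩
      rw [this]
      intro p hp x hx
      rcases List.mem_cons.1 hp with rfl | hp
      · have h4 := h3 (ρ, P) (by rw [h1]; exact List.mem_cons_self) x hx
        have : x ≠ cu u := by rintro rfl; simp at hx; omega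
        simp only at h4
        simp [h4, Pi.mulSingle_eq_of_ne this]
      · exact h3 p (by rw [h1]; exact List.mem_cons_of_mem _ hp) x hx

theorem XX_eq_prod {G α : Type*} [Group G] (f : α → G) (l : List α) :
    XX f l = (l.reverse.map f).prod := by
  induction l with
  | nil => rfl
  | cons a l ih => simp [XX, ih]

theorem sg_Pt (r : ℕ) (hr : 0 < r) (u : List (Atm V L)) :
    XX (fun p : ℤ × (ℤ → DD V L) => p.2) (sg r u) = Pt u := by
  induction u with
  | nil => simp [sg, XX, Pt]
  | cons a u ih =>
    obtain ⟨ρ, P, l, h1, h2, h3⟩ := sg_inv r hr u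
    rw [h1] at ih
    rcases a with b | d
    · simp only [sg, h1, mvH, Pt]
      split_ifs
      · exact ih
      · rw [← ih]; simp [XX]
    · simp only [sg, h1, edH, Pt]
      rw [← ih]; simp [XX, mul_assoc]

theorem sg_κ (r : ℕ) (hr : 0 < r) (s : ℕ) (hk : 2 * r ≤ k s) (u : List (Atm V L)) (x : ℤ) :
    XX (fun p : ℤ × (ℤ → DD V L) => st (lev s) (mix (k s) p.2 x)) (sg r u) =
      (XX (aval (lev := lev) k) u).κ s x := by
  induction u with
  | nil => simp [sg, XX, st_mix]
  | cons a u ih =>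
    obtain ⟨ρ, P, l, h1, h2, h3⟩ := sg_inv r hr u
    rw [h1] at ih
    rcases a with b | d
    · rw [XX_κ_move, ← ih]
      simp only [sg, h1, mvH]
      split_ifs
      · rfl
      · simp [XX, st_mix]
    · rw [XX_κ_edit, ← ih]
      simp only [sg, h1, edH, XX, mul_assoc]
      congr 1
      simp only [st_mix, Pi.mul_apply, map_mul]
      by_cases hx : x = cu u
      · have hP : P (x - k s) = 1 := by
          refine h3 (ρ, P) (by rw [h1]; exact List.mem_cons_self) _ ?_
          simp only
          rcases abs_cases (cu u - ρ) with h | h <;>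
          rcases abs_cases (x - k s - ρ) with h' | h' <;> omega
        have hx2 : x - k s ≠ cu u := by omega
        simp [hP, Pi.mulSingle_eq_of_ne hx2]
      · simp [Pi.mulSingle_eq_of_ne hx, mul_assoc]

theorem prod_filter_one {G α : Type*} [Monoid G] (f : α → G) (p : α → Prop) (l : List α)
    (h : ∀ a ∈ l, ¬ p a → f a = 1) : ((l.filter (fun a => p a)).map f).prod = (l.map f).prod := by
  induction l with
  | nil => rfl
  | cons a l ih =>
    have h1 := ih fun b hb => h b (List.mem_cons_of_mem _ hb)
    by_cases hp : p a
    · simp [List.filter_cons, hp, h1]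
    · simp [List.filter_cons, hp, h1, h a List.mem_cons_self hp]

theorem sum_filter_le {α : Type*} (f : α → ℕ) (p : α → Prop) (l : List α) :
    ((l.filter (fun a => p a)).map f).sum ≤ (l.map f).sum := by
  induction l with
  | nil => simp
  | cons a l ih =>
    by_cases hp : p a
    · simp [List.filter_cons, hp, ih]
    · simp [List.filter_cons, hp]; omega

/-- defect from the common part -/
noncomputable def gam (s : ℕ) (u : List (Atm V L)) (x : ℤ) : Site (lev s) L :=
  (XX (aval (lev := lev) k) u).κ s x * st (lev s) (mix (k s) (fun x => (Pt u x)⁻¹) x)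

theorem gam_mul (s : ℕ) (u : List (Atm V L)) (x : ℤ) :
    gam (lev := lev) k s u x * (sB (Pt u (x - k s)) * sAC (Pt u x)) =
      (XX (aval (lev := lev) k) u).κ s x := by
  simp [gam, st_mix, mul_assoc]

theorem gam_eq_one (hk : ∀ s, 0 < k s) (u : List (Atm V L)) (s) (x : ℤ)
    (h : Ru u < x.natAbs ∨ Ru u < (x - k s).natAbs) : gam (lev := lev) k s u x = 1 := by
  have := gam_mul (lev := lev) k s u x
  rw [κ_common k hk u s x h] at this
  simpa using this

theorem gam_null (nm : L → ℕ) (hnm : ∀ a, nm a⁻¹ = nm a) (r : ℕ) (hr : 0 < r) (s : ℕ)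
    (hk : 2 * r ≤ k s) (u : List (Atm V L)) (x : ℤ) (p : ℤ × (ℤ → DD V L) → Prop)
    (hp : ∀ q ∈ sg r u, ¬ p q → mix (k s) q.2 x = 1) :
    NullHist (lev s) nm (((sg r u).filter (fun q => p q)).length + 1)
      (((sg r u).map (fun q => nm (q.2 x).2.2)).sum + nm (Pt u x).2.2) (gam (lev := lev) k s u x) := by
  have hp' : ∀ q ∈ (sg r u).reverse, ¬ p q → mix (k s) q.2 x = 1 :=
    fun q hq => hp q (List.mem_reverse.1 hq)
  refine ⟨((sg r u).reverse.filter (fun q => p q)).map (fun q => mix (k s) q.2 x) ++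
    [mix (k s) (fun x => (Pt u x)⁻¹) x], ?_, ?_, ?_, ?_⟩
  · simp [List.filter_reverse]
  · rw [List.prod_append, prod_filter_one _ _ _ hp']
    have h1 : ((sg r u).reverse.map (fun q => mix (k s) q.2 x)).prod = mix (k s) (Pt u) x := by
      rw [← sg_Pt r hr u, XX_eq_prod]
      generalize (sg r u).reverse = l
      induction l with
      | nil => rfl
      | cons a l ih => simp only [List.map_cons, List.prod_cons, ih]; rfl
    rw [h1]
    ext <;> simp [mix]
  · rw [List.map_append, List.prod_append, List.map_map]
    have h2 := prod_filter_one (fun q : ℤ × (ℤ → DD V L) => st (lev s) (mix (k s) q.2 x)) p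
      (sg r u).reverse (fun q hq hn => by rw [hp' q hq hn, st_one])
    simp only [Function.comp_def]
    rw [h2, ← XX_eq_prod, sg_κ k r hr s hk]
    simp [gam]
  · rw [List.map_append, List.sum_append, List.map_map]
    refine add_le_add ?_ (by simp [mix, hnm])
    refine (sum_filter_le _ _ _).trans ?_
    rw [List.map_reverse, List.sum_reverse]
    rfl

end
end SE

/-! ## Part P4b -/
namespace SE

section
variable {V L : Type} [CommGroup V] [CommGroup L]
variable {lev : ℕ → Lev V} {k : ℕ → ℕ} {nm : L → ℕ}

theorem sum_range_shift (a : ℤ) (m : ℕ) (j : ℤ → ℕ) :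
    ∑ i ∈ Finset.range m, j (a + i) = ∑ x ∈ Finset.Ico a (a + m), j x := by
  refine Finset.sum_nbij' (fun i => a + i) (fun x => (x - a).toNat) ?_ ?_ ?_ ?_ ?_
  · intro i hi; simp at hi ⊢; omega
  · intro x hx; simp at hx ⊢; omega
  · intro i hi; simp
  · intro x hx; simp at hx ⊢; omega
  · intro i hi; rfl

theorem Rp_gam (hnm : nm 1 = 0) (hk0 : ∀ s, 0 < k s) (s h J : ℕ) (hkh : k s ≤ 2 * h)
    (hk : ∀ s', s' ≠ s → (h : ℤ) ≤ |(k s' : ℤ) - k s|)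
    (u : List (Atm V L)) (hJ : Ru u < J * h) (j : ℤ → ℕ) (ℓ : ℕ → ℕ)
    (hγ : ∀ i < 2 * J, ∀ x ∈ Set.Ico (-(J * h : ℕ) + (i * h : ℕ) : ℤ) (-(J * h : ℕ) + (i * h : ℕ) + h),
      NullHist (lev s) nm (ℓ i) (j x) (gam (lev := lev) k s u x)) :
    Rp k nm 0 0 (2 * (J * h) + ∑ i ∈ Finset.range (2 * J), (10 * h * ℓ i + h))
      (∑ x ∈ Finset.Icc (-(Ru u : ℤ)) (Ru u), j x)
      (inLev s (gam (lev := lev) k s u) : GG lev L) := by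
  have h1 := Rp_level (lev := lev) (k := k) (nm := nm) hnm s h (-(J * h : ℕ)) hkh hk
    (gam (lev := lev) k s u)
    (fun x => if x ∈ Finset.Icc (-(Ru u : ℤ)) (Ru u) then j x else 0) ℓ (2 * J) ?_
  · have h2 : Set.mulIndicator (Set.Ico (-(J * h : ℕ) : ℤ) (-(J * h : ℕ) + (2 * J * h : ℕ)))
        (gam (lev := lev) k s u) = gam (lev := lev) k s u := by
      funext x
      by_cases hx : x ∈ Set.Ico (-(J * h : ℕ) : ℤ) (-(J * h : ℕ) + (2 * J * h : ℕ))
      · rw [Set.mulIndicator_of_mem hx]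
      · rw [Set.mulIndicator_of_notMem hx, gam_eq_one k hk0 u s x]
        left
        rw [Set.mem_Ico] at hx
        have : 2 * J * h = 2 * (J * h) := by ring
        rw [this] at hx
        push_cast [Nat.cast_mul] at hx
        by_contra hcon
        apply hx
        zify at hJ hcon
        rcases abs_cases x with h | h <;> constructor <;> omega
    rw [h2] at h1
    have h3 := (Rp.move (k := k) (nm := nm) (lev := lev) (L := L) 0 (-(J * h : ℕ))).mul h1
    have h4 := h3.move' (r := 0)
    rw [one_mul] at h4
    refine h4.mono ?_ ?_
    · have : 2 * J * h = 2 * (J * h) := by ring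
      rw [this]
      generalize J * h = m
      push_cast
      omega
    · rw [zero_add]
      refine (le_of_eq (sum_range_shift (-(J * h : ℕ)) (2 * J * h)
        (fun x => if x ∈ Finset.Icc (-(Ru u : ℤ)) (Ru u) then j x else 0))).trans ?_
      rw [← Finset.sum_filter]
      exact Finset.sum_le_sum_of_subset (fun x hx => (Finset.mem_filter.1 hx).2)
  · intro i hi x hx
    by_cases hx2 : x ∈ Finset.Icc (-(Ru u : ℤ)) (Ru u)
    · simp only [hx2, if_true]; exact hγ i hi x hx
    · rw [gam_eq_one k hk0 u s x]
      · exact NullHist.one _ _ _ _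
      · left; rw [Finset.mem_Icc] at hx2; omega

theorem filter_count {α : Type*} (N : ℕ) (p : ℕ → α → Prop)
    (h : ∀ a, ((Finset.range N).filter (fun i => p i a)).card ≤ 4) (l : List α) :
    ∑ i ∈ Finset.range N, (l.filter (fun a => p i a)).length ≤ 4 * l.length := by
  induction l with
  | nil => simp
  | cons a l ih =>
    have h1 : ∀ i, ((a :: l).filter (fun a => p i a)).length =
        (if p i a then 1 else 0) + (l.filter (fun a => p i a)).length := by
      intro i
      by_cases hp : p i a
      · simp [List.filter_cons, hp]; omega
      · simp [List.filter_cons, hp]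
    simp only [h1, Finset.sum_add_distrib, List.length_cons]
    rw [← Finset.card_filter]
    have := h a
    omega

theorem block_count (N r : ℕ) (hr : 0 < r) (a ρ : ℤ) :
    ((Finset.range N).filter (fun i => ∃ x : ℤ, (a + (i * (2 * r) : ℕ) ≤ x ∧
      x < a + (i * (2 * r) : ℕ) + (2 * r : ℕ)) ∧ (|x - ρ| < r ∨ |x - (4 * r : ℕ) - ρ| < r))).card ≤ 4 := by
  set q : ℤ := (ρ - r + 1 - a) / (2 * r) with hq
  have hsub : ((Finset.range N).filter (fun i => ∃ x : ℤ, (a + (i * (2 * r) : ℕ) ≤ x ∧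
      x < a + (i * (2 * r) : ℕ) + (2 * r : ℕ)) ∧ (|x - ρ| < r ∨ |x - (4 * r : ℕ) - ρ| < r))).map
      Nat.castEmbedding ⊆ Finset.Icc q (q + 3) := by
    intro z hz
    obtain ⟨i, hi, rfl⟩ := Finset.mem_map.1 hz
    obtain ⟨x, ⟨h1, h2⟩, h3⟩ := (Finset.mem_filter.1 hi).2
    have hq1 : q * (2 * r) ≤ ρ - r + 1 - a := Int.ediv_mul_le _ (by omega)
    have hq2 : ρ - r + 1 - a < (q + 1) * (2 * r) := Int.lt_ediv_add_one_mul_self _ (by omega)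
    simp only [Nat.castEmbedding_apply, Finset.mem_Icc]
    push_cast at h1 h2 h3
    have hb : ρ - r < x ∧ x < ρ + 5 * r := by
      rcases h3 with h | h <;> rw [abs_lt] at h <;> constructor <;> omega
    have hr' : (0 : ℤ) < 2 * r := by omega
    constructor
    · by_contra hc
      have : (i : ℤ) + 1 ≤ q := by omega
      nlinarith
    · by_contra hc
      have : q + 4 ≤ (i : ℤ) := by omega
      nlinarith
  have := Finset.card_le_card hsub
  rw [Finset.card_map, Int.card_Icc] at this
  refine this.trans ?_
  omega

variable (dd : ℕ → ℕ)

/-- word cost for level `s` -/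
noncomputable def WL (lev : ℕ → Lev V) [Fintype V] (ss s : ℕ) (u : List (Atm V L)) : ℕ :=
  if 4 * dd s ≤ 2 * Ru u then
    (if s < ss then 288 * Fintype.card (ZZ (lev s)) * Ru u
      else 24 * Ru u + 128 * dd s * (sg (dd s) u).length) else 0

/-- lamp cost for level `s` -/
noncomputable def JL (lev : ℕ → Lev V) (k : ℕ → ℕ) (nm : L → ℕ) (ss s : ℕ) (u : List (Atm V L)) : ℕ :=
  if 4 * dd s ≤ 2 * Ru u then ∑ x ∈ Finset.Icc (-(Ru u : ℤ)) (Ru u),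
    (if s < ss then ∑ κ, nm ((gam (lev := lev) k s u x).φ κ)
      else ((sg (dd s) u).map (fun q => nm (q.2 x).2.2)).sum + nm (Pt u x).2.2) else 0

variable {dd}

theorem k_gap (hdd : ∀ s, 0 < dd s) (hdd2 : ∀ s, 2 * dd s ≤ dd (s + 1)) (s s' : ℕ) (h : s' ≠ s) :
    ((2 * dd s : ℕ) : ℤ) ≤ |((4 * dd s' : ℕ) : ℤ) - (4 * dd s : ℕ)| := by
  have hm : Monotone dd := monotone_nat_of_le_succ fun s => by have := hdd2 s; omega
  rcases lt_or_gt_of_ne h with h | h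
  · have h1 : 2 * dd s' ≤ dd s := (hdd2 s').trans (hm h)
    rw [abs_of_nonpos] <;> push_cast <;> omega
  · have h1 : 2 * dd s ≤ dd s' := (hdd2 s).trans (hm h)
    rw [abs_of_nonneg] <;> push_cast <;> omega

theorem Rp_one_level [Fintype V] (hnm : nm 1 = 0) (hnm2 : ∀ a, nm a⁻¹ = nm a)
    (hdd : ∀ s, 0 < dd s) (hdd2 : ∀ s, 2 * dd s ≤ dd (s + 1)) (hk : ∀ s, k s = 4 * dd s)
    (ss s : ℕ) (u : List (Atm V L)) :
    Rp k nm 0 0 (WL dd lev ss s u) (JL dd lev k nm ss s u)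
      (inLev s (gam (lev := lev) k s u) : GG lev L) := by
  have hk0 : ∀ s, 0 < k s := fun s => by rw [hk]; have := hdd s; omega
  by_cases hact : 4 * dd s ≤ 2 * Ru u
  · have hgap : ∀ s', s' ≠ s → ((2 * dd s : ℕ) : ℤ) ≤ |(k s' : ℤ) - k s| := by
      intro s' h; rw [hk, hk]; exact k_gap hdd hdd2 s s' h
    have hd := hdd s
    set h := 2 * dd s with hh
    set J := Ru u / h + 1 with hJ
    have hJ1 : Ru u < J * h := by
      have := Nat.div_add_mod (Ru u) h
      have := Nat.mod_lt (Ru u) (show 0 < h by omega)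
      rw [hJ]; nlinarith
    have hJ2 : J * h ≤ Ru u + h := by
      have := Nat.div_mul_le_self (Ru u) h
      rw [hJ]; nlinarith
    have hkh : k s ≤ 2 * h := by rw [hk]; omega
    simp only [WL, JL, hact, if_true]
    by_cases hss : s < ss
    · simp only [hss, if_true]
      have := Rp_gam (lev := lev) (k := k) (nm := nm) hnm hk0 s h J hkh hgap u hJ1
        (fun x => ∑ κ, nm ((gam (lev := lev) k s u x).φ κ)) (fun _ => 7 * Fintype.card (ZZ (lev s)))
        (fun i hi x hx => (gam_null k nm hnm2 (dd s) hd s (by rw [hk]; omega) u x (fun _ => True)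
          (by simp)).tour (lev s) hnm)
      refine this.mono ?_ le_rfl
      rw [Finset.sum_const, Finset.card_range, smul_eq_mul]
      have hZ : 1 ≤ Fintype.card (ZZ (lev s)) := Fintype.card_pos
      generalize Fintype.card (ZZ (lev s)) = Z at hZ ⊢
      have e1 : 2 * J * (10 * h * (7 * Z) + h) = 140 * (J * h) * Z + 2 * (J * h) := by ring
      rw [e1]
      have e2 : J * h ≤ 2 * Ru u := by omega
      generalize J * h = m at e2 ⊢
      have : m * Z ≤ 2 * Ru u * Z := Nat.mul_le_mul_right _ e2
      nlinarith
    · simp only [hss, if_false]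
      let p : ℕ → ℤ × (ℤ → DD V L) → Prop := fun i q => ∃ x : ℤ,
        ((-(J * h : ℕ) : ℤ) + (i * (2 * dd s) : ℕ) ≤ x ∧
        x < (-(J * h : ℕ) : ℤ) + (i * (2 * dd s) : ℕ) + (2 * dd s : ℕ)) ∧
        (|x - q.1| < dd s ∨ |x - (4 * dd s : ℕ) - q.1| < dd s)
      have := Rp_gam (lev := lev) (k := k) (nm := nm) hnm hk0 s h J hkh hgap u hJ1
        (fun x => ((sg (dd s) u).map (fun q => nm (q.2 x).2.2)).sum + nm (Pt u x).2.2)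
        (fun i => ((sg (dd s) u).filter (fun q => p i q)).length + 1)
        (fun i hi x hx => gam_null k nm hnm2 (dd s) hd s (by rw [hk]; omega) u x (p i) ?_)
      · refine this.mono ?_ le_rfl
        have hc := filter_count (2 * J) p (fun q => block_count (2 * J) (dd s) hd (-(J * h : ℕ)) q.1)
          (sg (dd s) u)
        have hlen : 1 ≤ (sg (dd s) u).length := by
          obtain ⟨ρ, P, l, h1, _⟩ := sg_inv (dd s) hd u
          rw [h1]; simp
        have e1 : ∑ i ∈ Finset.range (2 * J),
            (10 * h * (((sg (dd s) u).filter (fun q => p i q)).length + 1) + h) =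
            10 * h * (∑ i ∈ Finset.range (2 * J), ((sg (dd s) u).filter (fun q => p i q)).length) +
            22 * (J * h) := by
          rw [Finset.mul_sum, Finset.sum_congr rfl (fun i _ =>
            show 10 * h * (((sg (dd s) u).filter (fun q => p i q)).length + 1) + h =
              10 * h * ((sg (dd s) u).filter (fun q => p i q)).length + 11 * h by ring),
            Finset.sum_add_distrib, Finset.sum_const, Finset.card_range, smul_eq_mul]
          ring
        rw [e1]
        generalize (∑ i ∈ Finset.range (2 * J), ((sg (dd s) u).filter (fun q => p i q)).length) = S at hc ⊢
        generalize (sg (dd s) u).length = N at hc hlen ⊢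
        have e2 : 10 * h * S ≤ 10 * h * (4 * N) := Nat.mul_le_mul_left _ hc
        have e3 : 10 * h * (4 * N) = 80 * dd s * N := by rw [hh]; ring
        have e4 : dd s ≤ dd s * N := Nat.le_mul_of_pos_right _ hlen
        have e5 : 80 * dd s * N = 80 * (dd s * N) := by ring
        have e6 : 128 * dd s * N = 128 * (dd s * N) := by ring
        omega
      · intro q hq hn
        obtain ⟨_, _, _, _, _, h3⟩ := sg_inv (dd s) hd u
        have h1 : q.2 x = 1 := h3 q hq x (by
          by_contra hc; exact hn ⟨x, ⟨hx.1, hx.2⟩, Or.inl (by omega)⟩)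
        have h2 : q.2 (x - k s) = 1 := h3 q hq _ (by
          by_contra hc; exact hn ⟨x, ⟨hx.1, hx.2⟩, Or.inr (by rw [hk] at hc; omega)⟩)
        ext <;> simp [mix, h1, h2]
  · have : gam (lev := lev) k s u = 1 := by
      funext x
      refine gam_eq_one k hk0 u s x ?_
      rw [hk]; omega
    rw [this, map_one]
    exact (Rp.move 0 0).mono (Nat.zero_le _) (Nat.zero_le _)

theorem Rp_levels [Fintype V] (hnm : nm 1 = 0) (hnm2 : ∀ a, nm a⁻¹ = nm a)
    (hdd : ∀ s, 0 < dd s) (hdd2 : ∀ s, 2 * dd s ≤ dd (s + 1)) (hk : ∀ s, k s = 4 * dd s)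
    (ss : ℕ) (u : List (Atm V L)) (N : ℕ) :
    Rp k nm 0 0 (∑ s ∈ Finset.range N, WL dd lev ss s u) (∑ s ∈ Finset.range N, JL dd lev k nm ss s u)
      (pure (fun s => if s < N then gam (lev := lev) k s u else 1) : GG lev L) := by
  induction N with
  | zero =>
    have : (fun s => if s < 0 then gam (lev := lev) k s u else 1) = 1 := by funext s; simp
    rw [this, map_one]
    exact (Rp.move 0 0).mono (Nat.zero_le _) (Nat.zero_le _)
  | succ N ih =>
    have := ih.mul (Rp_one_level (lev := lev) hnm hnm2 hdd hdd2 hk ss N u)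
    rw [Finset.sum_range_succ, Finset.sum_range_succ]
    convert this using 1
    refine GG.ext' (fun s x => ?_) rfl
    simp only [pure, inLev, MonoidHom.coe_mk, OneHom.coe_mk, GG.mul_κ, sub_zero]
    rcases lt_trichotomy s N with h | h | h
    · rw [Pi.mulSingle_eq_of_ne h.ne]; simp [h, Nat.lt_succ_of_lt h]
    · subst h; simp
    · rw [Pi.mulSingle_eq_of_ne h.ne']
      have h1 : ¬ s < N := by omega
      have h2 : ¬ s < N + 1 := by omega
      simp [h1, h2]

/-- the deterministic upper bound -/
theorem Rep_main [Fintype V] (hnm : nm 1 = 0) (hnm2 : ∀ a, nm a⁻¹ = nm a)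
    (hdd : ∀ s, 0 < dd s) (hdd2 : ∀ s, 2 * dd s ≤ dd (s + 1)) (hk : ∀ s, k s = 4 * dd s)
    (ss : ℕ) (u : List (Atm V L)) (N : ℕ) (hN : ∀ s, N ≤ s → 2 * Ru u < k s) :
    Rep k nm ((∑ s ∈ Finset.range N, WL dd lev ss s u) + (14 * Ru u + 6))
      ((∑ s ∈ Finset.range N, JL dd lev k nm ss s u) +
        ∑ x ∈ Finset.Icc (-(Ru u : ℤ)) (Ru u), nm (Pt u x).2.2)
      (XX (aval (lev := lev) k) u) := by
  have hk0 : ∀ s, 0 < k s := fun s => by rw [hk]; have := hdd s; omega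
  have h1 := Rp_levels (lev := lev) hnm hnm2 hdd hdd2 hk ss u N
  have hI : Set.mulIndicator (Set.Ico (-(Ru u : ℤ)) (-(Ru u : ℤ) + (2 * Ru u + 1 : ℕ))) (Pt u) = Pt u := by
    funext x
    by_cases hx : x ∈ Set.Ico (-(Ru u : ℤ)) (-(Ru u : ℤ) + (2 * Ru u + 1 : ℕ))
    · rw [Set.mulIndicator_of_mem hx]
    · rw [Set.mulIndicator_of_notMem hx, Pt_supp]
      rw [Set.mem_Ico] at hx; push_cast at hx; omega
  have h2 := Rp.sweepB (k := k) (lev := lev) hnm (Pt u) (-(Ru u : ℤ)) (2 * Ru u + 1)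
  have h3 := Rp.sweepA (k := k) (nm := nm) (lev := lev) (Pt u) (-(Ru u : ℤ)) (2 * Ru u + 1)
  rw [hI] at h2 h3
  rw [sum_range_shift (-(Ru u:ℤ)) (2*Ru u+1) (fun x => nm (Pt u x).2.2)] at h3
  have h4 := ((h1.move' (r := -(Ru u : ℤ))).mul (h2.move' (r := -(Ru u : ℤ)))).mul
    (h3.move' (r := cu u))
  have h5 : Rep k nm _ _ _ := h4
  rw [neg_zero, Tz_zero, one_mul] at h5
  have hX : XX (aval (lev := lev) k) u = pure (fun s => if s < N then gam (lev := lev) k s u else 1) *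
      layB k (Pt u) * layA (Pt u) * Tz (cu u) := by
    refine GG.ext' (fun s x => ?_) (by simp [XX_c, pure])
    simp only [pure, MonoidHom.coe_mk, OneHom.coe_mk, GG.mul_κ, GG.mul_c, layA_κ, layB_κ, Tz_κ, mul_one,
      layB_c, sub_zero, add_zero]
    have h6 := gam_mul (lev := lev) k s u x
    split_ifs with hs
    · rw [mul_assoc, h6]
    · rw [← h6, gam_eq_one k hk0 u s x]
      · simp
      · have := hN s (by omega)
        omega
  rw [hX]
  refine h5.mono ?_ ?_
  · have := Ru_cu u
    push_cast
    omega
  · have : Finset.Ico (-(Ru u : ℤ)) (-(Ru u : ℤ) + (2 * Ru u + 1 : ℕ)) =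
      Finset.Icc (-(Ru u : ℤ)) (Ru u) := by
      ext x; simp only [Finset.mem_Ico, Finset.mem_Icc]; push_cast; omega
    rw [this]; omega

end
end SE

/-! ## Part P5 -/
namespace SE

section
variable {V L : Type} [CommGroup V] [CommGroup L]

/-- a base step: switch, switch, type, direction -/
abbrev Bs (V : Type) := (V × V) × (V × V) × Bool × Bool
/-- a step: base step and a lamp bit -/
abbrev Stp (V : Type) := Bs V × Bool

def mm (lam : Bool → L) (a : Stp V) : Atm V L :=
  if a.1.2.2.1 then .inr (1, 1, lam a.2) else .inl a.1.2.2.2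

def ops (lam : Bool → L) (a : Stp V) : List (Atm V L) :=
  [.inr (a.1.2.1.1, a.1.2.1.2, 1), mm lam a, .inr (a.1.1.1, a.1.1.2, 1)]

def uu (lam : Bool → L) (l : List (Stp V)) : List (Atm V L) := l.flatMap (ops lam)

variable (lam : Bool → L)

theorem uu_nil : uu lam ([] : List (Stp V)) = [] := rfl

theorem uu_cons (a : Stp V) (l : List (Stp V)) : uu lam (a :: l) =
    .inr (a.1.2.1.1, a.1.2.1.2, 1) :: mm lam a :: .inr (a.1.1.1, a.1.1.2, 1) :: uu lam l := rfl

/-- displacement -/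
def dl (b : Bs V) : ℤ := if b.2.2.1 then 0 else if b.2.2.2 then 1 else -1

theorem cu_mm (a : Stp V) (u : List (Atm V L)) : cu (mm lam a :: u) = cu u + dl a.1 := by
  unfold mm dl; split_ifs <;> simp_all [cu]

theorem cu_uu (a : Stp V) (l : List (Stp V)) : cu (uu lam (a :: l)) = cu (uu lam l) + dl a.1 := by
  rw [uu_cons]; simp only [cu, cu_mm]

theorem dl_abs (b : Bs V) : |dl b| ≤ 1 := by unfold dl; split_ifs <;> simp

theorem Ru_inr (d : DD V L) (u : List (Atm V L)) : Ru (.inr d :: u) = Ru u := by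
  have := Ru_cu u
  simp [Ru, cu]; exact this

theorem Ru_uu (a : Stp V) (l : List (Stp V)) :
    Ru (uu lam (a :: l)) = max (Ru (uu lam l)) (cu (uu lam l) + dl a.1).natAbs := by
  rw [uu_cons, Ru_inr, Ru, Ru_inr, cu_mm]; rfl

theorem Ru_le (l : List (Stp V)) : Ru (uu lam l) ≤ l.length := by
  have : ∀ l : List (Stp V), (cu (uu lam l)).natAbs ≤ l.length ∧ Ru (uu lam l) ≤ l.length := by
    intro l
    induction l with
    | nil => exact ⟨by simp [uu_nil, cu], by simp [uu_nil, Ru]⟩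
    | cons a l ih =>
      rw [Ru_uu, cu_uu, List.length_cons]
      have := dl_abs a.1
      rw [abs_le] at this
      omega
  exact (this l).2

variable [Fintype V]

theorem av_stp (F : Bool → Bool → Bool → ℝ) :
    av (fun a : Stp V => F a.1.2.2.1 a.1.2.2.2 a.2) =
      av (fun t => av fun d => av fun e => F t d e) := by
  rw [av_prod]
  rw [av_prod (fun b : Bs V => av fun e => F b.2.2.1 b.2.2.2 e)]
  simp only
  rw [av_const, av_prod]
  simp only
  rw [av_const, av_prod]

theorem av_bool (F : Bool → ℝ) : av F = (F true + F false) / 2 := by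
  simp [av]

theorem av_dl (f : ℤ → ℝ) : av (fun a : Stp V => f (dl a.1)) = (2 * f 0 + f 1 + f (-1)) / 4 := by
  have := av_stp (V := V) (fun t d e => f (if t then 0 else if d then 1 else -1))
  unfold dl
  rw [this]
  simp only [av_bool]
  simp
  ring

theorem E_c2 (n : ℕ) : EE n (fun l : List (Stp V) => ((cu (uu lam l) : ℤ) : ℝ) ^ 2) ≤ n / 2 := by
  have := EE_growth (F := fun l : List (Stp V) => ((cu (uu lam l) : ℤ) : ℝ) ^ 2) (c := 1 / 2)
    (fun l => by
      simp only [cu_uu]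
      rw [av_dl (fun d => (((cu (uu lam l) + d : ℤ)) : ℝ) ^ 2)]
      push_cast
      linarith) n
  simp [uu_nil, cu] at this
  linarith

/-- reflected process -/
def Dp (σ : ℤ) : List (Atm V L) → ℤ
  | [] => 0
  | .inl b :: u => max (Dp σ u - σ * (if b then 1 else -1)) 0
  | .inr _ :: u => Dp σ u

theorem Dp_nonneg (σ : ℤ) (u : List (Atm V L)) : 0 ≤ Dp σ u := by
  induction u with
  | nil => simp [Dp]
  | cons a u ih => rcases a with b | d <;> simp [Dp, ih]

theorem Dp_uu (σ : ℤ) (a : Stp V) (l : List (Stp V)) :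
    Dp σ (uu lam (a :: l)) = max (Dp σ (uu lam l) - σ * dl a.1) 0 := by
  rw [uu_cons]; simp only [Dp]
  have := Dp_nonneg σ (uu lam l)
  unfold mm dl; split_ifs <;> simp_all [Dp]

theorem Ru_Dp (u : List (Atm V L)) : (Ru u : ℤ) ≤ max (cu u + Dp 1 u) (- cu u + Dp (-1) u) := by
  induction u with
  | nil => simp [Ru, cu, Dp]
  | cons a u ih =>
    rcases a with b | d
    · have h1 := Dp_nonneg 1 u
      have h2 := Dp_nonneg (-1) u
      cases b <;> simp only [Ru, cu, Dp, Nat.cast_max, if_true, Bool.false_eq_true, if_false] <;> omega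
    · rw [Ru_inr]; exact ih

theorem max_sq_le (z : ℤ) : (((max z 0 : ℤ)) : ℝ) ^ 2 ≤ ((z : ℤ) : ℝ) ^ 2 := by
  rcases le_total z 0 with h | h
  · rw [max_eq_right h, Int.cast_zero, zero_pow two_ne_zero]; exact sq_nonneg _
  · rw [max_eq_left h]

theorem E_Dp (σ : ℤ) (hσ : σ ^ 2 = 1) (n : ℕ) :
    EE n (fun l : List (Stp V) => ((Dp σ (uu lam l) : ℤ) : ℝ) ^ 2) ≤ n / 2 := by
  have hst : ∀ l : List (Stp V), av (fun a => ((Dp σ (uu lam (a :: l)) : ℤ) : ℝ) ^ 2) ≤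
      ((Dp σ (uu lam l) : ℤ) : ℝ) ^ 2 + 1 / 2 := by
    intro l
    simp only [Dp_uu]
    generalize Dp σ (uu lam l) = D
    have h1 : ∀ d : ℤ, (((max (D - σ * d) 0 : ℤ)) : ℝ) ^ 2 ≤ (((D - σ * d : ℤ)) : ℝ) ^ 2 :=
      fun d => max_sq_le (D - σ * d)
    have h2 := av_mono (f := fun a : Stp V => (((max (D - σ * dl a.1) 0 : ℤ)) : ℝ) ^ 2)
      (g := fun a : Stp V => (((D - σ * dl a.1 : ℤ)) : ℝ) ^ 2) (fun a => h1 _)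
    refine h2.trans ?_
    rw [av_dl (fun d => (((D - σ * d : ℤ)) : ℝ) ^ 2)]
    have : (σ:ℝ) ^ 2 = 1 := by exact_mod_cast hσ
    push_cast
    nlinarith
  have := EE_growth (F := fun l : List (Stp V) => ((Dp σ (uu lam l) : ℤ) : ℝ) ^ 2) hst n
  simp [uu_nil, Dp] at this
  linarith

theorem E_R2 (n : ℕ) : EE n (fun l : List (Stp V) => (Ru (uu lam l) : ℝ) ^ 2) ≤ 4 * n := by
  have h : ∀ l : List (Stp V), (Ru (uu lam l) : ℝ) ^ 2 ≤ 4 * ((cu (uu lam l) : ℤ) : ℝ) ^ 2 +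
      (2 * ((Dp 1 (uu lam l) : ℤ) : ℝ) ^ 2 + 2 * ((Dp (-1) (uu lam l) : ℤ) : ℝ) ^ 2) := by
    intro l
    have h1 := Ru_Dp (uu lam l)
    have h2 : (0 : ℝ) ≤ Ru (uu lam l) := by positivity
    rcases le_max_iff.1 h1 with h | h
    · have h3 : (Ru (uu lam l) : ℝ) ≤ (cu (uu lam l) : ℤ) + (Dp 1 (uu lam l) : ℤ) := by exact_mod_cast h
      nlinarith [sq_nonneg (((cu (uu lam l) : ℤ) : ℝ) - (Dp 1 (uu lam l) : ℤ)),
        sq_nonneg ((Dp (-1) (uu lam l) : ℤ) : ℝ), sq_nonneg ((cu (uu lam l) : ℤ) : ℝ)]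
    · have h3 : (Ru (uu lam l) : ℝ) ≤ -(cu (uu lam l) : ℤ) + (Dp (-1) (uu lam l) : ℤ) := by exact_mod_cast h
      nlinarith [sq_nonneg (((cu (uu lam l) : ℤ) : ℝ) + (Dp (-1) (uu lam l) : ℤ)),
        sq_nonneg ((Dp 1 (uu lam l) : ℤ) : ℝ), sq_nonneg ((cu (uu lam l) : ℤ) : ℝ)]
  refine (EE_mono fun l _ => h l).trans ?_
  rw [EE_add, EE_add, EE_smul, EE_smul, EE_smul]
  have h1 := E_c2 (V := V) lam n
  have h2 := E_Dp (V := V) lam 1 (by norm_num) n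
  have h3 := E_Dp (V := V) lam (-1) (by norm_num) n
  linarith

theorem E_R (n : ℕ) : EE n (fun l : List (Stp V) => (Ru (uu lam l) : ℝ)) ≤ 3 * Real.sqrt n := by
  rcases Nat.eq_zero_or_pos n with rfl | hn
  · simp [EE_zero, uu_nil, Ru]
  have hs : 0 < Real.sqrt n := Real.sqrt_pos.2 (by exact_mod_cast hn)
  have hs2 : Real.sqrt n * Real.sqrt n = n := Real.mul_self_sqrt (by positivity)
  have h : ∀ l : List (Stp V), (Ru (uu lam l) : ℝ) ≤
      (1 / (2 * Real.sqrt n)) * (Ru (uu lam l) : ℝ) ^ 2 + Real.sqrt n / 2 := by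
    intro l
    rw [div_mul_eq_mul_div, div_add_div _ _ (by positivity) (by norm_num), le_div_iff₀ (by positivity)]
    nlinarith [sq_nonneg ((Ru (uu lam l) : ℝ) - Real.sqrt n)]
  refine (EE_mono fun l _ => h l).trans ?_
  rw [EE_add, EE_smul, EE_const]
  have h1 := E_R2 (V := V) lam n
  have : 1 / (2 * Real.sqrt n) * EE n (fun l : List (Stp V) => (Ru (uu lam l) : ℝ) ^ 2) ≤
      1 / (2 * Real.sqrt n) * (4 * n) := mul_le_mul_of_nonneg_left h1 (by positivity)
  have e : 1 / (2 * Real.sqrt n) * (4 * n) = 2 * Real.sqrt n := by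
    rw [div_mul_eq_mul_div, div_eq_iff (by positivity)]; linarith
  linarith

/-- potential for the segments -/
noncomputable def vl (r : ℕ) (u : List (Atm V L)) : ℝ :=
  (((cu u - ((sg r u).head?.map Prod.fst).getD 0 : ℤ)) : ℝ) ^ 2 + r ^ 2 * (sg r u).length

theorem vl_inr (r : ℕ) (d : DD V L) (u : List (Atm V L)) : vl r (.inr d :: u) = vl r u := by
  unfold vl
  have : (sg r (.inr d :: u)) = edH (cu u) d (sg r u) := rfl
  rw [this]
  rcases sg r u with _ | ⟨⟨ρ, P⟩, l⟩ <;> simp [edH, cu]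

theorem vl_mm (r : ℕ) (hr : 0 < r) (u : List (Atm V L)) : ∃ ρ : ℤ, ∃ z : ℝ,
    vl r u = (((cu u - ρ : ℤ)) : ℝ) ^ 2 + z ∧ ∀ a : Stp V,
      vl r (mm lam a :: u) ≤ (((cu u + dl a.1 - ρ : ℤ)) : ℝ) ^ 2 + z := by
  obtain ⟨ρ, P, l, h1, h2, h3⟩ := sg_inv r hr u
  refine ⟨ρ, r ^ 2 * (sg r u).length, by simp [vl, h1], ?_⟩
  intro a
  have hc := cu_mm lam a u
  unfold mm at hc ⊢
  split_ifs at hc ⊢ with ht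
  · rw [vl_inr]
    simp [vl, h1, dl, ht]
  · unfold vl
    have h4 : sg r (.inl a.1.2.2.2 :: u) = mvH r (cu (V := V) (L := L) (.inl a.1.2.2.2 :: u)) (sg r u) := rfl
    rw [h4, hc, h1]
    simp only [mvH]
    split_ifs with h5
    · simp
    · simp only [List.head?_cons, Option.map_some, Option.getD_some, sub_self, List.length_cons]
      have h6 : (r : ℝ) ≤ |(((cu u + dl a.1 - ρ : ℤ)) : ℝ)| := by
        rw [← Int.cast_abs]; push Not at h5; exact_mod_cast h5
      have h7 : (r : ℝ) ^ 2 ≤ |(((cu u + dl a.1 - ρ : ℤ)) : ℝ)| ^ 2 := by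
        gcongr
      rw [sq_abs] at h7
      push_cast at h7 ⊢
      nlinarith

theorem E_vl (r : ℕ) (hr : 0 < r) (n : ℕ) :
    EE n (fun l : List (Stp V) => vl r (uu lam l)) ≤ r ^ 2 + n / 2 := by
  have := EE_growth (F := fun l : List (Stp V) => vl r (uu lam l)) (c := 1 / 2)
    (fun l => by
      simp only [uu_cons, vl_inr]
      have h0 : ∀ a : Stp V, vl r (mm lam a :: .inr (a.1.1.1, a.1.1.2, 1) :: uu lam l) =
          vl r (mm lam a :: uu lam l) := by
        intro a
        have e1 : sg r (.inr (a.1.1.1, a.1.1.2, 1) :: uu lam l) =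
          edH (cu (uu lam l)) (a.1.1.1, a.1.1.2, 1) (sg r (uu lam l)) := rfl
        unfold mm
        split_ifs
        · rw [vl_inr, vl_inr, vl_inr]
        · simp only [vl, sg, cu]
          obtain ⟨ρ, P, l', h1, h2, h3⟩ := sg_inv r hr (uu lam l)
          rw [h1]
          simp only [edH, mvH]
          split_ifs <;> simp
      simp only [h0]
      obtain ⟨ρ, z, h1, h2⟩ := vl_mm (V := V) lam r hr (uu lam l)
      refine (av_mono h2).trans ?_
      rw [av_dl (fun d => (((cu (uu lam l) + d - ρ : ℤ)) : ℝ) ^ 2 + z), h1]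
      push_cast
      linarith) n
  refine this.trans ?_
  simp [uu_nil, vl, cu, sg]
  linarith

theorem E_len (r : ℕ) (hr : 0 < r) (n : ℕ) :
    EE n (fun l : List (Stp V) => ((sg r (uu lam l)).length : ℝ) - 1) ≤ n / (2 * r ^ 2) := by
  have hr' : (0:ℝ) < r := by exact_mod_cast hr
  have h := E_vl (V := V) lam r hr n
  have h2 : EE n (fun l : List (Stp V) => (r:ℝ) ^ 2 * (sg r (uu lam l)).length) ≤ r ^ 2 + n / 2 := by
    refine (EE_mono fun l _ => ?_).trans h
    unfold vl
    have := sq_nonneg (((cu (uu lam l) - ((sg r (uu lam l)).head?.map Prod.fst).getD 0 : ℤ)) : ℝ)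
    linarith
  rw [EE_smul] at h2
  rw [EE_sub, EE_const, le_div_iff₀ (by positivity)]
  nlinarith

theorem sg_len_pos (r : ℕ) (hr : 0 < r) (u : List (Atm V L)) : 1 ≤ (sg r u).length := by
  obtain ⟨ρ, P, l, h1, _⟩ := sg_inv r hr u
  rw [h1]; simp

/-- number of segments on the event that the level is active -/
theorem E_lenact (r : ℕ) (hr : 0 < r) (n : ℕ) :
    EE n (fun l : List (Stp V) => if 4 * r ≤ 2 * Ru (uu lam l) then ((sg r (uu lam l)).length : ℝ) else 0)
      ≤ 2 * n / r ^ 2 := by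
  have hr' : (0:ℝ) < r := by exact_mod_cast hr
  have h : ∀ l : List (Stp V),
      (if 4 * r ≤ 2 * Ru (uu lam l) then ((sg r (uu lam l)).length : ℝ) else 0) ≤
        (((sg r (uu lam l)).length : ℝ) - 1) + (1 / (4 * r ^ 2)) * (Ru (uu lam l) : ℝ) ^ 2 := by
    intro l
    have h1 : (1:ℝ) ≤ (sg r (uu lam l)).length := by exact_mod_cast sg_len_pos r hr _
    have h0 : 0 ≤ (1 / (4 * (r:ℝ) ^ 2)) * (Ru (uu lam l) : ℝ) ^ 2 := by positivity
    split_ifs with ha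
    · have h2 : 2 * (r:ℝ) ≤ Ru (uu lam l) := by
        have : 2 * r ≤ Ru (uu lam l) := by omega
        exact_mod_cast this
      have : 1 ≤ (1 / (4 * (r:ℝ) ^ 2)) * (Ru (uu lam l) : ℝ) ^ 2 := by
        rw [div_mul_eq_mul_div, one_mul, le_div_iff₀ (by positivity)]
        nlinarith
      linarith
    · linarith
  refine (EE_mono fun l _ => h l).trans ?_
  rw [EE_add, EE_smul]
  have h1 := E_len (V := V) lam r hr n
  have h2 := E_R2 (V := V) lam n
  have h3 : (1 / (4 * (r:ℝ) ^ 2)) * EE n (fun l : List (Stp V) => (Ru (uu lam l) : ℝ) ^ 2) ≤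
      (1 / (4 * (r:ℝ) ^ 2)) * (4 * n) := mul_le_mul_of_nonneg_left h2 (by positivity)
  have e1 : (1 / (4 * (r:ℝ) ^ 2)) * (4 * n) = n / r ^ 2 := by field_simp
  have e2 : (n:ℝ) / (2 * r ^ 2) ≤ n / r ^ 2 := by
    gcongr; nlinarith [sq_nonneg (r:ℝ)]
  have e3 : 2 * (n:ℝ) / r ^ 2 = n / r ^ 2 + n / r ^ 2 := by ring
  linarith

/-- radius on the event that the level is active -/
theorem E_Ract (r : ℕ) (hr : 0 < r) (n : ℕ) :
    EE n (fun l : List (Stp V) => if 4 * r ≤ 2 * Ru (uu lam l) then (Ru (uu lam l) : ℝ) else 0)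
      ≤ 2 * n / r := by
  have hr' : (0:ℝ) < r := by exact_mod_cast hr
  have h : ∀ l : List (Stp V),
      (if 4 * r ≤ 2 * Ru (uu lam l) then (Ru (uu lam l) : ℝ) else 0) ≤
        (1 / (2 * r)) * (Ru (uu lam l) : ℝ) ^ 2 := by
    intro l
    split_ifs with ha
    · have h2 : 2 * (r:ℝ) ≤ Ru (uu lam l) := by
        have : 2 * r ≤ Ru (uu lam l) := by omega
        exact_mod_cast this
      rw [div_mul_eq_mul_div, one_mul, le_div_iff₀ (by positivity)]
      nlinarith
    · positivity
  refine (EE_mono fun l _ => h l).trans ?_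
  rw [EE_smul]
  have h2 := E_R2 (V := V) lam n
  have h3 : (1 / (2 * (r:ℝ))) * EE n (fun l : List (Stp V) => (Ru (uu lam l) : ℝ) ^ 2) ≤
      (1 / (2 * (r:ℝ))) * (4 * n) := mul_le_mul_of_nonneg_left h2 (by positivity)
  refine h3.trans (le_of_eq ?_)
  field_simp; ring

variable {lev : ℕ → Lev V} {dd : ℕ → ℕ}

/-- expected word cost -/
theorem E_W (hdd : ∀ s, 0 < dd s) (ss N n : ℕ) :
    EE n (fun l : List (Stp V) => (((∑ s ∈ Finset.range N, WL dd lev ss s (uu lam l)) +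
        (14 * Ru (uu lam l) + 6) : ℕ) : ℝ)) ≤
      (864 * ∑ s ∈ Finset.range N, if s < ss then (Fintype.card (ZZ (lev s)) : ℝ) else 0) * Real.sqrt n
      + (304 * ∑ s ∈ Finset.range N, if s < ss then 0 else 1 / (dd s : ℝ)) * n + 42 * Real.sqrt n + 6 := by
  have hlev : ∀ s, EE n (fun l : List (Stp V) => (WL dd lev ss s (uu lam l) : ℝ)) ≤
      864 * (if s < ss then (Fintype.card (ZZ (lev s)) : ℝ) else 0) * Real.sqrt n +
      304 * (if s < ss then 0 else 1 / (dd s : ℝ)) * n := by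
    intro s
    by_cases hs : s < ss
    · simp only [hs, if_true, mul_zero, zero_mul, add_zero]
      have : ∀ l : List (Stp V), (WL dd lev ss s (uu lam l) : ℝ) ≤
          288 * (Fintype.card (ZZ (lev s)) : ℝ) * Ru (uu lam l) := by
        intro l
        unfold WL
        simp only [hs, if_true]
        split_ifs
        · push_cast; exact le_rfl
        · push_cast; positivity
      refine (EE_mono fun l _ => this l).trans ?_
      rw [EE_smul]
      have h1 := E_R (V := V) lam n
      have : 288 * (Fintype.card (ZZ (lev s)) : ℝ) * EE n (fun l : List (Stp V) => (Ru (uu lam l) : ℝ))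
        ≤ 288 * (Fintype.card (ZZ (lev s)) : ℝ) * (3 * Real.sqrt n) :=
        mul_le_mul_of_nonneg_left h1 (by positivity)
      linarith
    · simp only [hs, if_false, mul_zero, zero_mul, zero_add]
      have : ∀ l : List (Stp V), (WL dd lev ss s (uu lam l) : ℝ) ≤
          24 * (if 4 * dd s ≤ 2 * Ru (uu lam l) then (Ru (uu lam l) : ℝ) else 0) +
          (128 * dd s) * (if 4 * dd s ≤ 2 * Ru (uu lam l) then ((sg (dd s) (uu lam l)).length : ℝ) else 0) := by
        intro l
        unfold WL
        simp only [hs, if_false]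
        split_ifs
        · push_cast; exact le_rfl
        · simp
      refine (EE_mono fun l _ => this l).trans ?_
      rw [EE_add, EE_smul, EE_smul]
      have hd : (0:ℝ) < dd s := by exact_mod_cast hdd s
      have h1 := E_Ract (V := V) lam (dd s) (hdd s) n
      have h2 := mul_le_mul_of_nonneg_left (E_lenact (V := V) lam (dd s) (hdd s) n)
        (show (0:ℝ) ≤ 128 * dd s by positivity)
      have e1 : 128 * (dd s:ℝ) * (2 * n / dd s ^ 2) = 256 * (n / dd s) := by field_simp; ring
      have e2 : 304 * (1 / (dd s:ℝ)) * n = 304 * (n / dd s) := by ring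
      have e3 : 2 * (n:ℝ) / dd s = 2 * (n / dd s) := by ring
      rw [e1] at h2; rw [e2]; rw [e3] at h1
      linarith
  have h1 : EE n (fun l : List (Stp V) => (((∑ s ∈ Finset.range N, WL dd lev ss s (uu lam l)) +
        (14 * Ru (uu lam l) + 6) : ℕ) : ℝ)) =
      (∑ s ∈ Finset.range N, EE n (fun l : List (Stp V) => (WL dd lev ss s (uu lam l) : ℝ))) +
      (14 * EE n (fun l : List (Stp V) => (Ru (uu lam l) : ℝ)) + 6) := by
    push_cast
    rw [EE_add, EE_add, EE_smul, EE_const, EE_sum]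
  rw [h1]
  have h2 := Finset.sum_le_sum (fun s (_ : s ∈ Finset.range N) => hlev s)
  rw [Finset.sum_add_distrib, ← Finset.sum_mul, ← Finset.sum_mul, ← Finset.mul_sum, ← Finset.mul_sum] at h2
  have h3 := E_R (V := V) lam n
  linarith

end
end SE

/-! ## Part P5b -/
namespace SE

section
variable {V L : Type} [CommGroup V] [CommGroup L]
variable {lev : ℕ → Lev V} (k : ℕ → ℕ)

theorem φ_edit (d : DD V L) (u : List (Atm V L)) (s x) (κ : (lev s).K) :
    ((XX (aval (lev := lev) k) (.inr d :: u)).κ s x).φ κ =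
      ((XX (aval (lev := lev) k) u).κ s x).φ κ *
        (if x = cu u ∧ κ = ((XX (aval (lev := lev) k) u).κ s x).y • (lev s).o then d.2.2 else 1) := by
  rw [XX_κ_edit, Site.mul_φ, Site.mul_φ, sAC_φ, sB_φ, mul_one]
  congr 1
  rw [inv_smul_eq_iff]
  by_cases hx : x = cu u
  · subst hx; simp
  · simp [hx, Pi.mulSingle_eq_of_ne hx]

theorem y_edit (d : DD V L) (u : List (Atm V L)) (s x) :
    ((XX (aval (lev := lev) k) (.inr d :: u)).κ s x).y =
      ((XX (aval (lev := lev) k) u).κ s x).y *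
        ((if x = cu u then (lev s).A d.1 else 1) * (if x - k s = cu u then (lev s).B d.2.1 else 1)) := by
  rw [XX_κ_edit, Site.mul_y, Site.mul_y, sAC_y, sB_y]
  congr 2
  · by_cases hx : x = cu u
    · subst hx; simp
    · simp [hx, Pi.mulSingle_eq_of_ne hx]
  · by_cases hx : x - k s = cu u
    · rw [hx]; simp
    · simp [hx, Pi.mulSingle_eq_of_ne hx]

end

/-- integer lamps -/
abbrev ZL := Multiplicative ℤ

def lamB (e : Bool) : ZL := Multiplicative.ofAdd (if e then 1 else -1)
def nmB (z : ZL) : ℕ := (Multiplicative.toAdd z).natAbs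

theorem nmB_one : nmB 1 = 0 := rfl
theorem nmB_inv (z : ZL) : nmB z⁻¹ = nmB z := by simp [nmB]
theorem nmB_mul (z w : ZL) : nmB (z * w) ≤ nmB z + nmB w := by
  simp only [nmB, toAdd_mul]; exact Int.natAbs_add_le _ _

section
variable {V : Type} [CommGroup V]

/-- accounts -/
structure AccU (N : ℕ) (Q : (ℤ → ℝ) → List (Atm V ZL) → ℝ) (z : List (Atm V ZL) → ℤ) : Prop where
  nil : ∀ w, w 0 = 0 → Q w [] = 0
  mv : ∀ w, w 0 = 0 → ∀ b u, Q w (.inl b :: u) = Q w u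
  ed : ∀ w, w 0 = 0 → ∀ d u, Q w (.inr d :: u) = Q w u +
    if cu u ∈ Finset.Icc (-(N:ℤ)) N then w (z u + Multiplicative.toAdd d.2.2) - w (z u) else 0
  z1 : ∀ v v' u, z (.inr (v, v', 1) :: u) = z u

theorem AccU.step {N : ℕ} {Q : (ℤ → ℝ) → List (Atm V ZL) → ℝ} {z : List (Atm V ZL) → ℤ}
    (h : AccU N Q z) (w : ℤ → ℝ) (hw : w 0 = 0) (a : Stp V) (l : List (Stp V)) :
    Q w (uu lamB (a :: l)) = Q w (uu lamB l) +
      if a.1.2.2.1 = true ∧ cu (uu lamB l) ∈ Finset.Icc (-(N:ℤ)) N then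
        w (z (uu lamB l) + (if a.2 then 1 else -1)) - w (z (uu lamB l)) else 0 := by
  rw [uu_cons, h.ed w hw]
  have e1 : Multiplicative.toAdd (1 : ZL) = 0 := rfl
  simp only [e1, add_zero, sub_self, ite_self]
  unfold mm
  by_cases ht : a.1.2.2.1 = true
  · simp only [ht, if_true, true_and]
    rw [h.ed w hw, h.ed w hw, h.z1]
    simp only [e1, add_zero, sub_self, ite_self, cu, lamB, toAdd_ofAdd]
    congr 1
  · rw [if_neg ht, if_neg (fun h => ht h.1)]
    rw [h.mv w hw, h.ed w hw]
    simp [e1]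

theorem AccU.abs_le {N : ℕ} {Q : (ℤ → ℝ) → List (Atm V ZL) → ℝ} {z : List (Atm V ZL) → ℤ}
    (h : AccU N Q z) (l : List (Stp V)) : Q (fun t => |(t:ℝ)|) (uu lamB l) ≤ l.length := by
  induction l with
  | nil => rw [uu_nil, h.nil _ (by simp)]; simp
  | cons a l ih =>
    rw [h.step _ (by simp), List.length_cons]
    have h1 : |(((z (uu lamB l) + (if a.2 then 1 else -1) : ℤ)) : ℝ)| ≤ |((z (uu lamB l) : ℤ):ℝ)| + 1 := by
      push_cast
      refine (abs_add_le _ _).trans ?_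
      gcongr
      split_ifs <;> simp
    push_cast at h1 ⊢
    by_cases hc : a.1.2.2.1 = true ∧ cu (uu lamB l) ∈ Finset.Icc (-(N:ℤ)) N
    · rw [if_pos hc]; linarith
    · rw [if_neg hc]; linarith

variable [Fintype V]

theorem AccU.sq_le {N : ℕ} {Q : (ℤ → ℝ) → List (Atm V ZL) → ℝ} {z : List (Atm V ZL) → ℤ}
    (h : AccU N Q z) (n : ℕ) :
    EE n (fun l : List (Stp V) => Q (fun t => (t:ℝ) ^ 2) (uu lamB l)) ≤ n := by
  have hst : ∀ l : List (Stp V), av (fun a => Q (fun t => (t:ℝ) ^ 2) (uu lamB (a :: l))) ≤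
      Q (fun t => (t:ℝ) ^ 2) (uu lamB l) + 1 := by
    intro l
    simp only [h.step (fun t => (t:ℝ) ^ 2) (by simp)]
    generalize z (uu lamB l) = y
    generalize Q (fun t => (t:ℝ) ^ 2) (uu lamB l) = q
    have := av_stp (V := V) (fun t d e => q + if t = true ∧ cu (uu lamB l) ∈ Finset.Icc (-(N:ℤ)) N then
        (((y + (if e then 1 else -1) : ℤ)) : ℝ) ^ 2 - (y:ℝ) ^ 2 else 0)
    rw [this]
    simp only [av_bool]
    by_cases hc : cu (uu lamB l) ∈ Finset.Icc (-(N:ℤ)) N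
    · simp [hc]; linarith
    · simp only [hc, and_false, if_false]; linarith
  have := EE_growth (F := fun l : List (Stp V) => Q (fun t => (t:ℝ) ^ 2) (uu lamB l)) hst n
  rw [uu_nil, h.nil _ (by simp)] at this
  linarith

end

section
variable {V : Type} [CommGroup V] {lev : ℕ → Lev V} (k : ℕ → ℕ)

noncomputable def Qφ (lev : ℕ → Lev V) (k : ℕ → ℕ) (s N : ℕ) (w : ℤ → ℝ) (u : List (Atm V ZL)) : ℝ :=
  ∑ x ∈ Finset.Icc (-(N:ℤ)) N, ∑ κ : (lev s).K,
    w (Multiplicative.toAdd (((XX (aval (lev := lev) k) u).κ s x).φ κ))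

theorem Qφ_acc (hk : ∀ s, 0 < k s) (s N : ℕ) : AccU N (Qφ lev k s N) (fun u =>
    Multiplicative.toAdd (((XX (aval (lev := lev) k) u).κ s (cu u)).φ
      (((XX (aval (lev := lev) k) u).κ s (cu u)).y • (lev s).o))) where
  nil w hw := by simp [Qφ, XX, hw]
  mv w hw b u := by simp only [Qφ, XX_κ_move]
  ed w hw d u := by
    simp only [Qφ, φ_edit]
    by_cases hc : cu u ∈ Finset.Icc (-(N:ℤ)) N
    · rw [if_pos hc, ← sub_eq_iff_eq_add', ← Finset.sum_sub_distrib,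
        Finset.sum_eq_single_of_mem _ hc, ← Finset.sum_sub_distrib,
        Finset.sum_eq_single_of_mem _ (Finset.mem_univ
          (((XX (aval (lev := lev) k) u).κ s (cu u)).y • (lev s).o))]
      · simp
      · intro κ _ hκ; simp [hκ]
      · intro x _ hx; simp [hx]
    · rw [if_neg hc, add_zero]
      refine Finset.sum_congr rfl fun x hx => ?_
      have : x ≠ cu u := by rintro rfl; exact hc hx
      simp [this]
  z1 v v' u := by
    have hks := hk s
    simp only [cu]
    have h2 : ¬ (cu u - k s = cu u) := by omega
    rw [y_edit, φ_edit]
    simp only [if_true, h2, if_false, mul_one, ite_self, mul_smul, (lev s).hA]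

noncomputable def QP (N : ℕ) (w : ℤ → ℝ) (u : List (Atm V ZL)) : ℝ :=
  ∑ x ∈ Finset.Icc (-(N:ℤ)) N, w (Multiplicative.toAdd (Pt u x).2.2)

theorem sum_single_change {N : ℕ} (f g : ℤ → ℝ) (c : ℤ) (h : ∀ x, x ≠ c → f x = g x) :
    ∑ x ∈ Finset.Icc (-(N:ℤ)) N, f x = ∑ x ∈ Finset.Icc (-(N:ℤ)) N, g x +
      if c ∈ Finset.Icc (-(N:ℤ)) N then f c - g c else 0 := by
  by_cases hc : c ∈ Finset.Icc (-(N:ℤ)) N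
  · rw [if_pos hc, ← sub_eq_iff_eq_add', ← Finset.sum_sub_distrib, Finset.sum_eq_single_of_mem _ hc]
    intro x _ hx; rw [h x hx, sub_self]
  · rw [if_neg hc, add_zero]
    refine Finset.sum_congr rfl fun x hx => h x ?_
    rintro rfl; exact hc hx

theorem QP_acc (N : ℕ) : AccU N (QP (V := V) N) (fun u => Multiplicative.toAdd (Pt u (cu u)).2.2) where
  nil w hw := by simp [QP, Pt, hw]
  mv w hw b u := by simp only [QP, Pt]
  ed w hw d u := by
    unfold QP
    rw [sum_single_change _ (fun x => w (Multiplicative.toAdd (Pt u x).2.2)) (cu u)]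
    · congr 1
      simp [Pt]
    · intro x hx
      simp [Pt, Pi.mulSingle_eq_of_ne hx]
  z1 v v' u := by simp [Pt, cu]

noncomputable def Qsg (r N : ℕ) (w : ℤ → ℝ) (u : List (Atm V ZL)) : ℝ :=
  ((sg r u).map (fun q => ∑ x ∈ Finset.Icc (-(N:ℤ)) N, w (Multiplicative.toAdd (q.2 x).2.2))).sum

theorem Qsg_acc (r : ℕ) (hr : 0 < r) (N : ℕ) : AccU N (Qsg (V := V) r N)
    (fun u => Multiplicative.toAdd ((((sg r u).head?.map Prod.snd).getD 1) (cu u)).2.2) where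
  nil w hw := by simp [Qsg, sg, hw]
  mv w hw b u := by
    unfold Qsg
    rw [show sg r (.inl b :: u) = mvH r (cu (V := V) (L := ZL) (.inl b :: u)) (sg r u) from rfl]
    rcases sg r u with _ | ⟨⟨ρ, P⟩, l⟩
    · rfl
    · simp only [mvH]
      split_ifs
      · rfl
      · simp [hw]
  ed w hw d u := by
    unfold Qsg
    rw [show sg r (.inr d :: u) = edH (cu u) d (sg r u) from rfl]
    obtain ⟨ρ, P, l, h1, _⟩ := sg_inv r hr u
    rw [h1]
    simp only [edH, List.map_cons, List.sum_cons, List.head?_cons, Option.map_some, Option.getD_some]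
    rw [sum_single_change _ (fun x => w (Multiplicative.toAdd (P x).2.2)) (cu u)]
    · simp; ring
    · intro x hx
      simp [Pi.mulSingle_eq_of_ne hx]
  z1 v v' u := by
    rw [show sg r (.inr (v, v', 1) :: u) = edH (cu u) (v, v', (1 : ZL)) (sg r u) from rfl]
    obtain ⟨ρ, P, l, h1, _⟩ := sg_inv r hr u
    rw [h1]
    simp [edH, cu]

theorem nmB_abs (z : ZL) : (nmB z : ℝ) = |((Multiplicative.toAdd z : ℤ) : ℝ)| := by
  simp [nmB, Nat.cast_natAbs]

theorem gam_nm (s : ℕ) (u : List (Atm V ZL)) (x : ℤ) :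
    ∑ κ, nmB ((gam (lev := lev) k s u x).φ κ) ≤
      (∑ κ, nmB (((XX (aval (lev := lev) k) u).κ s x).φ κ)) + nmB (Pt u x).2.2 := by
  unfold gam
  set g := (XX (aval (lev := lev) k) u).κ s x
  set d := mix (k s) (fun x => (Pt u x)⁻¹) x with hd
  have h1 : ∀ κ, nmB ((g * st (lev s) d).φ κ) ≤ nmB (g.φ κ) + nmB ((st (lev s) d).φ (g.y⁻¹ • κ)) :=
    fun κ => nmB_mul _ _
  refine (Finset.sum_le_sum fun κ _ => h1 κ).trans ?_
  rw [Finset.sum_add_distrib]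
  refine add_le_add le_rfl ?_
  have h2 : ∑ κ, nmB ((st (lev s) d).φ (g.y⁻¹ • κ)) = ∑ κ, nmB ((st (lev s) d).φ κ) :=
    Equiv.sum_comp (MulAction.toPerm g.y⁻¹) (fun κ => nmB ((st (lev s) d).φ κ))
  rw [h2]
  have h3 : ∀ κ, nmB ((st (lev s) d).φ κ) = if κ = (lev s).o then nmB d.2.2 else 0 := by
    intro κ
    unfold st
    rw [Site.mul_φ, sAC_φ, sB_φ, mul_one]
    split_ifs <;> simp [nmB_one]
  simp only [h3, Finset.sum_ite_eq', Finset.mem_univ, if_true]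
  have : d.2.2 = (Pt u x).2.2⁻¹ := rfl
  rw [this, nmB_inv]

theorem Icc_sub {R n : ℕ} (h : R ≤ n) : Finset.Icc (-(R:ℤ)) R ⊆ Finset.Icc (-(n:ℤ)) n :=
  Finset.Icc_subset_Icc (by omega) (by omega)

variable {dd : ℕ → ℕ}

/-- deterministic bound -/
theorem JL_le (hk : ∀ s, 0 < k s) (hdd : ∀ s, 0 < dd s) (ss s n : ℕ) (l : List (Stp V)) (hl : l.length = n) :
    JL dd lev k nmB ss s (uu lamB l) ≤ 2 * n := by
  have hR : Ru (uu lamB l) ≤ n := hl ▸ Ru_le lamB l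
  have hP := (QP_acc (V := V) n).abs_le l
  have hφ := (Qφ_acc (lev := lev) k hk s n).abs_le l
  have hs := (Qsg_acc (V := V) (dd s) (hdd s) n).abs_le l
  rw [hl] at hP hφ hs
  set u := uu lamB l
  have hP' : ∑ x ∈ Finset.Icc (-(Ru u : ℤ)) (Ru u), nmB (Pt u x).2.2 ≤ n := by
    refine (Finset.sum_le_sum_of_subset (Icc_sub hR)).trans ?_
    have : ((∑ x ∈ Finset.Icc (-(n:ℤ)) n, nmB (Pt u x).2.2 : ℕ) : ℝ) ≤ n := by
      push_cast; simp only [nmB_abs]; exact hP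
    exact_mod_cast this
  unfold JL
  split_ifs
  · refine (Finset.sum_le_sum fun x _ => gam_nm k s u x).trans ?_
    rw [Finset.sum_add_distrib]
    have : ∑ x ∈ Finset.Icc (-(Ru u : ℤ)) (Ru u), ∑ κ, nmB (((XX (aval (lev := lev) k) u).κ s x).φ κ) ≤ n := by
      refine (Finset.sum_le_sum_of_subset (Icc_sub hR)).trans ?_
      have : ((∑ x ∈ Finset.Icc (-(n:ℤ)) n, ∑ κ, nmB (((XX (aval (lev := lev) k) u).κ s x).φ κ) : ℕ) : ℝ) ≤ n := by
        push_cast; simp only [nmB_abs]; exact hφ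
      exact_mod_cast this
    omega
  · rw [Finset.sum_add_distrib]
    have : ∑ x ∈ Finset.Icc (-(Ru u : ℤ)) (Ru u), ((sg (dd s) u).map (fun q => nmB (q.2 x).2.2)).sum ≤ n := by
      refine (Finset.sum_le_sum_of_subset (Icc_sub hR)).trans ?_
      have : ((∑ x ∈ Finset.Icc (-(n:ℤ)) n, ((sg (dd s) u).map (fun q => nmB (q.2 x).2.2)).sum : ℕ) : ℝ) ≤ n := by
        refine le_trans (le_of_eq ?_) hs
        unfold Qsg
        generalize sg (dd s) u = m
        induction m with
        | nil => simp
        | cons q m ih =>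
          simp only [List.map_cons, List.sum_cons, Finset.sum_add_distrib, ← ih]
          push_cast; simp only [nmB_abs]
      exact_mod_cast this
    omega
  · omega

variable [Fintype V]

theorem amgm {t : ℝ} (ht : 0 < t) (z : ℝ) : |z| ≤ z ^ 2 / (2 * t) + t / 2 := by
  rw [div_add_div _ _ (by positivity) (by norm_num), le_div_iff₀ (by positivity)]
  have : z ^ 2 = |z| ^ 2 := (sq_abs z).symm
  nlinarith [sq_nonneg (|z| - t)]

theorem card_IccR (R : ℕ) : ((Finset.Icc (-(R:ℤ)) R).card : ℝ) = 2 * R + 1 := by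
  rw [Int.card_Icc]
  have : ((R:ℤ) + 1 - -R).toNat = 2 * R + 1 := by omega
  rw [this]; push_cast; ring

theorem P_pt {t : ℝ} (ht : 0 < t) (n : ℕ) (u : List (Atm V ZL)) (hR : Ru u ≤ n) :
    ((∑ x ∈ Finset.Icc (-(Ru u : ℤ)) (Ru u), nmB (Pt u x).2.2 : ℕ) : ℝ) ≤
      (1 / (2 * t)) * QP n (fun t => (t:ℝ) ^ 2) u + (t / 2) * (2 * Ru u + 1) := by
  have h1 : ((∑ x ∈ Finset.Icc (-(Ru u : ℤ)) (Ru u), nmB (Pt u x).2.2 : ℕ) : ℝ) ≤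
      ∑ x ∈ Finset.Icc (-(Ru u : ℤ)) (Ru u), ((1 / (2 * t)) * ((Multiplicative.toAdd (Pt u x).2.2 : ℤ) : ℝ) ^ 2 + t / 2) := by
    push_cast
    refine Finset.sum_le_sum fun x _ => ?_
    rw [nmB_abs]
    have := amgm ht ((Multiplicative.toAdd (Pt u x).2.2 : ℤ) : ℝ)
    refine this.trans (le_of_eq ?_); ring
  refine h1.trans ?_
  rw [Finset.sum_add_distrib, ← Finset.mul_sum, Finset.sum_const, nsmul_eq_mul, card_IccR]
  have h2 : ∑ x ∈ Finset.Icc (-(Ru u : ℤ)) (Ru u), ((Multiplicative.toAdd (Pt u x).2.2 : ℤ) : ℝ) ^ 2 ≤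
      QP n (fun t => (t:ℝ) ^ 2) u :=
    Finset.sum_le_sum_of_subset_of_nonneg (Icc_sub hR) (fun _ _ _ => sq_nonneg _)
  have := mul_le_mul_of_nonneg_left h2 (show 0 ≤ 1 / (2 * t) by positivity)
  linarith

theorem E_P {t : ℝ} (ht : 0 < t) (n : ℕ) (hn : 1 ≤ n) :
    EE n (fun l : List (Stp V) => ((∑ x ∈ Finset.Icc (-(Ru (uu lamB l) : ℤ)) (Ru (uu lamB l)),
      nmB (Pt (uu lamB l) x).2.2 : ℕ) : ℝ)) ≤ n / (2 * t) + 4 * t * Real.sqrt n := by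
  refine (EE_mono fun l hl => P_pt ht n (uu lamB l) (hl ▸ Ru_le lamB l)).trans ?_
  rw [EE_add, EE_smul, EE_smul, EE_add, EE_smul, EE_const]
  have h1 := (QP_acc (V := V) n).sq_le n
  have h2 := E_R (V := V) lamB n
  have hs : 1 ≤ Real.sqrt n := Real.one_le_sqrt.2 (by exact_mod_cast hn)
  have h3 := mul_le_mul_of_nonneg_left h1 (show 0 ≤ 1 / (2 * t) by positivity)
  have h4 := mul_le_mul_of_nonneg_left h2 ht.le
  have h5 := mul_le_mul_of_nonneg_left hs ht.le
  have e : 1 / (2 * t) * (n:ℝ) = n / (2 * t) := by ring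
  linarith

theorem E_Jtour (hk : ∀ s, 0 < k s) {t : ℝ} (ht : 0 < t) (ss s n : ℕ) (hn : 1 ≤ n) (hs : s < ss) :
    EE n (fun l : List (Stp V) => (JL dd lev k nmB ss s (uu lamB l) : ℝ)) ≤
      n / t + 8 * t * Real.sqrt n * Fintype.card (lev s).K := by
  have hK : (1:ℝ) ≤ Fintype.card (lev s).K := by
    have : 0 < Fintype.card (lev s).K := Fintype.card_pos_iff.2 ⟨(lev s).o⟩
    exact_mod_cast this
  set KK : ℝ := (Fintype.card (lev s).K : ℝ) with hKK
  have hpt : ∀ l : List (Stp V), l.length = n → (JL dd lev k nmB ss s (uu lamB l) : ℝ) ≤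
      ((1 / (2 * t)) * Qφ lev k s n (fun t => (t:ℝ) ^ 2) (uu lamB l) + (t / 2 * KK) * (2 * Ru (uu lamB l) + 1)) +
      ((∑ x ∈ Finset.Icc (-(Ru (uu lamB l) : ℤ)) (Ru (uu lamB l)),
      nmB (Pt (uu lamB l) x).2.2 : ℕ) : ℝ) := by
    intro l hl
    have hR : Ru (uu lamB l) ≤ n := hl ▸ Ru_le lamB l
    set u := uu lamB l
    have h0 : JL dd lev k nmB ss s u ≤ (∑ x ∈ Finset.Icc (-(Ru u : ℤ)) (Ru u),
        ∑ κ, nmB (((XX (aval (lev := lev) k) u).κ s x).φ κ)) +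
        ∑ x ∈ Finset.Icc (-(Ru u : ℤ)) (Ru u), nmB (Pt u x).2.2 := by
      unfold JL
      simp only [hs, if_true]
      rw [← Finset.sum_add_distrib]
      split_ifs
      · exact Finset.sum_le_sum fun x _ => gam_nm k s u x
      · exact Nat.zero_le _
    have h0' : (JL dd lev k nmB ss s u : ℝ) ≤ ((∑ x ∈ Finset.Icc (-(Ru u : ℤ)) (Ru u),
        ∑ κ, nmB (((XX (aval (lev := lev) k) u).κ s x).φ κ) : ℕ) : ℝ) +
        ((∑ x ∈ Finset.Icc (-(Ru u : ℤ)) (Ru u), nmB (Pt u x).2.2 : ℕ) : ℝ) := by exact_mod_cast h0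
    refine h0'.trans (add_le_add ?_ le_rfl)
    have h1 : ((∑ x ∈ Finset.Icc (-(Ru u : ℤ)) (Ru u),
        ∑ κ, nmB (((XX (aval (lev := lev) k) u).κ s x).φ κ) : ℕ) : ℝ) ≤
        ∑ x ∈ Finset.Icc (-(Ru u : ℤ)) (Ru u), ∑ κ,
          ((1 / (2 * t)) * ((Multiplicative.toAdd (((XX (aval (lev := lev) k) u).κ s x).φ κ) : ℤ) : ℝ) ^ 2 + t / 2) := by
      push_cast
      refine Finset.sum_le_sum fun x _ => Finset.sum_le_sum fun κ _ => ?_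
      rw [nmB_abs]
      refine (amgm ht _).trans (le_of_eq ?_); ring
    refine h1.trans ?_
    simp only [Finset.sum_add_distrib, ← Finset.mul_sum, Finset.sum_const, nsmul_eq_mul]
    rw [card_IccR, Finset.card_univ]
    have h2 : ∑ x ∈ Finset.Icc (-(Ru u : ℤ)) (Ru u), ∑ κ,
        ((Multiplicative.toAdd (((XX (aval (lev := lev) k) u).κ s x).φ κ) : ℤ) : ℝ) ^ 2 ≤
        Qφ lev k s n (fun t => (t:ℝ) ^ 2) u :=
      Finset.sum_le_sum_of_subset_of_nonneg (Icc_sub hR)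
        (fun _ _ _ => Finset.sum_nonneg fun _ _ => sq_nonneg _)
    have := mul_le_mul_of_nonneg_left h2 (show 0 ≤ 1 / (2 * t) by positivity)
    rw [← hKK]
    linarith
  refine (EE_mono hpt).trans ?_
  rw [EE_add, EE_add, EE_smul, EE_smul, EE_add, EE_smul, EE_const]
  have h1 := (Qφ_acc (lev := lev) k hk s n).sq_le n
  have h2 := E_R (V := V) lamB n
  have h6 := E_P (V := V) ht n hn
  have hs : 1 ≤ Real.sqrt n := Real.one_le_sqrt.2 (by exact_mod_cast hn)
  have h3 := mul_le_mul_of_nonneg_left h1 (show 0 ≤ 1 / (2 * t) by positivity)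
  have h4 := mul_le_mul_of_nonneg_left h2 (show 0 ≤ t * KK by positivity)
  have h5 := mul_le_mul_of_nonneg_left hs (show 0 ≤ t * KK by positivity)
  have h7 : 4 * t * Real.sqrt n * 1 ≤ 4 * t * Real.sqrt n * KK := by gcongr
  have e : 1 / (2 * t) * (n:ℝ) = n / t / 2 := by field_simp
  have e' : (n:ℝ) / (2 * t) = n / t / 2 := by field_simp
  rw [e] at h3
  rw [e'] at h6
  have h8 : 0 ≤ t * KK := by positivity
  linarith

theorem seg_one {t : ℝ} (ht : 0 < t) (r R n : ℕ) (hR : R ≤ n) (q : ℤ × (ℤ → DD V ZL))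
    (hq : ∀ x : ℤ, (r : ℤ) ≤ |x - q.1| → q.2 x = 1) :
    ((∑ x ∈ Finset.Icc (-(R : ℤ)) R, nmB (q.2 x).2.2 : ℕ) : ℝ) ≤
      (1 / (2 * t)) * (∑ x ∈ Finset.Icc (-(n:ℤ)) n, ((Multiplicative.toAdd (q.2 x).2.2 : ℤ) : ℝ) ^ 2) + t * r := by
  have h1 : ((∑ x ∈ Finset.Icc (-(R : ℤ)) R, nmB (q.2 x).2.2 : ℕ) : ℝ) ≤
      ∑ x ∈ Finset.Icc (-(R : ℤ)) R, ((1 / (2 * t)) * ((Multiplicative.toAdd (q.2 x).2.2 : ℤ) : ℝ) ^ 2 +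
        if x ∈ Finset.Ioo (q.1 - r) (q.1 + r) then t / 2 else 0) := by
    push_cast
    refine Finset.sum_le_sum fun x _ => ?_
    by_cases hx : x ∈ Finset.Ioo (q.1 - r) (q.1 + r)
    · rw [if_pos hx, nmB_abs]
      refine (amgm ht _).trans (le_of_eq ?_); ring
    · rw [if_neg hx, hq x]
      · simp [nmB_one]
      · rw [Finset.mem_Ioo] at hx
        by_contra hlt
        rw [not_le, abs_lt] at hlt
        exact hx ⟨by omega, by omega⟩
  refine h1.trans ?_
  rw [Finset.sum_add_distrib, ← Finset.mul_sum]
  have h2 : ∑ x ∈ Finset.Icc (-(R : ℤ)) R, ((Multiplicative.toAdd (q.2 x).2.2 : ℤ) : ℝ) ^ 2 ≤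
      ∑ x ∈ Finset.Icc (-(n:ℤ)) n, ((Multiplicative.toAdd (q.2 x).2.2 : ℤ) : ℝ) ^ 2 :=
    Finset.sum_le_sum_of_subset_of_nonneg (Icc_sub hR) (fun _ _ _ => sq_nonneg _)
  have h3 : ∑ x ∈ Finset.Icc (-(R : ℤ)) R, (if x ∈ Finset.Ioo (q.1 - r) (q.1 + r) then t / 2 else 0) ≤ t * r := by
    rw [← Finset.sum_filter, Finset.sum_const, nsmul_eq_mul]
    have : (Finset.filter (fun x => x ∈ Finset.Ioo (q.1 - (r:ℤ)) (q.1 + r)) (Finset.Icc (-(R : ℤ)) R)).card ≤ 2 * r := by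
      refine (Finset.card_le_card (fun x hx => (Finset.mem_filter.1 hx).2)).trans ?_
      rw [Int.card_Ioo]; omega
    have h4 : ((Finset.filter (fun x => x ∈ Finset.Ioo (q.1 - (r:ℤ)) (q.1 + r)) (Finset.Icc (-(R : ℤ)) R)).card : ℝ) ≤ 2 * r := by
      exact_mod_cast this
    nlinarith
  have := mul_le_mul_of_nonneg_left h2 (show 0 ≤ 1 / (2 * t) by positivity)
  linarith

theorem seg_list {t : ℝ} (ht : 0 < t) (r R n : ℕ) (hR : R ≤ n) (m : List (ℤ × (ℤ → DD V ZL)))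
    (hm : ∀ p ∈ m, ∀ x : ℤ, (r : ℤ) ≤ |x - p.1| → p.2 x = 1) :
    ((∑ x ∈ Finset.Icc (-(R : ℤ)) R, (m.map (fun q => nmB (q.2 x).2.2)).sum : ℕ) : ℝ) ≤
      (1 / (2 * t)) * (m.map (fun q => ∑ x ∈ Finset.Icc (-(n:ℤ)) n,
        ((Multiplicative.toAdd (q.2 x).2.2 : ℤ) : ℝ) ^ 2)).sum + t * r * m.length := by
  induction m with
  | nil => simp
  | cons q m ih =>
    have h1 := seg_one ht r R n hR q (hm q (by simp))
    have h2 := ih (fun p hp => hm p (by simp [hp]))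
    simp only [List.map_cons, List.sum_cons, Finset.sum_add_distrib, List.length_cons]
    push_cast at h1 h2 ⊢
    linarith

theorem E_Jseg (hdd : ∀ s, 0 < dd s) {t : ℝ} (ht : 0 < t) (ss s n : ℕ) (hs : ¬ s < ss) :
    EE n (fun l : List (Stp V) => (JL dd lev k nmB ss s (uu lamB l) : ℝ)) ≤
      n / t + 5 * t * n / dd s := by
  have hd : (0:ℝ) < dd s := by exact_mod_cast hdd s
  have hpt : ∀ l : List (Stp V), l.length = n → (JL dd lev k nmB ss s (uu lamB l) : ℝ) ≤
      ((1 / (2 * t)) * Qsg (dd s) n (fun t => (t:ℝ) ^ 2) (uu lamB l) +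
        (1 / (2 * t)) * QP n (fun t => (t:ℝ) ^ 2) (uu lamB l)) +
      (((t * dd s) * (if 4 * dd s ≤ 2 * Ru (uu lamB l) then ((sg (dd s) (uu lamB l)).length : ℝ) else 0)) +
        (3 * t / 2) * (if 4 * dd s ≤ 2 * Ru (uu lamB l) then (Ru (uu lamB l) : ℝ) else 0)) := by
    intro l hl
    have hR : Ru (uu lamB l) ≤ n := hl ▸ Ru_le lamB l
    have hQ1 : 0 ≤ Qsg (dd s) n (fun t => (t:ℝ) ^ 2) (uu lamB l) :=
      List.sum_nonneg (by
        intro x hx; rw [List.mem_map] at hx; obtain ⟨q, _, rfl⟩ := hx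
        exact Finset.sum_nonneg fun _ _ => sq_nonneg _)
    have hQ2 : 0 ≤ QP n (fun t => (t:ℝ) ^ 2) (uu lamB l) := Finset.sum_nonneg fun _ _ => sq_nonneg _
    set u := uu lamB l
    unfold JL
    simp only [hs, if_false]
    by_cases ha : 4 * dd s ≤ 2 * Ru u
    · simp only [ha, if_true]
      rw [Finset.sum_add_distrib]
      have h1 := P_pt ht n u hR
      obtain ⟨_, _, _, _, _, h3⟩ := sg_inv (dd s) (hdd s) u
      have h2 := seg_list ht (dd s) (Ru u) n hR (sg (dd s) u) h3
      have h4 : (1:ℝ) ≤ Ru u := by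
        have := hdd s
        exact_mod_cast (show 1 ≤ Ru u by omega)
      have h5 := mul_le_mul_of_nonneg_left h4 ht.le
      rw [Nat.cast_add]
      unfold Qsg
      linarith
    · simp only [ha, if_false]
      have : 0 ≤ 1 / (2 * t) := by positivity
      have := mul_nonneg this hQ1
      have := mul_nonneg (show 0 ≤ 1 / (2 * t) by positivity) hQ2
      simp only [Nat.cast_zero, mul_zero, add_zero]; linarith
  refine (EE_mono hpt).trans ?_
  rw [EE_add, EE_add, EE_add, EE_smul, EE_smul, EE_smul, EE_smul]
  have h1 := (Qsg_acc (V := V) (dd s) (hdd s) n).sq_le n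
  have h2 := (QP_acc (V := V) n).sq_le n
  have h3 := E_lenact (V := V) lamB (dd s) (hdd s) n
  have h4 := E_Ract (V := V) lamB (dd s) (hdd s) n
  have g1 := mul_le_mul_of_nonneg_left h1 (show 0 ≤ 1 / (2 * t) by positivity)
  have g2 := mul_le_mul_of_nonneg_left h2 (show 0 ≤ 1 / (2 * t) by positivity)
  have g3 := mul_le_mul_of_nonneg_left h3 (show 0 ≤ t * dd s by positivity)
  have g4 := mul_le_mul_of_nonneg_left h4 (show 0 ≤ 3 * t / 2 by positivity)
  have e : 1 / (2 * t) * (n:ℝ) = n / t / 2 := by field_simp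
  have e3 : t * dd s * (2 * n / (dd s : ℝ) ^ 2) = 2 * (t * n / dd s) := by field_simp
  have e4 : 3 * t / 2 * (2 * n / (dd s : ℝ)) = 3 * (t * n / dd s) := by field_simp
  have e5 : 5 * t * n / (dd s : ℝ) = 5 * (t * n / dd s) := by ring
  rw [e] at g1 g2
  rw [e3] at g3
  rw [e4] at g4
  rw [e5]
  linarith

end
end SE

/-! ## Part P6 -/
namespace SE

section
variable {V : Type} [CommGroup V] [Fintype V]

noncomputable def PA (E : Lev V) (g : E.Y → ℝ) (y : E.Y) : ℝ := av (fun v => g (y * E.A v))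
noncomputable def PB (E : Lev V) (g : E.Y → ℝ) (y : E.Y) : ℝ := av (fun v => g (y * E.B v))
noncomputable def f0 (E : Lev V) (y : E.Y) : ℝ := if y • E.o = E.o then 1 else 0
noncomputable def hh (E : Lev V) : ℕ → E.Y → ℝ
  | 0 => f0 E
  | N + 1 => PA E (PB E (hh E N))

theorem PA_PA (E : Lev V) (g : E.Y → ℝ) : PA E (PA E g) = PA E g := by
  funext y
  unfold PA
  have : ∀ v : V, av (fun w => g (y * E.A v * E.A w)) = av (fun w => g (y * E.A w)) := by
    intro v
    have := av_equiv (Equiv.mulLeft v) (fun w => g (y * E.A w))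
    simpa [mul_assoc] using this
  simp only [this, av_const]

theorem PB_PB (E : Lev V) (g : E.Y → ℝ) : PB E (PB E g) = PB E g := by
  funext y
  unfold PB
  have : ∀ v : V, av (fun w => g (y * E.B v * E.B w)) = av (fun w => g (y * E.B w)) := by
    intro v
    have := av_equiv (Equiv.mulLeft v) (fun w => g (y * E.B w))
    simpa [mul_assoc] using this
  simp only [this, av_const]

theorem PA_f0 (E : Lev V) : PA E (f0 E) = f0 E := by
  funext y
  simp only [PA, f0, mul_smul, E.hA, av_const]

theorem PA_hh (E : Lev V) (N : ℕ) : PA E (hh E N) = hh E N := by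
  cases N with
  | zero => exact PA_f0 E
  | succ N => exact PA_PA E _

theorem PA_add (E : Lev V) (a b : ℝ) (f g : E.Y → ℝ) (y : E.Y) :
    PA E (fun y => a * f y + b * g y) y = a * PA E f y + b * PA E g y := by
  unfold PA
  rw [av_add (fun v => a * f (y * E.A v)) (fun v => b * g (y * E.A v)), av_smul a (fun v => f (y * E.A v)),
    av_smul b (fun v => g (y * E.A v))]

theorem PB_add (E : Lev V) (a b : ℝ) (f g : E.Y → ℝ) (y : E.Y) :
    PB E (fun y => a * f y + b * g y) y = a * PB E f y + b * PB E g y := by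
  unfold PB
  rw [av_add (fun v => a * f (y * E.B v)) (fun v => b * g (y * E.B v)), av_smul a (fun v => f (y * E.B v)),
    av_smul b (fun v => g (y * E.B v))]

/-- Edit of site `0` from cursor `c`. -/
noncomputable def edy (E : Lev V) (k : ℕ) (c : ℤ) (d : V × V) : E.Y :=
  (if 0 = c then E.A d.1 else 1) * (if 0 - (k:ℤ) = c then E.B d.2 else 1)

noncomputable def Pc (E : Lev V) (k : ℕ) (c : ℤ) (g : E.Y → ℝ) (y : E.Y) : ℝ :=
  av (fun d : V × V => g (y * edy E k c d))

theorem Pc_zero (E : Lev V) (k : ℕ) (hk : 0 < k) (g : E.Y → ℝ) : Pc E k 0 g = PA E g := by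
  funext y
  have : ¬ (0 - (k:ℤ) = 0) := by omega
  simp only [Pc, edy, if_true, this, if_false, mul_one]
  rw [av_prod]
  simp only [av_const, PA]

theorem Pc_k (E : Lev V) (k : ℕ) (hk : 0 < k) (g : E.Y → ℝ) : Pc E k (-k) g = PB E g := by
  funext y
  have h1 : ¬ (0 = -(k:ℤ)) := by omega
  simp only [Pc, edy, zero_sub, if_true, h1, if_false, one_mul]
  rw [av_prod]
  simp only [av_const, PB]

theorem Pc_ne (E : Lev V) (k : ℕ) (c : ℤ) (h0 : c ≠ 0) (h1 : c ≠ -k) (g : E.Y → ℝ) : Pc E k c g = g := by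
  funext y
  have h1 : ¬ (-(k:ℤ) = c) := fun h => h1 h.symm
  simp only [Pc, edy, zero_sub, h0.symm, h1, if_false, mul_one, av_const]

noncomputable def al (k : ℕ) (c : ℤ) : ℝ := max 0 (min (k:ℝ) (k + c))

theorem al_zero (k : ℕ) : al k 0 = k := by simp [al]
theorem al_k (k : ℕ) : al k (-k) = 0 := by simp [al]
theorem al_nonneg (k : ℕ) (c : ℤ) : 0 ≤ al k c := le_max_left _ _
theorem al_le (k : ℕ) (c : ℤ) : al k c ≤ k := max_le (by positivity) (min_le_left _ _)
theorem al_pos {k : ℕ} {c : ℤ} (h : 0 ≤ c) : al k c = k := by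
  have : (0:ℝ) ≤ c := by exact_mod_cast h
  unfold al; rw [min_eq_left (by linarith), max_eq_right (by positivity)]
theorem al_neg {k : ℕ} {c : ℤ} (h : c ≤ -k) : al k c = 0 := by
  have : (c:ℝ) ≤ -k := by exact_mod_cast h
  unfold al; rw [max_eq_left]; exact (min_le_right _ _).trans (by linarith)
theorem al_mid {k : ℕ} {c : ℤ} (h : -k ≤ c) (h' : c ≤ 0) : al k c = k + c := by
  have h1 : -(k:ℝ) ≤ c := by exact_mod_cast h
  have h2 : (c:ℝ) ≤ 0 := by exact_mod_cast h'
  unfold al; rw [min_eq_right (by linarith), max_eq_right (by linarith)]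

noncomputable def vv (E : Lev V) (k : ℕ) (g : E.Y → ℝ) (c : ℤ) (y : E.Y) : ℝ :=
  (4 * al k c) * g y + (4 * (k - al k c)) * PB E g y

theorem Pc_vv (E : Lev V) (k : ℕ) (hk : 0 < k) (g : E.Y → ℝ) (hg : PA E g = g) (c : ℤ) :
    Pc E k c (vv E k g c) = vv E k g c := by
  by_cases h0 : c = 0
  · subst h0
    rw [Pc_zero E k hk]
    funext y
    unfold vv
    rw [PA_add, hg, al_zero]; simp
  by_cases h1 : c = -k
  · subst h1
    rw [Pc_k E k hk]
    funext y
    unfold vv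
    rw [PB_add, PB_PB, al_k]; simp
  exact Pc_ne E k c h0 h1 _

theorem vv_step (E : Lev V) (k : ℕ) (hk : 0 < k) (g : E.Y → ℝ) (hg : PA E g = g) (c : ℤ) (y : E.Y) :
    Pc E k c (fun y => (2 * vv E k g c y + vv E k g (c + 1) y + vv E k g (c + -1) y) / 4) y =
      vv E k g c y + if c = 0 then PA E (PB E g) y - g y else 0 := by
  have h : (fun y => (2 * vv E k g c y + vv E k g (c + 1) y + vv E k g (c + -1) y) / 4) =
      fun y => (2 * al k c + al k (c + 1) + al k (c + -1)) * g y +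
        (4 * k - (2 * al k c + al k (c + 1) + al k (c + -1))) * PB E g y := by
    funext y; unfold vv; ring
  rw [h]
  have hk' : (1:ℝ) ≤ k := by exact_mod_cast hk
  by_cases h0 : c = 0
  · subst h0
    rw [Pc_zero E k hk, PA_add, hg, if_pos rfl]
    unfold vv
    rw [al_zero, al_pos (by norm_num : (0:ℤ) ≤ 0 + 1), al_mid (by omega) (by norm_num : (0:ℤ) + -1 ≤ 0)]
    push_cast; ring
  rw [if_neg h0, add_zero]
  by_cases h1 : c = -k
  · subst h1
    rw [Pc_k E k hk, PB_add, PB_PB]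
    unfold vv
    rw [al_k]; ring
  rw [Pc_ne E k c h0 h1]
  unfold vv
  have : 2 * al k c + al k (c + 1) + al k (c + -1) = 4 * al k c := by
    rcases lt_or_gt_of_ne h0 with h | h
    · rcases lt_or_gt_of_ne h1 with h' | h'
      · rw [al_neg (by omega), al_neg (by omega), al_neg (by omega)]; ring
      · rw [al_mid (by omega) (by omega), al_mid (by omega) (by omega), al_mid (by omega) (by omega)]
        push_cast; ring
    · rw [al_pos (by omega), al_pos (by omega), al_pos (by omega)]; ring
  rw [this]; ring

theorem av_stp3 (F : V × V → V × V → ℤ → ℝ) :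
    av (fun a : Stp V => F a.1.1 a.1.2.1 (dl a.1)) =
      av fun f1 => av fun f2 => (2 * F f1 f2 0 + F f1 f2 1 + F f1 f2 (-1)) / 4 := by
  rw [av_prod]
  simp only [av_const]
  rw [av_prod]
  congr 1; funext f1
  rw [av_prod]
  congr 1; funext f2
  rw [av_prod]
  simp [dl, av_bool]
  ring

end

section
variable {V L : Type} [CommGroup V] [Fintype V] [CommGroup L]
variable {lev : ℕ → Lev V} (k : ℕ → ℕ) (lam : Bool → L)

/-- state of site zero at level `s` -/
noncomputable def yz (lev : ℕ → Lev V) (s : ℕ) (x : ℤ) (l : List (Stp V)) : (lev s).Y :=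
  ((XX (aval (lev := lev) k) (uu lam l)).κ s x).y

theorem yz_nil (s : ℕ) (x : ℤ) : yz k lam lev s x [] = 1 := rfl

theorem yz_cons (s : ℕ) (a : Stp V) (l : List (Stp V)) :
    yz k lam lev s 0 (a :: l) = yz k lam lev s 0 l * edy (lev s) (k s) (cu (uu lam l)) a.1.1 *
      edy (lev s) (k s) (cu (uu lam l) + dl a.1) a.1.2.1 := by
  unfold yz
  rw [uu_cons, y_edit]
  have h1 : cu (mm lam a :: .inr (a.1.1.1, a.1.1.2, 1) :: uu lam l) = cu (uu lam l) + dl a.1 := by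
    rw [cu_mm]; rfl
  have h2 : ((XX (aval (lev := lev) k) (mm lam a :: .inr (a.1.1.1, a.1.1.2, 1) :: uu lam l)).κ s 0).y =
      ((XX (aval (lev := lev) k) (.inr (a.1.1.1, a.1.1.2, 1) :: uu lam l)).κ s 0).y := by
    unfold mm
    split_ifs
    · rw [y_edit]; simp
    · rw [XX_κ_move]
  rw [h1, h2, y_edit]
  rfl

theorem vv_av (hk : ∀ s, 0 < k s) (s : ℕ) (g : (lev s).Y → ℝ) (hg : PA (lev s) g = g) (l : List (Stp V)) :
    av (fun a : Stp V => vv (lev s) (k s) g (cu (uu lam (a :: l))) (yz k lam lev s 0 (a :: l))) =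
      vv (lev s) (k s) g (cu (uu lam l)) (yz k lam lev s 0 l) +
        if cu (uu lam l) = 0 then PA (lev s) (PB (lev s) g) (yz k lam lev s 0 l) - g (yz k lam lev s 0 l) else 0 := by
  simp only [cu_uu, yz_cons]
  set c := cu (uu lam l)
  set y := yz k lam lev s 0 l
  have h1 := av_stp3 (V := V) (fun f1 f2 δ => vv (lev s) (k s) g (c + δ)
    (y * edy (lev s) (k s) c f1 * edy (lev s) (k s) (c + δ) f2))
  rw [h1, ← vv_step (lev s) (k s) (hk s) g hg c y]
  unfold Pc
  congr 1; funext f1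
  set y' := y * edy (lev s) (k s) c f1
  have h2 : ∀ δ : ℤ, av (fun f2 => vv (lev s) (k s) g (c + δ) (y' * edy (lev s) (k s) (c + δ) f2)) =
      vv (lev s) (k s) g (c + δ) y' := fun δ => congrFun (Pc_vv (lev s) (k s) (hk s) g hg (c + δ)) y'
  have h3 : ∀ F0 F1 F2 : V × V → ℝ, av (fun f2 => (2 * F0 f2 + F1 f2 + F2 f2) / 4) =
      (2 * av F0 + av F1 + av F2) / 4 := by
    intro F0 F1 F2
    simp only [av, ← Finset.sum_div, Finset.sum_add_distrib, ← Finset.mul_sum]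
    ring
  rw [h3 (fun f2 => vv (lev s) (k s) g (c + 0) (y' * edy (lev s) (k s) (c + 0) f2))
    (fun f2 => vv (lev s) (k s) g (c + 1) (y' * edy (lev s) (k s) (c + 1) f2))
    (fun f2 => vv (lev s) (k s) g (c + -1) (y' * edy (lev s) (k s) (c + -1) f2)), h2, h2, h2, add_zero]

noncomputable def pp (lev : ℕ → Lev V) (s m : ℕ) : ℝ :=
  EE m (fun l : List (Stp V) => if cu (uu lam l) = 0 ∧ yz k lam lev s 0 l • (lev s).o = (lev s).o then 1 else 0)

theorem EE_tele {α : Type} [Fintype α] [Nonempty α] (F c : List α → ℝ)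
    (h : ∀ l, av (fun a => F (a :: l)) = F l + c l) (n : ℕ) :
    EE n F = F [] + ∑ m ∈ Finset.range n, EE m c := by
  induction n with
  | zero => simp [EE_zero]
  | succ n ih =>
    rw [EE_succ', Finset.sum_range_succ, ← add_assoc, ← ih, ← EE_add]
    exact EE_congr fun l _ => h l

theorem E_c0 (n : ℕ) : ∑ m ∈ Finset.range n, EE m (fun l : List (Stp V) =>
    if cu (uu lam l) = 0 then (1:ℝ) else 0) ≤ 2 * Real.sqrt n := by
  have h1 : EE n (fun l : List (Stp V) => |((cu (uu lam l) : ℤ) : ℝ)|) = |(((0:ℤ)) : ℝ)| +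
      ∑ m ∈ Finset.range n, EE m (fun l : List (Stp V) => (1/2) * if cu (uu lam l) = 0 then (1:ℝ) else 0) := by
    refine EE_tele (fun l : List (Stp V) => |((cu (uu lam l) : ℤ) : ℝ)|) _ (fun l => ?_) n
    simp only [cu_uu]
    rw [av_dl (V := V) (fun δ => |((cu (uu lam l) + δ : ℤ) : ℝ)|)]
    set c := cu (uu lam l)
    rcases lt_trichotomy c 0 with h | h | h
    · have h1 : c + 1 ≤ 0 := h
      have a1 : ((c + 1 : ℤ) : ℝ) ≤ 0 := by exact_mod_cast h1
      have a2 : ((c + 0 : ℤ) : ℝ) ≤ 0 := by push_cast at a1 ⊢; linarith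
      have a3 : ((c + -1 : ℤ) : ℝ) ≤ 0 := by push_cast at a1 ⊢; linarith
      have a4 : ((c : ℤ) : ℝ) ≤ 0 := by push_cast at a1 ⊢; linarith
      rw [abs_of_nonpos a1, abs_of_nonpos a2, abs_of_nonpos a3, abs_of_nonpos a4, if_neg h.ne]
      push_cast; ring
    · rw [h]; norm_num
    · have h1 : 0 ≤ c + -1 := by omega
      have a1 : 0 ≤ ((c + -1 : ℤ) : ℝ) := by exact_mod_cast h1
      have a2 : 0 ≤ ((c + 0 : ℤ) : ℝ) := by push_cast at a1 ⊢; linarith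
      have a3 : 0 ≤ ((c + 1 : ℤ) : ℝ) := by push_cast at a1 ⊢; linarith
      have a4 : 0 ≤ ((c : ℤ) : ℝ) := by push_cast at a1 ⊢; linarith
      rw [abs_of_nonneg a1, abs_of_nonneg a2, abs_of_nonneg a3, abs_of_nonneg a4, if_neg h.ne']
      push_cast; ring
  simp only [EE_smul, ← Finset.mul_sum, Int.cast_zero, abs_zero, zero_add] at h1
  have h2 : EE n (fun l : List (Stp V) => |((cu (uu lam l) : ℤ) : ℝ)|) ≤ Real.sqrt n := by
    rcases Nat.eq_zero_or_pos n with rfl | hn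
    · simp [EE_zero, uu_nil, cu]
    have hs : 0 < Real.sqrt n := Real.sqrt_pos.2 (by exact_mod_cast hn)
    have h3 : ∀ l : List (Stp V), l.length = n → |((cu (uu lam l) : ℤ) : ℝ)| ≤
        (1 / (2 * Real.sqrt n)) * ((cu (uu lam l) : ℤ) : ℝ) ^ 2 + Real.sqrt n / 2 := by
      intro l _
      refine (amgm hs _).trans (le_of_eq ?_); ring
    refine (EE_mono h3).trans ?_
    rw [EE_add, EE_smul, EE_const]
    have h4 := E_c2 (V := V) lam n
    have h5 := mul_le_mul_of_nonneg_left h4 (show 0 ≤ 1 / (2 * Real.sqrt n) by positivity)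
    have h6 : 1 / (2 * Real.sqrt n) * ((n:ℝ) / 2) = Real.sqrt n / 4 := by
      have : (n:ℝ) = Real.sqrt n * Real.sqrt n := (Real.mul_self_sqrt (by positivity)).symm
      rw [this, Real.sqrt_mul_self hs.le]
      field_simp
      norm_num
    linarith
  linarith

theorem f0_le (E : Lev V) (y : E.Y) : f0 E y ≤ 1 := by unfold f0; split_ifs <;> norm_num
theorem f0_nonneg (E : Lev V) (y : E.Y) : 0 ≤ f0 E y := by unfold f0; split_ifs <;> norm_num
theorem hh_nonneg (E : Lev V) (N : ℕ) (y : E.Y) : 0 ≤ hh E N y := by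
  induction N generalizing y with
  | zero => exact f0_nonneg E y
  | succ N ih =>
    have : ∀ {β : Type} [Fintype β] (f : β → ℝ), (∀ b, 0 ≤ f b) → 0 ≤ av f := by
      intro β _ f h
      exact div_nonneg (Finset.sum_nonneg fun b _ => h b) (by positivity)
    exact this _ fun v => this _ fun w => ih _

/-- the Green function bound -/
theorem G_bound (hk : ∀ s, 0 < k s) (s K n : ℕ) (B b : ℝ)
    (hB : ∑ N ∈ Finset.range K, hh (lev s) N 1 ≤ B) (hb : ∀ y, hh (lev s) K y ≤ b) (hb0 : 0 ≤ b) :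
    ∑ m ∈ Finset.range n, pp k lam lev s m ≤ 4 * k s * B + b * (2 * Real.sqrt n) := by
  set g : (lev s).Y → ℝ := fun y => ∑ N ∈ Finset.range K, hh (lev s) N y with hgdef
  have sumPA : ∀ (K : ℕ) (F : ℕ → (lev s).Y → ℝ) (y), PA (lev s) (fun y => ∑ N ∈ Finset.range K, F N y) y =
      ∑ N ∈ Finset.range K, PA (lev s) (F N) y := by
    intro K F y; unfold PA av; rw [Finset.sum_comm, Finset.sum_div]
  have sumPB : ∀ (K : ℕ) (F : ℕ → (lev s).Y → ℝ) (y), PB (lev s) (fun y => ∑ N ∈ Finset.range K, F N y) y =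
      ∑ N ∈ Finset.range K, PB (lev s) (F N) y := by
    intro K F y; unfold PB av; rw [Finset.sum_comm, Finset.sum_div]
  have hg : PA (lev s) g = g := by
    funext y; rw [hgdef, sumPA]; simp only [PA_hh]
  have hgn : ∀ y, 0 ≤ g y := fun y => Finset.sum_nonneg fun N _ => hh_nonneg _ N y
  have hinc : ∀ y, PA (lev s) (PB (lev s) g) y - g y = hh (lev s) K y - f0 (lev s) y := by
    intro y
    have e : PB (lev s) g = fun y => ∑ N ∈ Finset.range K, PB (lev s) (hh (lev s) N) y := by
      funext y; rw [hgdef, sumPB]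
    rw [e, sumPA, hgdef, ← Finset.sum_sub_distrib]
    exact Finset.sum_range_sub (fun N => hh (lev s) N y) K
  have h1 := EE_tele (fun l : List (Stp V) => vv (lev s) (k s) g (cu (uu lam l)) (yz k lam lev s 0 l)) _
    (vv_av k lam hk s g hg) n
  have h2 : 0 ≤ EE n (fun l : List (Stp V) => vv (lev s) (k s) g (cu (uu lam l)) (yz k lam lev s 0 l)) := by
    refine EE_nonneg fun l _ => ?_
    unfold vv
    have := al_nonneg (k s) (cu (uu lam l))
    have := al_le (k s) (cu (uu lam l))
    have h3 : 0 ≤ PB (lev s) g (yz k lam lev s 0 l) :=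
      div_nonneg (Finset.sum_nonneg fun b _ => hgn _) (by positivity)
    have h4 := hgn (yz k lam lev s 0 l)
    have h5 : 0 ≤ (k s : ℝ) - al (k s) (cu (uu lam l)) := by linarith
    positivity
  have h3 : vv (lev s) (k s) g (cu (uu lam ([] : List (Stp V)))) (yz k lam lev s 0 []) ≤ 4 * k s * B := by
    rw [yz_nil, uu_nil]
    unfold vv
    rw [show cu ([] : List (Atm V L)) = 0 from rfl, al_zero]
    simp only [sub_self, mul_zero, zero_mul, add_zero]
    exact mul_le_mul_of_nonneg_left hB (by positivity)
  have h4 : ∑ m ∈ Finset.range n, EE m (fun l : List (Stp V) => if cu (uu lam l) = 0 then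
      PA (lev s) (PB (lev s) g) (yz k lam lev s 0 l) - g (yz k lam lev s 0 l) else 0) ≤
      ∑ m ∈ Finset.range n, (b * EE m (fun l : List (Stp V) =>
        if cu (uu lam l) = 0 then (1:ℝ) else 0) - pp k lam lev s m) := by
    refine Finset.sum_le_sum fun m _ => ?_
    unfold pp
    rw [← EE_smul, ← EE_sub]
    refine EE_mono fun l _ => ?_
    by_cases hc : cu (uu lam l) = 0
    · simp only [hc, if_true, true_and, hinc, mul_one]
      have := hb (yz k lam lev s 0 l)
      unfold f0
      linarith
    · simp [hc]
  rw [Finset.sum_sub_distrib, ← Finset.mul_sum] at h4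
  have h5 := mul_le_mul_of_nonneg_left (E_c0 (V := V) lam n) hb0
  linarith

end
end SE

/-! ## Part P6b -/
namespace SE

section Dih
variable (M : ℕ)

def dAct : DihedralGroup M → ZMod M → ZMod M
  | .r i, x => x + i
  | .sr i, x => - x - i

instance dihAct : MulAction (DihedralGroup M) (ZMod M) where
  smul := dAct M
  one_smul x := by
    show dAct M (.r 0) x = x
    simp [dAct]
  mul_smul a b x := by
    show dAct M (a * b) x = dAct M a (dAct M b x)
    rcases a with i | i <;> rcases b with j | j <;> simp [dAct] <;> ring

theorem sr_smul (i x : ZMod M) : (DihedralGroup.sr i : DihedralGroup M) • x = - x - i := rfl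

noncomputable def uI (i : ZMod M) : ℤˣ →* DihedralGroup M where
  toFun u := if u = 1 then 1 else .sr i
  map_one' := by simp
  map_mul' a b := by
    rcases Int.units_eq_one_or a with rfl | rfl <;> rcases Int.units_eq_one_or b with rfl | rfl <;>
      simp [show (-1 : ℤˣ) ≠ 1 by decide]

theorem uI_one (i : ZMod M) : uI M i 1 = 1 := by simp
theorem uI_neg (i : ZMod M) : uI M i (-1) = .sr i := by
  show (if (-1 : ℤˣ) = 1 then (1 : DihedralGroup M) else .sr i) = _
  rw [if_neg (by decide)]

abbrev V3 := Fin 3 → ℤˣ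

noncomputable def clev [NeZero M] : Lev V3 where
  Y := Fin 3 → DihedralGroup M
  K := Fin 3 → ZMod M
  gY := inferInstance
  fY := inferInstance
  fK := inferInstance
  act := Pi.mulAction'
  o := 0
  A := (uI M 0).compLeft (Fin 3)
  B := (uI M 1).compLeft (Fin 3)
  hA v := by
    funext i
    show (uI M 0 (v i)) • (0 : ZMod M) = 0
    rcases Int.units_eq_one_or (v i) with h | h <;> rw [h]
    · simp
    · rw [uI_neg, sr_smul]; simp

theorem card_K [NeZero M] : Fintype.card (clev M).K = M ^ 3 := by
  show Fintype.card (Fin 3 → ZMod M) = _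
  simp [ZMod.card]

theorem card_Y [NeZero M] : Fintype.card (clev M).Y = 8 * M ^ 3 := by
  show Fintype.card (Fin 3 → DihedralGroup M) = _
  simp [DihedralGroup.card]; ring

theorem card_V3 : Fintype.card V3 = 8 := by simp

noncomputable def q1 : ℕ → ZMod M → ℝ
  | 0, w => if w = 0 then 1 else 0
  | N + 1, w => (2 * q1 N w + q1 N (w + 1) + q1 N (w - 1)) / 4

theorem q1_even (N : ℕ) (w : ZMod M) : q1 M N (-w) = q1 M N w := by
  induction N generalizing w with
  | zero => simp [q1]
  | succ N ih =>
    simp only [q1]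
    have h1 : q1 M N (-w + 1) = q1 M N (w - 1) := by rw [← ih (w - 1)]; congr 1; ring
    have h2 : q1 M N (-w - 1) = q1 M N (w + 1) := by rw [← ih (w + 1)]; congr 1; ring
    rw [ih, h1, h2]; ring

theorem av_V3 (F : Fin 3 → ℤˣ → ℝ) :
    av (fun v : V3 => ∏ i, F i (v i)) = ∏ i, (F i 1 + F i (-1)) / 2 := by
  unfold av
  rw [card_V3]
  have h := Finset.prod_univ_sum (fun _ : Fin 3 => (Finset.univ : Finset ℤˣ)) F
  rw [Fintype.piFinset_univ] at h
  rw [← h, Finset.prod_div_distrib]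
  have : ∀ i, ∑ j, F i j = F i 1 + F i (-1) := by
    intro i
    rw [show (Finset.univ : Finset ℤˣ) = {1, -1} by decide, Finset.sum_pair (by decide)]
  simp only [this]
  norm_num

theorem inv_act (y : DihedralGroup M) (i : ZMod M) (u : ℤˣ) :
    (y * uI M i u)⁻¹ • (0 : ZMod M) = uI M i u • (y⁻¹ • (0 : ZMod M)) := by
  have : (uI M i u)⁻¹ = uI M i u := by rw [← map_inv, Int.units_inv_eq_self]
  rw [mul_inv_rev, mul_smul, this]

theorem hh_clev [NeZero M] (N : ℕ) (y : Fin 3 → DihedralGroup M) :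
    hh (clev M) N y = ∏ i, q1 M N ((y i)⁻¹ • (0 : ZMod M)) := by
  induction N generalizing y with
  | zero =>
    simp only [q1]
    have : ∀ i, ((y i)⁻¹ • (0 : ZMod M) = 0) ↔ y i • (0 : ZMod M) = 0 := by
      intro i; rw [inv_smul_eq_iff, eq_comm]
    simp only [this]
    by_cases h : y • (0 : Fin 3 → ZMod M) = 0
    · rw [show hh (clev M) 0 y = 1 from if_pos h]
      have h' : ∀ i, y i • (0 : ZMod M) = 0 := fun i => congrFun h i
      simp [h']
    · rw [show hh (clev M) 0 y = 0 from if_neg h]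
      have : ∃ i, y i • (0 : ZMod M) ≠ 0 := by
        by_contra hc
        push Not at hc
        exact h (funext hc)
      obtain ⟨i, hi⟩ := this
      exact (Finset.prod_eq_zero (Finset.mem_univ i) (if_neg hi)).symm
  | succ N ih =>
    have hB : ∀ y : Fin 3 → DihedralGroup M, PB (clev M) (hh (clev M) N) y =
        ∏ i, (q1 M N ((y i)⁻¹ • (0 : ZMod M)) + q1 M N ((y i)⁻¹ • (0 : ZMod M) + 1)) / 2 := by
      intro y
      have h1 : PB (clev M) (hh (clev M) N) y = av (fun v : V3 => ∏ i,
          q1 M N (uI M 1 (v i) • ((y i)⁻¹ • (0 : ZMod M)))) := by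
        unfold PB
        congr 1; funext v
        refine (ih (y * (fun i => uI M 1 (v i)))).trans ?_
        simp only [Pi.mul_apply, inv_act]
      rw [h1, av_V3 (fun i u => q1 M N (uI M 1 u • ((y i)⁻¹ • (0 : ZMod M))))]
      refine Finset.prod_congr rfl fun i _ => ?_
      rw [uI_one, one_smul, uI_neg, sr_smul]
      congr 2
      rw [← q1_even]; congr 1; ring
    have h2 : hh (clev M) (N + 1) y = av (fun v : V3 => ∏ i,
        (q1 M N (uI M 0 (v i) • ((y i)⁻¹ • (0 : ZMod M))) +
          q1 M N (uI M 0 (v i) • ((y i)⁻¹ • (0 : ZMod M)) + 1)) / 2) := by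
      show PA (clev M) (PB (clev M) (hh (clev M) N)) y = _
      unfold PA
      congr 1; funext v
      refine (hB (y * (fun i => uI M 0 (v i)))).trans ?_
      simp only [Pi.mul_apply, inv_act]
    rw [h2, av_V3 (fun i u => (q1 M N (uI M 0 u • ((y i)⁻¹ • (0 : ZMod M))) +
          q1 M N (uI M 0 u • ((y i)⁻¹ • (0 : ZMod M)) + 1)) / 2)]
    refine Finset.prod_congr rfl fun i _ => ?_
    rw [uI_one, one_smul, uI_neg, sr_smul]
    simp only [q1, sub_zero, q1_even]
    have : q1 M N (-((y i)⁻¹ • (0 : ZMod M)) + 1) = q1 M N ((y i)⁻¹ • (0 : ZMod M) - 1) := by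
      rw [← q1_even]; congr 1; ring
    rw [this]; ring

/-- binomial sums in residue classes -/
def Qb (m : ℕ) (x : ZMod M) : ℕ := ∑ j ∈ Finset.range (m + 1), if (j : ZMod M) = x then m.choose j else 0

theorem Qb_succ (m : ℕ) (x : ZMod M) : Qb M (m + 1) x = Qb M m x + Qb M m (x - 1) := by
  unfold Qb
  rw [Finset.sum_range_succ']
  have h : ∀ j : ℕ, (if ((j + 1 : ℕ) : ZMod M) = x then (m + 1).choose (j + 1) else 0) =
      (if (j : ZMod M) = x - 1 then m.choose j else 0) +
        (if ((j + 1 : ℕ) : ZMod M) = x then m.choose (j + 1) else 0) := by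
    intro j
    have : ((j : ZMod M) = x - 1) ↔ ((j + 1 : ℕ) : ZMod M) = x := by
      push_cast; exact eq_sub_iff_add_eq
    simp only [this, Nat.choose_succ_succ]
    split_ifs <;> simp
  rw [Finset.sum_congr rfl (fun j _ => h j), Finset.sum_add_distrib]
  have h2 : (∑ j ∈ Finset.range (m + 1), if ((j + 1 : ℕ) : ZMod M) = x then m.choose (j + 1) else 0) +
      (if ((0 : ℕ) : ZMod M) = x then (m + 1).choose 0 else 0) =
      ∑ j ∈ Finset.range (m + 1), if (j : ZMod M) = x then m.choose j else 0 := by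
    have := Finset.sum_range_succ' (fun j => if (j : ZMod M) = x then m.choose j else 0) (m + 1)
    simp only [Nat.choose_zero_right] at this ⊢
    rw [← this, Finset.sum_range_succ]
    simp
  rw [add_assoc, h2, add_comm]

theorem q1_eq (N : ℕ) (w : ZMod M) : q1 M N w = Qb M (2 * N) (w + N) / 4 ^ N := by
  induction N generalizing w with
  | zero => simp [q1, Qb, eq_comm]
  | succ N ih =>
    simp only [q1, ih]
    rw [show 2 * (N + 1) = 2 * N + 1 + 1 by ring, Qb_succ, Qb_succ, Qb_succ]
    have e1 : w + ((N + 1 : ℕ) : ZMod M) = w + 1 + N := by push_cast; ring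
    have e2 : w + 1 + (N : ZMod M) - 1 = w + N := by ring
    have e3 : w + (N : ZMod M) - 1 = w - 1 + N := by ring
    rw [e1, e2, e3]
    push_cast
    rw [pow_succ]; field_simp; ring

theorem res_sum (hM : 0 < M) (f : ℕ → ℕ) (hf : Monotone f) (N : ℕ) (x : ZMod M) :
    M * ∑ j ∈ (Finset.range (N + 1)).filter (fun j : ℕ => (j : ZMod M) = x), f j ≤
      ∑ t ∈ Finset.range (N + M), f t := by
  set P := (Finset.range (N + 1)).filter (fun j : ℕ => (j : ZMod M) = x)
  have h1 : M * ∑ j ∈ P, f j ≤ ∑ p ∈ P ×ˢ Finset.range M, f (p.1 + p.2) := by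
    rw [Finset.sum_product, Finset.mul_sum]
    refine Finset.sum_le_sum fun j _ => ?_
    calc M * f j = ∑ i ∈ Finset.range M, f j := by simp
      _ ≤ _ := Finset.sum_le_sum fun i _ => hf (by simp)
  refine h1.trans ?_
  have hinj : Set.InjOn (fun p : ℕ × ℕ => p.1 + p.2) (P ×ˢ Finset.range M : Finset (ℕ × ℕ)) := by
    rintro ⟨j, i⟩ h ⟨j', i'⟩ h' he
    simp only [Finset.coe_product, Set.mem_prod, Finset.mem_coe, P, Finset.mem_filter, Finset.mem_range] at h h'
    have he : j + i = j' + i' := he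
    have h2 : ((j + i : ℕ) : ZMod M) = (j' + i' : ℕ) := by rw [he]
    push_cast at h2
    rw [h.1.2, h'.1.2, add_right_inj, ZMod.natCast_eq_natCast_iff', Nat.mod_eq_of_lt h.2,
      Nat.mod_eq_of_lt h'.2] at h2
    subst h2
    have : j = j' := by omega
    rw [this]
  rw [← Finset.sum_image (f := f) hinj]
  refine Finset.sum_le_sum_of_subset ?_
  intro t ht
  simp only [Finset.mem_image, Finset.mem_product, P, Finset.mem_filter, Finset.mem_range] at ht ⊢
  obtain ⟨p, hp, rfl⟩ := ht
  omega

theorem half_sum (hM : 0 < M) (N : ℕ) (x : ZMod M) :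
    M * ∑ j ∈ (Finset.range (N + 1)).filter (fun j : ℕ => (j : ZMod M) = x), (2 * N).choose j ≤
      4 ^ N + M * N.centralBinom := by
  have hmono : Monotone (fun t => (2 * N).choose (min t N)) := by
    refine monotone_nat_of_le_succ fun t => ?_
    by_cases h : t < N
    · rw [min_eq_left h.le, min_eq_left (show t + 1 ≤ N from h)]
      exact Nat.choose_le_succ_of_lt_half_left (by omega)
    · rw [min_eq_right (by omega), min_eq_right (by omega)]
  have h1 := res_sum M hM _ hmono N x
  have h2 : ∑ j ∈ (Finset.range (N + 1)).filter (fun j : ℕ => (j : ZMod M) = x), (2 * N).choose j =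
      ∑ j ∈ (Finset.range (N + 1)).filter (fun j : ℕ => (j : ZMod M) = x), (2 * N).choose (min j N) := by
    refine Finset.sum_congr rfl fun j hj => ?_
    rw [Finset.mem_filter, Finset.mem_range] at hj
    rw [min_eq_left (by omega)]
  rw [h2]
  refine h1.trans ?_
  rw [Finset.sum_range_add]
  refine add_le_add ?_ ?_
  · calc ∑ t ∈ Finset.range N, (2 * N).choose (min t N) = ∑ t ∈ Finset.range N, (2 * N).choose t := by
          refine Finset.sum_congr rfl fun j hj => ?_
          rw [Finset.mem_range] at hj
          rw [min_eq_left (by omega)]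
      _ ≤ ∑ t ∈ Finset.range (2 * N + 1), (2 * N).choose t :=
          Finset.sum_le_sum_of_subset (Finset.range_subset_range.2 (by omega))
      _ = 4 ^ N := by rw [Nat.sum_range_choose, pow_mul]; norm_num
  · refine le_of_eq ?_
    rw [Finset.sum_congr rfl (fun t _ => by rw [min_eq_right (by omega : N ≤ N + t)])]
    simp [Nat.centralBinom]

theorem Qb_le (hM : 0 < M) (N : ℕ) (x : ZMod M) :
    M * Qb M (2 * N) x ≤ 2 * (4 ^ N + M * N.centralBinom) := by
  have h1 := half_sum M hM N x
  have h2 := half_sum M hM N ((2 * N : ℕ) - x)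
  have h3 : Qb M (2 * N) x ≤ ∑ j ∈ (Finset.range (N + 1)).filter (fun j : ℕ => (j : ZMod M) = x), (2 * N).choose j +
      ∑ j ∈ (Finset.range (N + 1)).filter (fun j : ℕ => (j : ZMod M) = (2 * N : ℕ) - x), (2 * N).choose j := by
    unfold Qb
    rw [show 2 * N + 1 = N + 1 + N by ring, Finset.sum_range_add, Finset.sum_filter]
    refine add_le_add le_rfl ?_
    rw [Finset.sum_filter, ← Finset.sum_range_reflect, Finset.sum_range_succ]
    refine le_trans (Finset.sum_le_sum fun j hj => ?_) (Nat.le_add_right _ _)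
    rw [Finset.mem_range] at hj
    have e : N + 1 + (N - 1 - j) = 2 * N - j := by omega
    rw [e, Nat.choose_symm (by omega)]
    have : (((2 * N - j : ℕ) : ZMod M) = x) ↔ ((j : ZMod M) = (2 * N : ℕ) - x) := by
      rw [Nat.cast_sub (by omega)]
      constructor
      · intro h; rw [← h]; ring
      · intro h; rw [h]; ring
    simp only [this, le_refl]
  have := Nat.mul_le_mul_left M h3
  rw [mul_add] at this
  omega

theorem cB_le (N : ℕ) : N.centralBinom ^ 2 * (2 * N + 1) ≤ 16 ^ N := by
  induction N with
  | zero => simp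
  | succ N ih =>
    have h := Nat.succ_mul_centralBinom_succ N
    have h2 : (N + 1) ^ 2 * ((N + 1).centralBinom ^ 2 * (2 * (N + 1) + 1)) ≤ (N + 1) ^ 2 * 16 ^ (N + 1) := by
      calc (N + 1) ^ 2 * ((N + 1).centralBinom ^ 2 * (2 * (N + 1) + 1))
          = ((N + 1) * (N + 1).centralBinom) ^ 2 * (2 * N + 3) := by ring
        _ = (N.centralBinom ^ 2 * (2 * N + 1)) * (4 * ((2 * N + 1) * (2 * N + 3))) := by
            rw [h]; ring
        _ ≤ 16 ^ N * (16 * (N + 1) ^ 2) := Nat.mul_le_mul ih (by nlinarith)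
        _ = (N + 1) ^ 2 * 16 ^ (N + 1) := by ring
    exact Nat.le_of_mul_le_mul_left h2 (by positivity)

theorem q1_nonneg (N : ℕ) (w : ZMod M) : 0 ≤ q1 M N w := by rw [q1_eq]; positivity

theorem q1_le (hM : 0 < M) (N : ℕ) (w : ZMod M) : q1 M N w ≤ 2 / M + 2 / Real.sqrt (2 * N + 1) := by
  have hM' : (0:ℝ) < M := by exact_mod_cast hM
  have h1 : (M:ℝ) * Qb M (2 * N) (w + N) ≤ 2 * (4 ^ N + M * N.centralBinom) := by
    exact_mod_cast Qb_le M hM N (w + N)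
  have h2 : (N.centralBinom : ℝ) * Real.sqrt (2 * N + 1) ≤ 4 ^ N := by
    have h3 : ((N.centralBinom : ℝ) * Real.sqrt (2 * N + 1)) ^ 2 ≤ (4 ^ N) ^ 2 := by
      rw [mul_pow, Real.sq_sqrt (by positivity), ← pow_mul, mul_comm N 2, pow_mul]
      have := cB_le N
      have h4 : (N.centralBinom : ℝ) ^ 2 * (2 * N + 1) ≤ 16 ^ N := by exact_mod_cast this
      norm_num; exact h4
    exact le_of_sq_le_sq h3 (by positivity)
  have hs : 0 < Real.sqrt (2 * N + 1) := Real.sqrt_pos.2 (by positivity)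
  rw [q1_eq, div_le_iff₀ (by positivity)]
  have h3 : (N.centralBinom : ℝ) ≤ 4 ^ N / Real.sqrt (2 * N + 1) := by rwa [le_div_iff₀ hs]
  have h4 : (Qb M (2 * N) (w + N) : ℝ) ≤ 2 * (4 ^ N + M * N.centralBinom) / M := by
    rw [le_div_iff₀ hM']; linarith
  refine h4.trans ?_
  have h5 : 2 * (4 ^ N + M * (N.centralBinom : ℝ)) / M = 2 / M * 4 ^ N + 2 * N.centralBinom := by
    field_simp
  rw [h5, add_mul]
  have : 2 / Real.sqrt (2 * N + 1) * 4 ^ N = 2 * (4 ^ N / Real.sqrt (2 * N + 1)) := by ring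
  rw [this]; linarith

theorem hh_le_cube [NeZero M] (N : ℕ) (y : (clev M).Y) :
    hh (clev M) N y ≤ (2 / M + 2 / Real.sqrt (2 * N + 1)) ^ 3 := by
  have hM : 0 < M := Nat.pos_of_ne_zero (NeZero.ne M)
  have h := hh_clev M N y
  refine (le_of_eq h).trans ?_
  refine (Finset.prod_le_prod (fun i _ => q1_nonneg M N _) (fun i _ => q1_le M hM N _)).trans ?_
  simp

theorem hh_last [NeZero M] (y : (clev M).Y) : hh (clev M) (M ^ 2) y ≤ 64 / M ^ 3 := by
  have hM : 0 < M := Nat.pos_of_ne_zero (NeZero.ne M)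
  have hM' : (0:ℝ) < M := by exact_mod_cast hM
  refine (hh_le_cube M _ y).trans ?_
  have h1 : (M:ℝ) ≤ Real.sqrt (2 * ((M ^ 2 : ℕ) : ℝ) + 1) := by
    apply Real.le_sqrt_of_sq_le
    push_cast; nlinarith
  have h2 : 2 / Real.sqrt (2 * ((M ^ 2 : ℕ) : ℝ) + 1) ≤ 2 / M := by gcongr
  calc (2 / (M:ℝ) + 2 / Real.sqrt (2 * ((M ^ 2 : ℕ) : ℝ) + 1)) ^ 3 ≤ (2 / (M:ℝ) + 2 / (M:ℝ)) ^ 3 := by gcongr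
    _ = 64 / (M:ℝ) ^ 3 := by field_simp; norm_num

theorem tele_sum (K : ℕ) : ∑ N ∈ Finset.range (K + 1), 1 / (((N:ℝ) + 1) * Real.sqrt (N + 1)) ≤
    3 - 2 / Real.sqrt (K + 1) := by
  induction K with
  | zero => norm_num
  | succ K ih =>
    rw [Finset.sum_range_succ]
    have ha : 0 < Real.sqrt ((K:ℝ) + 1) := Real.sqrt_pos.2 (by positivity)
    have hb : 0 < Real.sqrt ((K:ℝ) + 1 + 1) := Real.sqrt_pos.2 (by positivity)
    have ha2 : Real.sqrt ((K:ℝ) + 1) ^ 2 = K + 1 := Real.sq_sqrt (by positivity)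
    have hb2 : Real.sqrt ((K:ℝ) + 1 + 1) ^ 2 = K + 1 + 1 := Real.sq_sqrt (by positivity)
    have hab : Real.sqrt ((K:ℝ) + 1) ≤ Real.sqrt ((K:ℝ) + 1 + 1) := Real.sqrt_le_sqrt (by linarith)
    push_cast
    rw [← hb2]
    set a := Real.sqrt ((K:ℝ) + 1)
    set b := Real.sqrt ((K:ℝ) + 1 + 1) with hbdef
    have e : Real.sqrt (b ^ 2) = b := Real.sqrt_sq hb.le
    rw [e]
    have h1 : (b - a) * (b + a) = 1 := by linear_combination hb2 - ha2
    have h2 : 1 ≤ 2 * (b - a) * b := by nlinarith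
    have h3 : a * b ≤ 2 * (b - a) * b ^ 3 := by nlinarith [mul_pos hb hb]
    have h4 : 1 / (b ^ 2 * b) ≤ 2 / a - 2 / b := by
      rw [div_sub_div _ _ ha.ne' hb.ne', div_le_div_iff₀ (by positivity) (by positivity)]
      nlinarith
    linarith

theorem hh_sum [NeZero M] : ∑ N ∈ Finset.range (M ^ 2), hh (clev M) N 1 ≤ 648 := by
  have hM : 0 < M := Nat.pos_of_ne_zero (NeZero.ne M)
  have hM' : (0:ℝ) < M := by exact_mod_cast hM
  have h : ∀ N ∈ Finset.range (M ^ 2), hh (clev M) N 1 ≤ 216 * (1 / (((N:ℝ) + 1) * Real.sqrt (N + 1))) := by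
    intro N hN
    rw [Finset.mem_range] at hN
    refine (hh_le_cube M N 1).trans ?_
    set r := Real.sqrt ((N:ℝ) + 1) with hr
    have hr0 : 0 < r := Real.sqrt_pos.2 (by positivity)
    have hr2 : r ^ 2 = N + 1 := Real.sq_sqrt (by positivity)
    have h1 : r ≤ Real.sqrt (2 * N + 1) := Real.sqrt_le_sqrt (by linarith [show (0:ℝ) ≤ N by positivity])
    have h2 : r ≤ M := by
      apply Real.sqrt_le_iff.2 ⟨hM'.le, ?_⟩
      exact_mod_cast hN
    have h3 : 2 / (M:ℝ) ≤ 2 / r := by gcongr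
    have h4 : 2 / Real.sqrt (2 * N + 1) ≤ 2 / r := by gcongr
    calc (2 / (M:ℝ) + 2 / Real.sqrt (2 * N + 1)) ^ 3 ≤ (2 / r + 2 / r) ^ 3 := by gcongr
      _ = 64 * (1 / (r ^ 2 * r)) := by field_simp; norm_num
      _ ≤ 216 * (1 / (r ^ 2 * r)) := by gcongr; norm_num
      _ = _ := by rw [hr2]
  refine (Finset.sum_le_sum h).trans ?_
  rw [← Finset.mul_sum]
  obtain ⟨K, hK⟩ : ∃ K, M ^ 2 = K + 1 := Nat.exists_eq_succ_of_ne_zero (by positivity)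
  rw [hK]
  have h1 := tele_sum K
  have h2 : 0 ≤ 2 / Real.sqrt ((K : ℝ) + 1) := by positivity
  linarith

end Dih
end SE

/-! ## Part P7 -/
namespace SE

section
variable {V L : Type} [CommGroup V] [CommGroup L]
variable {lev : ℕ → Lev V} (k : ℕ → ℕ) (lam : Bool → L) (s : ℕ)

def cb : List (Bs V) → ℤ
  | [] => 0
  | b :: l => cb l + dl b

noncomputable def edx (E : Lev V) (k : ℕ) (x c : ℤ) (d : V × V) : E.Y :=
  (if x = c then E.A d.1 else 1) * (if x - (k:ℤ) = c then E.B d.2 else 1)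

noncomputable def yb (lev : ℕ → Lev V) : List (Bs V) → ℤ → (lev s).Y
  | [] => fun _ => 1
  | b :: l => fun x => yb lev l x * edx (lev s) (k s) x (cb l) b.1 * edx (lev s) (k s) x (cb l + dl b) b.2.1

/-- the key -/
noncomputable def kb (lev : ℕ → Lev V) (l : List (Bs V)) : ℤ × (lev s).K :=
  (cb l, yb k s lev l (cb l) • (lev s).o)

/-- lamp -/
noncomputable def ph (lev : ℕ → Lev V) (l : List (Stp V)) (κ : ℤ × (lev s).K) : L :=
  ((XX (aval (lev := lev) k) (uu lam l)).κ s κ.1).φ κ.2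

theorem cu_cb (l : List (Stp V)) : cu (uu lam l) = cb (l.map Prod.fst) := by
  induction l with
  | nil => rfl
  | cons a l ih => rw [cu_uu, ih]; rfl

theorem yz_yb (l : List (Stp V)) (x : ℤ) : yz k lam lev s x l = yb k s lev (l.map Prod.fst) x := by
  induction l with
  | nil => rfl
  | cons a l ih =>
    simp only [List.map_cons, yb]
    rw [← ih, ← cu_cb lam]
    unfold yz
    rw [uu_cons, y_edit]
    have h1 : cu (mm lam a :: .inr (a.1.1.1, a.1.1.2, 1) :: uu lam l) = cu (uu lam l) + dl a.1 := by
      rw [cu_mm]; rfl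
    have h2 : ((XX (aval (lev := lev) k) (mm lam a :: .inr (a.1.1.1, a.1.1.2, 1) :: uu lam l)).κ s x).y =
        ((XX (aval (lev := lev) k) (.inr (a.1.1.1, a.1.1.2, 1) :: uu lam l)).κ s x).y := by
      unfold mm
      split_ifs
      · rw [y_edit]; simp
      · rw [XX_κ_move]
    rw [h1, h2, y_edit]
    rfl

theorem ph_nil (κ : ℤ × (lev s).K) : ph k lam s lev [] κ = 1 := rfl

theorem ph_cons (hk : ∀ s, 0 < k s) (a : Stp V) (l : List (Stp V)) (κ : ℤ × (lev s).K) :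
    ph k lam s lev (a :: l) κ = ph k lam s lev l κ *
      if a.1.2.2.1 = true ∧ κ = kb k s lev (l.map Prod.fst) then lam a.2 else 1 := by
  have hks := hk s
  have hkey : κ = kb k s lev (l.map Prod.fst) ↔ κ.1 = cu (uu lam l) ∧
      κ.2 = ((XX (aval (lev := lev) k) (uu lam l)).κ s κ.1).y • (lev s).o := by
    unfold kb
    rw [Prod.ext_iff, ← yz_yb k lam, ← cu_cb lam]
    constructor
    · rintro ⟨h1, h2⟩; exact ⟨h1, by rw [h1]; exact h2⟩
    · rintro ⟨h1, h2⟩; exact ⟨h1, by rw [h1] at h2; exact h2⟩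
  simp only [hkey]
  unfold ph
  rw [uu_cons, φ_edit]
  simp only [ite_self, mul_one]
  unfold mm
  by_cases ht : a.1.2.2.1 = true
  · rw [if_pos ht, φ_edit, φ_edit, y_edit]
    simp only [ite_self, mul_one, ht, true_and]
    congr 1
    rw [show cu (.inr (a.1.1.1, a.1.1.2, (1:L)) :: uu lam l) = cu (uu lam l) from rfl]
    by_cases hx : κ.1 = cu (uu lam l)
    · have h2 : ¬ (κ.1 - k s = cu (uu lam l)) := by omega
      simp only [hx, true_and, if_true, mul_smul]
      have h3 : ¬ (cu (uu lam l) - (k s : ℤ) = cu (uu lam l)) := by omega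
      simp only [h3, if_false]
      simp only [one_smul, (lev s).hA]
    · simp only [hx, false_and, if_false]
  · rw [if_neg ht, if_neg (fun h => ht h.1), XX_κ_move, φ_edit]
    simp

/-- visits -/
noncomputable def Tb (lev : ℕ → Lev V) : List (Bs V) → ℤ × (lev s).K → ℕ
  | [] => fun _ => 0
  | b :: l => fun κ => Tb lev l κ + if b.2.2.1 = true ∧ κ = kb k s lev l then 1 else 0

theorem uu_append (l₁ l₂ : List (Stp V)) : uu lam (l₁ ++ l₂) = uu lam l₁ ++ uu lam l₂ := by
  simp [uu]

theorem XX_append' {G α : Type*} [Group G] (at' : α → G) (l₁ l₂ : List α) :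
    XX at' (l₁ ++ l₂) = XX at' l₂ * XX at' l₁ := by
  induction l₁ with
  | nil => simp [XX]
  | cons a l ih => simp [XX, ih, mul_assoc]

theorem key_append (l₁ l₂ : List (Stp V)) :
    kb k s lev ((l₁ ++ l₂).map Prod.fst) = kb k s lev (l₂.map Prod.fst) ↔
      cu (uu lam l₁) = 0 ∧ yz k lam lev s 0 l₁ • (lev s).o = (lev s).o := by
  unfold kb
  rw [Prod.ext_iff, ← yz_yb k lam, ← yz_yb k lam, ← cu_cb lam, ← cu_cb lam]
  have hc : cu (uu lam (l₁ ++ l₂)) = cu (uu lam l₂) + cu (uu lam l₁) := by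
    rw [← XX_c (lev := lev) k, uu_append, XX_append', GG.mul_c, XX_c, XX_c]
  simp only [hc, add_eq_left]
  refine and_congr_right fun h0 => ?_
  rw [h0, add_zero]
  unfold yz
  rw [uu_append, XX_append', GG.mul_κ, XX_c, sub_self, Site.mul_y, mul_smul, smul_left_cancel_iff]

theorem Tb_le (l : List (Bs V)) (κ : ℤ × (lev s).K) :
    (Tb k s lev l κ : ℝ) ≤ ∑ j ∈ Finset.range l.length, if κ = kb k s lev (l.drop (j + 1)) then 1 else 0 := by
  induction l with
  | nil => simp [Tb]
  | cons b l ih =>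
    rw [Tb, List.length_cons, Finset.sum_range_succ']
    simp only [List.drop_succ_cons, List.drop_zero]
    push_cast
    refine add_le_add ih ?_
    by_cases h : κ = kb k s lev l
    · simp only [h, and_true, if_true]; split_ifs <;> norm_num
    · simp [h]

variable [Fintype V]

theorem E_Tkey (m : ℕ) :
    EE m (fun l : List (Stp V) => (Tb k s lev (l.map Prod.fst) (kb k s lev (l.map Prod.fst)) : ℝ)) ≤
      ∑ j ∈ Finset.range m, pp k lam lev s (j + 1) := by
  have h1 : ∀ l : List (Stp V), l.length = m →
      (Tb k s lev (l.map Prod.fst) (kb k s lev (l.map Prod.fst)) : ℝ) ≤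
      ∑ j ∈ Finset.range m, if kb k s lev (l.map Prod.fst) = kb k s lev ((l.drop (j + 1)).map Prod.fst) then 1 else 0 := by
    intro l hl
    have := Tb_le k s (lev := lev) (l.map Prod.fst) (kb k s lev (l.map Prod.fst))
    rw [List.length_map, hl] at this
    simpa only [List.map_drop] using this
  refine (EE_mono h1).trans ?_
  rw [EE_sum]
  refine Finset.sum_le_sum fun j hj => ?_
  rw [Finset.mem_range] at hj
  obtain ⟨i, rfl⟩ : ∃ i, m = (j + 1) + i := ⟨m - (j + 1), by omega⟩
  rw [EE_append]
  have h2 : ∀ l₂ : List (Stp V), EE (j + 1) (fun l₁ : List (Stp V) =>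
      if kb k s lev ((l₁ ++ l₂).map Prod.fst) = kb k s lev (((l₁ ++ l₂).drop (j + 1)).map Prod.fst) then (1:ℝ) else 0) =
      pp k lam lev s (j + 1) := by
    intro l₂
    refine EE_congr fun l₁ hl₁ => ?_
    rw [List.drop_append_of_le_length (by omega), ← hl₁, List.drop_length, List.nil_append]
    simp only [key_append k lam s]
  simp only [h2, EE_const, le_refl]

theorem pp_nonneg (m : ℕ) : 0 ≤ pp k lam lev s m :=
  EE_nonneg fun l _ => by split_ifs <;> norm_num

/-- window -/
noncomputable def win (lev : ℕ → Lev V) (n : ℕ) : Finset (ℤ × (lev s).K) := Finset.Icc (-(n:ℤ)) n ×ˢ Finset.univ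

theorem cb_le (l : List (Bs V)) : |cb l| ≤ l.length := by
  induction l with
  | nil => simp [cb]
  | cons b l ih =>
    have := dl_abs b
    simp only [cb, List.length_cons]
    push_cast
    exact (abs_add_le _ _).trans (add_le_add ih this)

theorem kb_win (l : List (Bs V)) (n : ℕ) (h : l.length ≤ n) : kb k s lev l ∈ win s lev n := by
  unfold win kb
  rw [Finset.mem_product]
  refine ⟨?_, Finset.mem_univ _⟩
  have := cb_le l
  rw [abs_le] at this
  rw [Finset.mem_Icc]
  constructor <;> simp only <;> omega

theorem sum_win_cons (w : ℕ → ℝ) (b : Bs V) (l : List (Bs V)) (n : ℕ) (h : l.length ≤ n) :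
    ∑ κ ∈ win s lev n, w (Tb k s lev (b :: l) κ) = ∑ κ ∈ win s lev n, w (Tb k s lev l κ) +
      if b.2.2.1 = true then w (Tb k s lev l (kb k s lev l) + 1) - w (Tb k s lev l (kb k s lev l)) else 0 := by
  simp only [Tb]
  by_cases hb : b.2.2.1 = true
  · simp only [hb, true_and, if_true]
    rw [← sub_eq_iff_eq_add', ← Finset.sum_sub_distrib, Finset.sum_eq_single_of_mem _ (kb_win k s l n h)]
    · simp
    · intro κ _ hκ; simp [hκ]
  · simp [hb]

/-- energy bound -/
theorem E_T2 (n : ℕ) :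
    EE n (fun l : List (Stp V) => ∑ κ ∈ win s lev n, (Tb k s lev (l.map Prod.fst) κ : ℝ) ^ 2) ≤
      n * (2 * (∑ j ∈ Finset.range n, pp k lam lev s j) + 1) := by
  have h : ∀ m ≤ n, EE m (fun l : List (Stp V) => ∑ κ ∈ win s lev n, (Tb k s lev (l.map Prod.fst) κ : ℝ) ^ 2) ≤
      m * (2 * (∑ j ∈ Finset.range n, pp k lam lev s j) + 1) := by
    intro m
    induction m with
    | zero => intro _; simp [EE_zero, Tb]
    | succ m ih =>
      intro hm
      have h1 := EE_step_le (n := m)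
        (F := fun l : List (Stp V) => ∑ κ ∈ win s lev n, (Tb k s lev (l.map Prod.fst) κ : ℝ) ^ 2)
        (c := fun l => 2 * (Tb k s lev (l.map Prod.fst) (kb k s lev (l.map Prod.fst)) : ℝ) + 1) (by
          intro l hl
          have h2 : ∀ a : Stp V, ∑ κ ∈ win s lev n, (Tb k s lev ((a :: l).map Prod.fst) κ : ℝ) ^ 2 ≤
              ∑ κ ∈ win s lev n, (Tb k s lev (l.map Prod.fst) κ : ℝ) ^ 2 +
                (2 * (Tb k s lev (l.map Prod.fst) (kb k s lev (l.map Prod.fst)) : ℝ) + 1) := by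
            intro a
            rw [List.map_cons]
            have h3 := sum_win_cons k s (lev := lev) (fun t => (t:ℝ) ^ 2) a.1 (l.map Prod.fst) n
              (by rw [List.length_map]; omega)
            rw [h3]
            refine add_le_add le_rfl ?_
            split_ifs
            · push_cast; linarith
            · positivity
          refine (av_mono (f := fun a : Stp V => ∑ κ ∈ win s lev n, (Tb k s lev ((a :: l).map Prod.fst) κ : ℝ) ^ 2)
            (g := fun _ => _) h2).trans ?_
          rw [av_const])
      refine h1.trans ?_
      rw [EE_add, EE_smul, EE_const]
      have h2 := E_Tkey (lev := lev) k lam s m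
      have h3 : ∑ j ∈ Finset.range m, pp k lam lev s (j + 1) ≤ ∑ j ∈ Finset.range n, pp k lam lev s j := by
        have h4 := Finset.sum_range_succ' (pp k lam lev s) m
        have h5 : ∑ j ∈ Finset.range (m + 1), pp k lam lev s j ≤ ∑ j ∈ Finset.range n, pp k lam lev s j :=
          Finset.sum_le_sum_of_subset_of_nonneg (Finset.range_subset_range.2 hm) (fun _ _ _ => pp_nonneg k lam s _)
        have := pp_nonneg (lev := lev) k lam s 0
        linarith
      have h4 := ih (by omega)
      push_cast
      linarith
  exact h n le_rfl

theorem E_T1 (n : ℕ) :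
    EE n (fun l : List (Stp V) => ∑ κ ∈ win s lev n, (Tb k s lev (l.map Prod.fst) κ : ℝ)) = n / 2 := by
  have h : ∀ m ≤ n, EE m (fun l : List (Stp V) => ∑ κ ∈ win s lev n, (Tb k s lev (l.map Prod.fst) κ : ℝ)) = m / 2 := by
    intro m
    induction m with
    | zero => intro _; simp [EE_zero, Tb]
    | succ m ih =>
      intro hm
      rw [EE_succ']
      have h1 : ∀ l : List (Stp V), l.length = m →
          av (fun a : Stp V => ∑ κ ∈ win s lev n, (Tb k s lev ((a :: l).map Prod.fst) κ : ℝ)) =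
          ∑ κ ∈ win s lev n, (Tb k s lev (l.map Prod.fst) κ : ℝ) + 1 / 2 := by
        intro l hl
        have h3 := fun a : Stp V => sum_win_cons k s (lev := lev) (fun t => (t:ℝ)) a.1 (l.map Prod.fst) n
              (by rw [List.length_map]; omega)
        simp only [List.map_cons]
        simp only [h3]
        set S := ∑ κ ∈ win s lev n, (Tb k s lev (l.map Prod.fst) κ : ℝ)
        set t := (Tb k s lev (l.map Prod.fst) (kb k s lev (l.map Prod.fst)))
        rw [av_stp (V := V) (fun b _ _ => S + if b = true then ((t + 1 : ℕ):ℝ) - (t:ℝ) else 0)]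
        simp only [av_const, av_bool]
        simp; ring
      rw [EE_congr h1, EE_add, EE_const, ih (by omega)]
      push_cast; ring
  exact h n le_rfl

end
end SE

/-! ## Part P7b -/
namespace SE

theorem ent_lower {G : Type*} [Group G] {α β : Type*} [Fintype α] [Fintype β] [Nonempty α] [Nonempty β]
    (at' : α × β → G) (n : ℕ) (p : List α → ℝ) (B : ℝ) (hpB : ∀ la, la.length = n → p la ≤ B)
    (h : ∀ la, la.length = n → ∀ g, EE n (fun lb : List β => if XX at' (la.zip lb) = g then (1:ℝ) else 0) ≤
      Real.exp (- p la)) :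
    EE n p ≤ entropy (convPow (mu at') n) := by
  set q := convPow (mu at') n with hq
  have hq0 : ∀ g, 0 ≤ q g := fun g => convPow_nonneg at' n g
  obtain ⟨s0, hs0⟩ := convPow_support_finite at' n
  set s := s0.filter (fun g => q g ≠ 0) with hs
  have hqs : ∀ g, g ∉ s → q g = 0 := by
    intro g hg
    by_contra hne
    exact hg (Finset.mem_filter.2 ⟨by by_contra hh; exact hne (hs0 g hh), hne⟩)
  have hH : entropy q = ∑ g ∈ s, Real.negMulLog (q g) :=
    tsum_eq_sum fun g hg => by rw [hqs g hg]; simp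
  have h1 : ∑ g ∈ s, q g = 1 := by
    have := tsum_convPow at' n (fun _ => 1)
    rw [EE_const] at this
    rw [← this.tsum_eq, tsum_eq_sum (s := s)]
    · simp [hq]
    · intro g hg; rw [← hq, hqs g hg]; simp
  set f : G → List α → ℝ := fun g la => EE n (fun lb : List β => if XX at' (la.zip lb) = g then (1:ℝ) else 0) with hf
  have hf0 : ∀ g la, 0 ≤ f g la := fun g la => EE_nonneg fun l _ => by split_ifs <;> norm_num
  have hfq : ∀ g, EE n (f g) = q g := by
    intro g
    rw [hq, convPow_mu, EE_prod]
  have h2 : ∀ g ∈ s, EE n (fun la => f g la * p la) ≤ Real.negMulLog (q g) := by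
    intro g hg
    have hpos : 0 < q g := lt_of_le_of_ne (hq0 g) (Ne.symm (Finset.mem_filter.1 hg).2)
    have h3 : ∀ la : List α, la.length = n → f g la * p la ≤ f g la * (- Real.log (q g) - 1) + q g := by
      intro la hla
      have h4 := gibbs_pt (hf0 g la) hpos
      have h5 : f g la * p la ≤ Real.negMulLog (f g la) := by
        rcases (hf0 g la).eq_or_lt with h6 | h6
        · rw [← h6]; simp
        · unfold Real.negMulLog
          have h7 := (Real.log_le_log_iff h6 (Real.exp_pos _)).2 (h la hla g)
          rw [Real.log_exp] at h7
          nlinarith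
      linarith
    refine (EE_mono h3).trans ?_
    rw [EE_add, EE_mul_const, EE_const, hfq]
    unfold Real.negMulLog
    linarith
  have hs1 : ∀ la : List α, ∑ g ∈ s, f g la ≤ 1 := by
    intro la
    rw [hf, ← EE_sum]
    refine EE_le_const fun l _ => ?_
    rw [Finset.sum_ite_eq]
    split_ifs <;> norm_num
  have h3 : EE n p ≤ EE n (fun la => (∑ g ∈ s, f g la * p la) + B * (1 - ∑ g ∈ s, f g la)) := by
    refine EE_mono fun la hla => ?_
    rw [← Finset.sum_mul]
    nlinarith [hs1 la, hpB la hla]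
  refine h3.trans ?_
  rw [EE_add, EE_smul, EE_sub, EE_const, EE_sum, EE_sum, hH]
  simp only [hfq, h1, sub_self, mul_zero, add_zero]
  exact Finset.sum_le_sum h2

section
variable {V L : Type} [CommGroup V] [CommGroup L]
variable {lev : ℕ → Lev V} (k : ℕ → ℕ) (lam : Bool → L) (s : ℕ)

theorem zip_fst {α β : Type*} {la : List α} {lb : List β} (h : lb.length = la.length) :
    (la.zip lb).map Prod.fst = la := List.map_fst_zip h.ge

theorem ph_unvis (hk : ∀ s, 0 < k s) (l : List (Stp V)) (κ : ℤ × (lev s).K)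
    (h : Tb k s lev (l.map Prod.fst) κ = 0) : ph k lam s lev l κ = 1 := by
  induction l with
  | nil => rfl
  | cons a l ih =>
    simp only [List.map_cons, Tb, Nat.add_eq_zero_iff] at h
    rw [ph_cons k lam s hk, ih h.1, one_mul]
    have h2 := h.2
    split_ifs with h3
    · simp [h3] at h2
    · rfl

/-- number of visited keys -/
noncomputable def Vb (lev : ℕ → Lev V) (n : ℕ) (l : List (Bs V)) : ℝ :=
  ∑ κ ∈ win s lev n, if 0 < Tb k s lev l κ then (1:ℝ) else 0

variable [Fintype V]

theorem Vb_cons (b : Bs V) (l : List (Bs V)) (n : ℕ) (h : l.length ≤ n) :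
    Vb k s lev n (b :: l) = Vb k s lev n l +
      if b.2.2.1 = true ∧ Tb k s lev l (kb k s lev l) = 0 then 1 else 0 := by
  unfold Vb
  rw [sum_win_cons k s (fun t => if 0 < t then (1:ℝ) else 0) b l n h]
  congr 1
  by_cases hb : b.2.2.1 = true
  · simp only [hb, true_and, if_true]
    by_cases h0 : Tb k s lev l (kb k s lev l) = 0
    · simp [h0]
    · simp [h0, Nat.pos_of_ne_zero h0]
  · simp [hb]

theorem Vb_le (l : List (Bs V)) (n : ℕ) (h : l.length ≤ n) : Vb k s lev n l ≤ l.length := by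
  induction l with
  | nil => simp [Vb, Tb]
  | cons b l ih =>
    rw [List.length_cons] at h
    rw [Vb_cons k s b l n (by omega), List.length_cons]
    push_cast
    have := ih (by omega)
    split_ifs <;> linarith

theorem ph_prob (hk : ∀ s, 0 < k s) (hlam : lam false ≠ lam true) (n : ℕ) (la : List (Bs V)) (hla : la.length ≤ n) :
    ∀ ψ : ℤ × (lev s).K → L,
    EE la.length (fun lb : List Bool => if (∀ κ, ph k lam s lev (la.zip lb) κ = ψ κ) then (1:ℝ) else 0) ≤
      Real.exp (- (Real.log 2 * Vb k s lev n la)) := by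
  induction la with
  | nil =>
    intro ψ
    have : Vb k s lev n [] = 0 := by simp [Vb, Tb]
    rw [this]
    simp only [mul_zero, neg_zero, Real.exp_zero]
    exact EE_le_const fun l _ => by split_ifs <;> norm_num
  | cons b la ih =>
    intro ψ
    rw [List.length_cons] at hla
    have hla' : la.length ≤ n := by omega
    set ψ' : Bool → ℤ × (lev s).K → L := fun e κ =>
      ψ κ * (if b.2.2.1 = true ∧ κ = kb k s lev la then lam e else 1)⁻¹ with hψ'
    have key : ∀ (lb : List Bool) (e : Bool), lb.length = la.length →
        ((∀ κ, ph k lam s lev ((b :: la).zip (e :: lb)) κ = ψ κ) ↔ ∀ κ, ph k lam s lev (la.zip lb) κ = ψ' e κ) := by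
      intro lb e hlb
      refine forall_congr' fun κ => ?_
      rw [List.zip_cons_cons, ph_cons k lam s hk, zip_fst hlb, hψ']
      simp only
      rw [← eq_mul_inv_iff_mul_eq]
    rw [List.length_cons, EE_succ_av]
    have h1 : ∀ e : Bool, EE la.length (fun lb : List Bool => if (∀ κ, ph k lam s lev ((b :: la).zip (e :: lb)) κ = ψ κ) then (1:ℝ) else 0) =
        EE la.length (fun lb : List Bool => if (∀ κ, ph k lam s lev (la.zip lb) κ = ψ' e κ) then (1:ℝ) else 0) := by
      intro e
      exact EE_congr fun lb hlb => by simp only [key lb e hlb]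
    simp only [h1]
    rw [Vb_cons k s b la n hla']
    by_cases hnew : b.2.2.1 = true ∧ Tb k s lev la (kb k s lev la) = 0
    · rw [if_pos hnew]
      have h2 : ∀ e : Bool, ψ (kb k s lev la) ≠ lam e →
          EE la.length (fun lb : List Bool => if (∀ κ, ph k lam s lev (la.zip lb) κ = ψ' e κ) then (1:ℝ) else 0) = 0 := by
        intro e he
        refine (EE_congr (G := fun _ => 0) fun lb hlb => ?_).trans (EE_const _ 0)
        rw [if_neg]
        intro hall
        apply he
        have h3 := hall (kb k s lev la)
        rw [ph_unvis k lam s hk _ _ (by rw [zip_fst hlb]; exact hnew.2)] at h3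
        simp only [hψ', hnew.1, true_and, if_true] at h3
        rw [eq_mul_inv_iff_mul_eq, one_mul] at h3
        exact h3.symm
      have h4 : Real.exp (- (Real.log 2 * (Vb k s lev n la + 1))) = Real.exp (- (Real.log 2 * Vb k s lev n la)) / 2 := by
        rw [mul_add, neg_add, Real.exp_add, mul_one, Real.exp_neg (Real.log 2), Real.exp_log (by norm_num)]
        ring
      rw [h4, av_bool]
      have hp := Real.exp_pos (- (Real.log 2 * Vb k s lev n la))
      by_cases hf : ψ (kb k s lev la) = lam false
      · have := h2 true (by rw [hf]; exact hlam)
        have h5 := ih hla' (ψ' false)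
        simp only [this]
        linarith
      · have := h2 false hf
        have h5 := ih hla' (ψ' true)
        simp only [this]
        linarith
    · rw [if_neg hnew, add_zero]
      refine (av_mono (g := fun _ => Real.exp (- (Real.log 2 * Vb k s lev n la))) fun e => ih hla' (ψ' e)).trans ?_
      rw [av_const]

theorem E_base (n : ℕ) (F : List (Bs V) → ℝ) :
    EE n (fun l : List (Stp V) => F (l.map Prod.fst)) = EE n F := by
  rw [EE_prod]
  refine EE_congr fun la hla => ?_
  refine (EE_congr (G := fun _ => F la) fun lb hlb => ?_).trans (EE_const _ _)
  rw [zip_fst (by omega)]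

theorem E_V (n : ℕ) (G : ℝ) (hG : ∑ j ∈ Finset.range n, pp k lam lev s j ≤ G) :
    (n:ℝ) / 4 ≤ (2 * G + 1) * EE n (Vb k s lev n) := by
  have hG0 : 0 ≤ G := (Finset.sum_nonneg fun j _ => pp_nonneg k lam s j).trans hG
  have h1 := E_T1 (lev := lev) k s n
  have h2 := E_T2 (lev := lev) k lam s n
  rw [E_base n (fun l => ∑ κ ∈ win s lev n, (Tb k s lev l κ : ℝ))] at h1
  rw [E_base n (fun l => ∑ κ ∈ win s lev n, (Tb k s lev l κ : ℝ) ^ 2)] at h2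
  set D : ℝ := 2 * G + 1 with hD
  have hDpos : 0 < D := by linarith
  have h3 : EE n (fun l => ∑ κ ∈ win s lev n, (Tb k s lev l κ : ℝ)) ≤
      EE n (fun l => (1 / (4 * D)) * (∑ κ ∈ win s lev n, (Tb k s lev l κ : ℝ) ^ 2) + D * Vb k s lev n l) := by
    refine EE_mono fun l _ => ?_
    unfold Vb
    rw [Finset.mul_sum, Finset.mul_sum, ← Finset.sum_add_distrib]
    refine Finset.sum_le_sum fun κ _ => ?_
    rcases Nat.eq_zero_or_pos (Tb k s lev l κ) with h0 | h0
    · simp [h0]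
    · rw [if_pos h0, mul_one]
      set t : ℝ := (Tb k s lev l κ : ℝ)
      have : 1 / (4 * D) * t ^ 2 + D - t = (t - 2 * D) ^ 2 / (4 * D) := by field_simp; ring
      have : 0 ≤ (t - 2 * D) ^ 2 / (4 * D) := by positivity
      linarith
  rw [EE_add, EE_smul, EE_smul, h1] at h3
  have h4 : EE n (fun l => ∑ κ ∈ win s lev n, (Tb k s lev l κ : ℝ) ^ 2) ≤ n * D := by
    refine h2.trans ?_
    have : (0:ℝ) ≤ n := by positivity
    gcongr
    linarith
  have h5 : (1 / (4 * D)) * EE n (fun l => ∑ κ ∈ win s lev n, (Tb k s lev l κ : ℝ) ^ 2) ≤ n / 4 := by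
    refine (mul_le_mul_of_nonneg_left h4 (by positivity)).trans (le_of_eq ?_)
    field_simp
  linarith

/-- entropy lower bound -/
theorem ent_low {Γ : Type*} [Group Γ] (at' : Stp V → Γ) (hk : ∀ s, 0 < k s) (hlam : lam false ≠ lam true)
    (pr : Γ → GG lev L) (hpr : ∀ l, pr (XX at' l) = XX (aval (lev := lev) k) (uu lam l))
    (n : ℕ) (G : ℝ) (hG : ∑ j ∈ Finset.range n, pp k lam lev s j ≤ G) :
    (n:ℝ) / 4 * Real.log 2 ≤ (2 * G + 1) * entropy (convPow (mu at') n) := by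
  have hG0 : 0 ≤ G := (Finset.sum_nonneg fun j _ => pp_nonneg k lam s j).trans hG
  have hl2 : 0 < Real.log 2 := Real.log_pos (by norm_num)
  have h1 := E_V k lam s n G hG
  have h2 := ent_lower at' n (fun la => Real.log 2 * Vb k s lev n la) (Real.log 2 * n) (by
    intro la hla
    have := Vb_le k s (lev := lev) la n hla.le
    rw [hla] at this
    gcongr) (by
    intro la hla g
    have h3 := ph_prob k lam s hk hlam n la hla.le (fun κ => ((pr g).κ s κ.1).φ κ.2)
    rw [hla] at h3
    refine le_trans (EE_mono fun lb _ => ?_) h3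
    by_cases h4 : XX at' (la.zip lb) = g
    · rw [if_pos h4, if_pos]
      intro κ
      rw [← h4, hpr]; rfl
    · rw [if_neg h4]; split_ifs <;> norm_num)
  rw [EE_smul] at h2
  have h3 := mul_le_mul_of_nonneg_left h2 (show 0 ≤ 2 * G + 1 by linarith)
  have h4 := mul_le_mul_of_nonneg_right h1 hl2.le
  linarith

end

section
variable {V : Type} [CommGroup V]
variable {lev : ℕ → Lev V} (k : ℕ → ℕ) (s : ℕ)

/-- integer lamp value -/
noncomputable def pz (lev : ℕ → Lev V) (l : List (Stp V)) (κ : ℤ × (lev s).K) : ℝ :=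
  ((Multiplicative.toAdd (ph k lamB s lev l κ) : ℤ) : ℝ)

theorem pz_cons (hk : ∀ s, 0 < k s) (b : Bs V) (e : Bool) (la : List (Bs V)) (lb : List Bool)
    (h : lb.length = la.length) (κ : ℤ × (lev s).K) :
    pz k s lev ((b :: la).zip (e :: lb)) κ = pz k s lev (la.zip lb) κ +
      (if b.2.2.1 = true ∧ κ = kb k s lev la then (1:ℝ) else 0) * (if e then 1 else -1) := by
  unfold pz
  rw [List.zip_cons_cons, ph_cons k lamB s hk, zip_fst h, toAdd_mul]
  push_cast
  congr 1
  split_ifs with h1 h2 <;> simp_all [lamB]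

theorem pz2 (hk : ∀ s, 0 < k s) (la : List (Bs V)) (κ : ℤ × (lev s).K) :
    EE la.length (fun lb : List Bool => pz k s lev (la.zip lb) κ ^ 2) = Tb k s lev la κ := by
  induction la with
  | nil => simp [EE_zero, pz, Tb, ph_nil]
  | cons b la ih =>
    rw [List.length_cons, EE_succ']
    have h1 : ∀ lb : List Bool, lb.length = la.length →
        av (fun e => pz k s lev ((b :: la).zip (e :: lb)) κ ^ 2) = pz k s lev (la.zip lb) κ ^ 2 +
          (if b.2.2.1 = true ∧ κ = kb k s lev la then (1:ℝ) else 0) := by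
      intro lb hlb
      rw [av_bool]
      simp only [pz_cons k s hk b _ la lb hlb κ]
      split_ifs <;> simp_all <;> ring
    rw [EE_congr h1, EE_add, EE_const, ih, Tb]
    push_cast
    rfl

theorem pz4 (hk : ∀ s, 0 < k s) (la : List (Bs V)) (κ : ℤ × (lev s).K) :
    EE la.length (fun lb : List Bool => pz k s lev (la.zip lb) κ ^ 4) ≤ 3 * (Tb k s lev la κ : ℝ) ^ 2 := by
  induction la with
  | nil => simp [EE_zero, pz, Tb, ph_nil]
  | cons b la ih =>
    rw [List.length_cons, EE_succ']
    have h1 : ∀ lb : List Bool, lb.length = la.length →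
        av (fun e => pz k s lev ((b :: la).zip (e :: lb)) κ ^ 4) = pz k s lev (la.zip lb) κ ^ 4 +
          (if b.2.2.1 = true ∧ κ = kb k s lev la then (1:ℝ) else 0) * (6 * pz k s lev (la.zip lb) κ ^ 2 + 1) := by
      intro lb hlb
      rw [av_bool]
      simp only [pz_cons k s hk b _ la lb hlb κ]
      split_ifs <;> simp_all <;> ring
    rw [EE_congr h1, EE_add, EE_smul, EE_add, EE_smul, EE_const, pz2 k s hk, Tb]
    push_cast
    split_ifs with h
    · nlinarith
    · simpa using ih

variable [Fintype V]

theorem E_pz (hk : ∀ s, 0 < k s) (n : ℕ) (G r : ℝ) (hG : ∑ j ∈ Finset.range n, pp k lamB lev s j ≤ G) (hr0 : 0 < r)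
    (hr : 12 * (2 * G + 1) ≤ r ^ 2) :
    (n:ℝ) / 4 ≤ r * EE n (fun l : List (Stp V) => ∑ κ ∈ win s lev n, |pz k s lev l κ|) := by
  have h1 := E_T1 (lev := lev) k s n
  have h2 := E_T2 (lev := lev) k lamB s n
  rw [E_base n (fun l => ∑ κ ∈ win s lev n, (Tb k s lev l κ : ℝ))] at h1
  rw [E_base n (fun l => ∑ κ ∈ win s lev n, (Tb k s lev l κ : ℝ) ^ 2)] at h2
  have h3 : EE n (fun l : List (Stp V) => ∑ κ ∈ win s lev n, pz k s lev l κ ^ 2) = n / 2 := by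
    rw [← h1, EE_prod]
    refine EE_congr fun la hla => ?_
    rw [EE_sum]
    refine Finset.sum_congr rfl fun κ _ => ?_
    have := pz2 k s hk la κ
    rwa [hla] at this
  have h4 : EE n (fun l : List (Stp V) => ∑ κ ∈ win s lev n, pz k s lev l κ ^ 4) ≤ 3 * (n * (2 * G + 1)) := by
    have h5 : EE n (fun l : List (Stp V) => ∑ κ ∈ win s lev n, pz k s lev l κ ^ 4) ≤
        EE n (fun l => 3 * ∑ κ ∈ win s lev n, (Tb k s lev l κ : ℝ) ^ 2) := by
      rw [EE_prod]
      refine EE_mono fun la hla => ?_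
      rw [EE_sum, Finset.mul_sum]
      refine Finset.sum_le_sum fun κ _ => ?_
      have := pz4 k s hk la κ
      rwa [hla] at this
    rw [EE_smul] at h5
    have : (n:ℝ) * (2 * ∑ j ∈ Finset.range n, pp k lamB lev s j + 1) ≤ n * (2 * G + 1) := by
      gcongr
    linarith
  have h5 : EE n (fun l : List (Stp V) => ∑ κ ∈ win s lev n, pz k s lev l κ ^ 2) ≤
      EE n (fun l : List (Stp V) => r * (∑ κ ∈ win s lev n, |pz k s lev l κ|) +
        (1 / r ^ 2) * ∑ κ ∈ win s lev n, pz k s lev l κ ^ 4) := by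
    refine EE_mono fun l _ => ?_
    rw [Finset.mul_sum, Finset.mul_sum, ← Finset.sum_add_distrib]
    refine Finset.sum_le_sum fun κ _ => ?_
    set z := pz k s lev l κ
    have hz : z ^ 2 = |z| ^ 2 := (sq_abs z).symm
    have hz4 : z ^ 4 = |z| ^ 4 := by rw [show z ^ 4 = (z ^ 2) ^ 2 by ring, hz]; ring
    rw [hz, hz4]
    have ha := abs_nonneg z
    rcases le_total |z| r with h | h
    · have : 0 ≤ 1 / r ^ 2 * |z| ^ 4 := by positivity
      nlinarith
    · have h6 : |z| ^ 2 ≤ 1 / r ^ 2 * |z| ^ 4 := by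
        rw [one_div, ← div_eq_inv_mul, le_div_iff₀ (by positivity)]
        have : r ^ 2 ≤ |z| ^ 2 := by gcongr
        nlinarith [sq_nonneg |z|]
      have : 0 ≤ r * |z| := by positivity
      linarith
  rw [EE_add, EE_smul, EE_smul, h3] at h5
  have h6 : (1 / r ^ 2) * EE n (fun l : List (Stp V) => ∑ κ ∈ win s lev n, pz k s lev l κ ^ 4) ≤ n / 4 := by
    refine (mul_le_mul_of_nonneg_left h4 (by positivity)).trans ?_
    rw [one_div, ← div_eq_inv_mul, div_le_iff₀ (by positivity)]
    have : (0:ℝ) ≤ n := by positivity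
    nlinarith
  linarith

end
end SE

/-! ## Part P8 -/
namespace SE

section
variable {G : Type*} [Group G] {α : Type*} (at' : α → G)

theorem XX_eq_rev (l : List α) : XX at' l = (l.reverse.map at').prod := by
  induction l with
  | nil => rfl
  | cons a l ih => simp [XX, ih]

theorem wl_le (w : List α) (g : G) (h : (w.map at').prod = g) : wordLength (Set.range at') g ≤ w.length := by
  unfold wordLength
  refine Nat.sInf_le ⟨w.map at', by simp, ?_, h⟩
  intro x hx
  obtain ⟨a, _, rfl⟩ := List.mem_map.1 hx
  exact ⟨a, rfl⟩

theorem wl_spec (l : List α) : ∃ l' : List α, XX at' l' = XX at' l ∧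
    l'.length = wordLength (Set.range at') (XX at' l) := by
  have hne : {n | ∃ w : List G, w.length = n ∧ (∀ x ∈ w, x ∈ Set.range at') ∧ w.prod = XX at' l}.Nonempty := by
    refine ⟨_, l.reverse.map at', rfl, ?_, (XX_eq_rev at' l).symm⟩
    intro x hx
    obtain ⟨a, _, rfl⟩ := List.mem_map.1 hx
    exact ⟨a, rfl⟩
  obtain ⟨w, hw1, hw2, hw3⟩ := Nat.sInf_mem hne
  have h3 : ∀ w : List G, (∀ x ∈ w, x ∈ Set.range at') → ∃ v : List α, v.map at' = w := by
    intro w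
    induction w with
    | nil => intro _; exact ⟨[], rfl⟩
    | cons x w ih =>
      intro h
      obtain ⟨a, ha⟩ := h x (by simp)
      obtain ⟨v, hv⟩ := ih fun y hy => h y (by simp [hy])
      exact ⟨a :: v, by simp [ha, hv]⟩
  obtain ⟨v, hv⟩ := h3 w hw2
  refine ⟨v.reverse, ?_, ?_⟩
  · rw [XX_eq_rev, List.reverse_reverse, hv, hw3]
  · unfold wordLength
    rw [← hw1, List.length_reverse, ← hv, List.length_map]

end

section
variable {V L : Type} [CommGroup V] [CommGroup L] {lev : ℕ → Lev V} (k : ℕ → ℕ) (lam : Bool → L)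

noncomputable def stepv (a : Stp V) : GG lev L :=
  Ed k (a.1.1.1, a.1.1.2, 1) * aval k (mm lam a) * Ed k (a.1.2.1.1, a.1.2.1.2, 1)

theorem XX_stepv (l : List (Stp V)) : XX (stepv (lev := lev) k lam) l = XX (aval k) (uu lam l) := by
  induction l with
  | nil => rfl
  | cons a l ih =>
    rw [uu_cons]
    simp only [XX, ih, stepv, aval, mul_assoc]

def sinv (σ : Bool → Bool) (a : Stp V) : Stp V :=
  (((a.1.2.1.1⁻¹, a.1.2.1.2⁻¹), (a.1.1.1⁻¹, a.1.1.2⁻¹), a.1.2.2.1, !a.1.2.2.2), σ a.2)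

theorem sinv_sinv (σ : Bool → Bool) (hσ : ∀ e, σ (σ e) = e) (a : Stp V) : sinv σ (sinv σ a) = a := by
  simp [sinv, hσ]

theorem stepv_inv (hk : ∀ s, 0 < k s) (σ : Bool → Bool) (hσ : ∀ e, lam (σ e) = (lam e)⁻¹) (a : Stp V) :
    stepv (lev := lev) k lam (sinv σ a) = (stepv k lam a)⁻¹ := by
  have h1 : ∀ x y : V, (Ed k (x⁻¹, y⁻¹, (1:L)) : GG lev L) = (Ed k (x, y, 1))⁻¹ := by
    intro x y
    rw [← Ed_inv k hk]
    congr 1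
    simp
  have h2 : (aval k (mm lam (sinv σ a)) : GG lev L) = (aval k (mm lam a))⁻¹ := by
    unfold mm sinv
    simp only
    split_ifs with h
    · simp only [aval]
      rw [← Ed_inv k hk]
      congr 1
      simp [hσ]
    · simp only [aval]
      cases a.1.2.2.2
      · simp [← Tz_neg]
      · simp [← Tz_neg]
  unfold stepv
  rw [h2]
  simp only [sinv, h1, mul_inv_rev, mul_assoc]

variable (lev) in
/-- the group -/
abbrev Gam : Type := ↥(Subgroup.closure (Set.range (stepv (lev := lev) k lam)))

noncomputable def atG (a : Stp V) : Gam lev k lam := ⟨stepv k lam a, Subgroup.subset_closure ⟨a, rfl⟩⟩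

theorem XX_atG (l : List (Stp V)) : ((XX (atG (lev := lev) k lam) l : Gam lev k lam) : GG lev L) =
    XX (aval k) (uu lam l) := by
  rw [← XX_stepv]
  induction l with
  | nil => rfl
  | cons a l ih => simp only [XX, Subgroup.coe_mul, ih]; rfl

theorem atG_gen : Subgroup.closure (Set.range (atG (lev := lev) k lam)) = ⊤ := by
  have h := Subgroup.closure_closure_coe_preimage (k := Set.range (stepv (lev := lev) k lam))
  convert h using 2
  ext x
  constructor
  · rintro ⟨a, rfl⟩; exact ⟨a, rfl⟩
  · rintro ⟨a, ha⟩; exact ⟨a, Subtype.ext ha⟩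

theorem atG_inv (hk : ∀ s, 0 < k s) (σ : Bool → Bool) (hσ : ∀ e, lam (σ e) = (lam e)⁻¹) (a : Stp V) :
    atG (lev := lev) k lam (sinv σ a) = (atG k lam a)⁻¹ := Subtype.ext (stepv_inv k lam hk σ hσ a)

theorem genset [Fintype V] (hk : ∀ s, 0 < k s) (σ : Bool → Bool) (hσ : ∀ e, lam (σ e) = (lam e)⁻¹) :
    IsGenSet (Set.range (atG (lev := lev) k lam)) where
  finite := Set.finite_range _
  symm := by
    rintro _ ⟨a, rfl⟩
    exact ⟨_, atG_inv k lam hk σ hσ a⟩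
  gen := atG_gen k lam

theorem stepd [Fintype V] (hk : ∀ s, 0 < k s) (σ : Bool → Bool) (hσ : ∀ e, lam (σ e) = (lam e)⁻¹)
    (hσ2 : ∀ e, σ (σ e) = e) : IsStepDist (mu (atG (lev := lev) k lam)) :=
  mu_isStepDist _ (sinv σ) (sinv_sinv σ hσ2) (atG_inv k lam hk σ hσ) (atG_gen k lam)

variable {nm : L → ℕ}

theorem Ed_word (hk : ∀ s, 0 < k s) (hL : ∀ z : L, ∃ bs : List Bool, bs ≠ [] ∧ bs.length ≤ nm z + 2 ∧ (bs.map lam).prod = z)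
    (d : DD V L) : ∃ l : List (Stp V), l.length ≤ nm d.2.2 + 2 ∧ (l.map (stepv (lev := lev) k lam)).prod = Ed k d := by
  obtain ⟨bs, h1, h2, h3⟩ := hL d.2.2
  have hs : ∀ (a b : V) (e : Bool), stepv (lev := lev) k lam (((a, b), (1, 1), true, true), e) = Ed k (a, b, lam e) := by
    intro a b e
    unfold stepv mm
    simp only [if_true, aval]
    rw [← Ed_mul k hk, ← Ed_mul k hk]
    congr 1
    simp
  have ht : ∀ t : List Bool, ((t.map (fun e => ((((1, 1), (1, 1), true, true), e) : Stp V))).map (stepv (lev := lev) k lam)).prod =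
      Ed k (1, 1, (t.map lam).prod) := by
    intro t
    induction t with
    | nil => exact (Ed_one k).symm
    | cons e t ih =>
      rw [List.map_cons, List.map_cons, List.prod_cons, ih, hs, ← Ed_mul k hk]
      congr 1
      simp
  cases bs with
  | nil => exact absurd rfl h1
  | cons e t =>
    refine ⟨(((d.1, d.2.1), (1, 1), true, true), e) :: t.map (fun e => ((((1, 1), (1, 1), true, true), e) : Stp V)), ?_, ?_⟩
    · simpa using h2
    · rw [List.map_cons, List.prod_cons, ht, hs, ← Ed_mul k hk]
      congr 1
      simp at h3
      simp [h3]

theorem at_word (hk : ∀ s, 0 < k s) (hL : ∀ z : L, ∃ bs : List Bool, bs ≠ [] ∧ bs.length ≤ nm z + 2 ∧ (bs.map lam).prod = z)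
    (a : Atm V L) : ∃ l : List (Stp V), l.length ≤ anm nm a + 2 ∧ (l.map (stepv (lev := lev) k lam)).prod = aval k a := by
  rcases a with b | d
  · refine ⟨[(((1, 1), (1, 1), false, b), false)], by simp, ?_⟩
    have h1 : (Ed k ((1:V), (1:V), (1:L)) : GG lev L) = 1 := Ed_one k
    simp [stepv, mm, h1]
  · exact Ed_word k lam hk hL d

theorem list_word (hk : ∀ s, 0 < k s) (hL : ∀ z : L, ∃ bs : List Bool, bs ≠ [] ∧ bs.length ≤ nm z + 2 ∧ (bs.map lam).prod = z)
    (w : List (Atm V L)) : ∃ l : List (Stp V), l.length ≤ (w.map (anm nm)).sum + 2 * w.length ∧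
      (l.map (stepv (lev := lev) k lam)).prod = (w.map (aval k)).prod := by
  induction w with
  | nil => exact ⟨[], by simp, rfl⟩
  | cons a w ih =>
    obtain ⟨l, h1, h2⟩ := ih
    obtain ⟨l', h1', h2'⟩ := at_word (lev := lev) k lam hk hL a
    refine ⟨l' ++ l, ?_, ?_⟩
    · simp; omega
    · simp [h2, h2']

theorem coe_prod (l : List (Stp V)) : (((l.map (atG (lev := lev) k lam)).prod : Gam lev k lam) : GG lev L) =
    (l.map (stepv k lam)).prod := by
  induction l with
  | nil => rfl
  | cons a l ih => simp only [List.map_cons, List.prod_cons, Subgroup.coe_mul, ih]; rfl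

variable [Fintype V]

theorem speed_up (hk : ∀ s, 0 < k s) (hL : ∀ z : L, ∃ bs : List Bool, bs ≠ [] ∧ bs.length ≤ nm z + 2 ∧ (bs.map lam).prod = z)
    (n : ℕ) (W J : List (Stp V) → ℕ)
    (hR : ∀ l, l.length = n → Rep k nm (W l) (J l) (XX (aval (lev := lev) k) (uu lam l))) :
    speed (Set.range (atG (lev := lev) k lam)) (mu (atG k lam)) n ≤
      2 * EE n (fun l => (W l : ℝ)) + EE n (fun l => (J l : ℝ)) := by
  rw [speed_eq, ← EE_smul, ← EE_add]
  refine EE_mono fun l hl => ?_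
  obtain ⟨w, h1, h2, h3⟩ := hR l hl
  obtain ⟨v, h4, h5⟩ := list_word (lev := lev) k lam hk hL w
  have h6 := wl_le (atG (lev := lev) k lam) v (XX (atG k lam) l) (Subtype.ext (by rw [coe_prod, h5, h3, XX_atG]))
  have h7 : wordLength (Set.range (atG (lev := lev) k lam)) (XX (atG k lam) l) ≤ 2 * W l + J l := by omega
  exact_mod_cast h7

theorem aval_mem (hk : ∀ s, 0 < k s) (hL : ∀ z : L, ∃ bs : List Bool, bs ≠ [] ∧ bs.length ≤ nm z + 2 ∧ (bs.map lam).prod = z)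
    (a : Atm V L) : aval k a ∈ Subgroup.closure (Set.range (stepv (lev := lev) k lam)) := by
  obtain ⟨l, -, h⟩ := at_word (lev := lev) k lam hk hL a
  rw [← h, ← coe_prod]
  exact Subtype.property _

theorem ent_up (hk : ∀ s, 0 < k s) (hL : ∀ z : L, ∃ bs : List Bool, bs ≠ [] ∧ bs.length ≤ nm z + 2 ∧ (bs.map lam).prod = z)
    (n : ℕ) (W J : List (Stp V) → ℕ)
    (hR : ∀ l, l.length = n → Rep k nm (W l) (J l) (XX (aval (lev := lev) k) (uu lam l)))
    (Jm : ℕ) (hJ : ∀ l, l.length = n → J l ≤ Jm) (Z : Finset L) (hZ : ∀ z, nm z ≤ Jm → z ∈ Z) :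
    entropy (convPow (mu (atG (lev := lev) k lam)) n) ≤
      Real.log (2 * (2 + (Fintype.card V : ℝ) ^ 2 * Z.card)) * EE n (fun l => (W l : ℝ)) + 1 := by
  let val : Bool ⊕ (V × V × Z) → Gam lev k lam := fun a => match a with
    | .inl b => ⟨aval k (.inl b), aval_mem k lam hk hL _⟩
    | .inr d => ⟨aval k (.inr (d.1, d.2.1, d.2.2.1)), aval_mem k lam hk hL _⟩
  have hval : ∀ w : List (Atm V L), (w.map (anm nm)).sum ≤ Jm → ∃ w' : List (Bool ⊕ (V × V × Z)),
      w'.length = w.length ∧ (((w'.map val).prod : Gam lev k lam) : GG lev L) = (w.map (aval k)).prod := by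
    intro w
    induction w with
    | nil => intro _; exact ⟨[], rfl, rfl⟩
    | cons a w ih =>
      intro h
      rw [List.map_cons, List.sum_cons] at h
      obtain ⟨w', h1, h2⟩ := ih (by omega)
      rcases a with b | d
      · refine ⟨.inl b :: w', by simp [h1], ?_⟩
        simp only [List.map_cons, List.prod_cons, Subgroup.coe_mul, h2]
        rfl
      · have hd : nm d.2.2 ≤ Jm := by
          have : anm nm (.inr d : Atm V L) = nm d.2.2 := rfl
          omega
        refine ⟨.inr (d.1, d.2.1, ⟨d.2.2, hZ _ hd⟩) :: w', by simp [h1], ?_⟩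
        simp only [List.map_cons, List.prod_cons, Subgroup.coe_mul, h2]
        rfl
  have h := entropy_upper (atG (lev := lev) k lam) val n (fun l => (W l : ℝ)) (by
    intro l hl
    obtain ⟨w, h1, h2, h3⟩ := hR l hl
    obtain ⟨w', h4, h5⟩ := hval w (h2.trans (hJ l hl))
    refine ⟨w', Subtype.ext (by rw [h5, h3, XX_atG]), ?_⟩
    rw [h4]; exact_mod_cast h1)
  refine h.trans (le_of_eq ?_)
  congr 3
  simp only [Fintype.card_sum, Fintype.card_prod, Fintype.card_bool, Fintype.card_coe]
  push_cast
  ring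

end
end SE

/-! ## Part P9 -/
namespace SE

section
variable {V L : Type} [CommGroup V] [CommGroup L] {lev : ℕ → Lev V} (k : ℕ → ℕ) (lam : Bool → L)
variable [Fintype V]

theorem speed_half (n : ℕ) (hn : 1 ≤ n) :
    1 / 2 ≤ speed (Set.range (atG (lev := lev) k lam)) (mu (atG k lam)) n := by
  rw [speed_eq]
  have h1 : EE n (fun l : List (Stp V) => if cu (uu lam l) ≠ 0 then (1:ℝ) else 0) ≤
      EE n (fun l => (wordLength (Set.range (atG (lev := lev) k lam)) (XX (atG k lam) l) : ℝ)) := by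
    refine EE_mono fun l _ => ?_
    by_cases h : cu (uu lam l) = 0
    · rw [if_neg (by simpa using h)]; positivity
    · rw [if_pos h]
      have : wordLength (Set.range (atG (lev := lev) k lam)) (XX (atG k lam) l) ≠ 0 := by
        intro h0
        obtain ⟨l', h1, h2⟩ := wl_spec (atG (lev := lev) k lam) l
        rw [h0, List.length_eq_zero_iff] at h2
        subst h2
        apply h
        rw [← XX_c (lev := lev) k, ← XX_atG, ← h1]
        rfl
      exact_mod_cast Nat.one_le_iff_ne_zero.2 this
  refine le_trans ?_ h1
  obtain ⟨m, rfl⟩ : ∃ m, n = m + 1 := ⟨n - 1, by omega⟩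
  rw [EE_succ']
  have h2 : ∀ l : List (Stp V), (1:ℝ) / 2 ≤ av (fun a : Stp V => if cu (uu lam (a :: l)) ≠ 0 then (1:ℝ) else 0) := by
    intro l
    simp only [cu_uu]
    rw [av_dl (fun d => if cu (uu lam l) + d ≠ 0 then (1:ℝ) else 0)]
    generalize cu (uu lam l) = c
    split_ifs <;> first | (exfalso; omega) | norm_num
  have h3 := EE_mono (n := m) (F := fun _ => (1:ℝ) / 2) fun l _ => h2 l
  rwa [EE_const] at h3

theorem ent_speed (n : ℕ) : entropy (convPow (mu (atG (lev := lev) k lam)) n) ≤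
    Real.log (2 * Fintype.card (Stp V)) * speed (Set.range (atG (lev := lev) k lam)) (mu (atG k lam)) n + 1 := by
  rw [speed_eq]
  refine entropy_upper _ (atG (lev := lev) k lam) n _ fun l _ => ?_
  obtain ⟨l', h1, h2⟩ := wl_spec (atG (lev := lev) k lam) l
  refine ⟨l'.reverse, ?_, ?_⟩
  · rw [← XX_eq_rev, h1]
  · rw [List.length_reverse, h2]

end

section
variable {V : Type} [CommGroup V] {lev : ℕ → Lev V} (k : ℕ → ℕ) (s : ℕ)

theorem pz_sum (hk : ∀ s, 0 < k s) (n : ℕ) (l : List (Stp V)) :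
    ∑ κ ∈ win s lev n, |pz k s lev l κ| ≤ l.length := by
  induction l with
  | nil => simp [pz, ph_nil]
  | cons a l ih =>
    have h : ∀ κ, |pz k s lev (a :: l) κ| ≤ |pz k s lev l κ| + if κ = kb k s lev (l.map Prod.fst) then 1 else 0 := by
      intro κ
      have : pz k s lev (a :: l) κ = pz k s lev l κ + ((Multiplicative.toAdd
          (if a.1.2.2.1 = true ∧ κ = kb k s lev (l.map Prod.fst) then lamB a.2 else 1) : ℤ) : ℝ) := by
        unfold pz
        rw [ph_cons k lamB s hk, toAdd_mul]
        push_cast; rfl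
      rw [this]
      refine (abs_add_le _ _).trans (add_le_add le_rfl ?_)
      by_cases h1 : κ = kb k s lev (l.map Prod.fst)
      · rw [if_pos h1]
        split_ifs
        · unfold lamB; split_ifs <;> simp
        · simp
      · simp [h1]
    refine (Finset.sum_le_sum fun κ _ => h κ).trans ?_
    rw [Finset.sum_add_distrib, Finset.sum_ite_eq', List.length_cons]
    push_cast
    split_ifs <;> linarith

theorem speed_B [Fintype V] (hk : ∀ s, 0 < k s) (n : ℕ) :
    EE n (fun l : List (Stp V) => ∑ κ ∈ win s lev n, |pz k s lev l κ|) ≤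
    speed (Set.range (atG (lev := lev) k lamB)) (mu (atG k lamB)) n := by
  rw [speed_eq]
  refine EE_mono fun l _ => ?_
  obtain ⟨l', h1, h2⟩ := wl_spec (atG (lev := lev) k lamB) l
  rw [← h2]
  refine le_trans (le_of_eq ?_) (pz_sum (lev := lev) k s hk n l')
  refine Finset.sum_congr rfl fun κ _ => ?_
  unfold pz ph
  rw [← XX_atG, ← XX_atG, h1]

end

theorem params (e : ℝ) (h1 : 1 / 2 < e) (h2 : e < 1) : ∃ p : ℕ, 2 ≤ p ∧ ∃ c : ℝ, 2 ≤ c ∧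
    ∀ n : ℕ, 1 ≤ n → ∃ y z : ℝ, 1 ≤ y ∧ 1 ≤ z ∧ ∃ ss : ℕ, (n:ℝ) = y ^ 4 * z ^ 4 ∧ Real.sqrt n = y ^ 2 * z ^ 2 ∧
      (n:ℝ) ^ e = y ^ 4 * z ^ 2 ∧ (n:ℝ) ^ ((1 + e) / 2) = y ^ 4 * z ^ 3 ∧
      y ≤ ((p:ℝ) ^ 3) ^ ss ∧ ((p:ℝ) ^ 3) ^ ss ≤ (p:ℝ) ^ 3 * y ∧ z ≤ c ^ ss ∧ c ^ ss ≤ c * z := by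
  set x : ℝ := e - 1 / 2 with hx
  have hx0 : 0 < x := by linarith
  set θ : ℝ := (1 - e) / x with hθ
  have hθ0 : 0 < θ := div_pos (by linarith) hx0
  obtain ⟨p0, hp0⟩ := exists_nat_ge ((2:ℝ) ^ (1 / θ))
  set p := max 2 p0 with hp
  have hp2 : 2 ≤ p := le_max_left _ _
  have hpr : (2:ℝ) ≤ p := by exact_mod_cast hp2
  set P : ℝ := (p:ℝ) ^ 3 with hP
  have hP1 : (p:ℝ) ≤ P := by nlinarith [sq_nonneg ((p:ℝ) - 1)]
  have hP2 : 2 ≤ P := hpr.trans hP1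
  have hPp : (2:ℝ) ^ (1 / θ) ≤ P := by
    refine hp0.trans (le_trans ?_ hP1)
    exact_mod_cast le_max_right 2 p0
  refine ⟨p, hp2, P ^ θ, ?_, ?_⟩
  · calc (2:ℝ) = ((2:ℝ) ^ (1 / θ)) ^ θ := by
          rw [← Real.rpow_mul (by norm_num), one_div, inv_mul_cancel₀ hθ0.ne', Real.rpow_one]
      _ ≤ P ^ θ := Real.rpow_le_rpow (by positivity) hPp hθ0.le
  intro n hn
  have hn1 : (1:ℝ) ≤ n := by exact_mod_cast hn
  have hn0 : (0:ℝ) < n := by linarith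
  set y : ℝ := (n:ℝ) ^ (x / 2) with hy
  set z : ℝ := (n:ℝ) ^ ((1 - e) / 2) with hz
  have hy1 : 1 ≤ y := Real.one_le_rpow hn1 (by linarith)
  have hz1 : 1 ≤ z := Real.one_le_rpow hn1 (by linarith)
  have hzy : z = y ^ θ := by
    rw [hy, ← Real.rpow_mul hn0.le, hz]
    congr 1
    rw [hθ]; field_simp
  have hpow : ∀ i j : ℕ, y ^ i * z ^ j = (n:ℝ) ^ (x / 2 * i + (1 - e) / 2 * j) := by
    intro i j
    rw [Real.rpow_add hn0, Real.rpow_mul hn0.le, Real.rpow_mul hn0.le, Real.rpow_natCast, Real.rpow_natCast]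
  have hex : ∃ s : ℕ, y ≤ P ^ s := by
    obtain ⟨s, hs⟩ := pow_unbounded_of_one_lt y (show 1 < P by linarith)
    exact ⟨s, hs.le⟩
  have ha : y ≤ P ^ Nat.find hex := Nat.find_spec hex
  have hb : P ^ Nat.find hex ≤ P * y := by
    rcases Nat.eq_zero_or_pos (Nat.find hex) with h0 | h0
    · rw [h0, pow_zero]; nlinarith
    · have h3 := Nat.find_min hex (m := Nat.find hex - 1) (by omega)
      have h4 : P ^ Nat.find hex = P * P ^ (Nat.find hex - 1) := by
        rw [← pow_succ']; congr 1; omega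
      rw [h4]
      exact mul_le_mul_of_nonneg_left (not_le.1 h3).le (by linarith)
  have hc : (P ^ θ) ^ Nat.find hex = (P ^ Nat.find hex) ^ θ := by
    rw [← Real.rpow_natCast, ← Real.rpow_natCast, ← Real.rpow_mul (by linarith), ← Real.rpow_mul (by linarith), mul_comm]
  refine ⟨y, z, hy1, hz1, Nat.find hex, ?_, ?_, ?_, ?_, ha, hb, ?_, ?_⟩
  · rw [hpow]
    conv_lhs => rw [← Real.rpow_one (n:ℝ)]
    congr 1; push_cast; rw [hx]; ring
  · rw [hpow, Real.sqrt_eq_rpow]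
    congr 1; push_cast; rw [hx]; ring
  · rw [hpow]
    congr 1; push_cast; rw [hx]; ring
  · rw [hpow]
    congr 1; push_cast; rw [hx]; ring
  · rw [hzy, hc]; exact Real.rpow_le_rpow (by linarith) ha hθ0.le
  · rw [hzy, hc, ← Real.mul_rpow (by linarith) (by linarith)]
    exact Real.rpow_le_rpow (by positivity) hb hθ0.le

theorem geo1 {r : ℝ} (hr : 2 ≤ r) (ss N : ℕ) : ∑ s ∈ Finset.range N, (if s < ss then r ^ s else 0) ≤ r ^ ss := by
  have h1 : ∀ m, ∑ s ∈ Finset.range m, r ^ s ≤ r ^ m := by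
    intro m
    induction m with
    | zero => simp
    | succ m ih =>
      rw [Finset.sum_range_succ, pow_succ]
      have : 0 < r ^ m := by positivity
      nlinarith
  refine le_trans ?_ (h1 ss)
  rw [← Finset.sum_filter]
  refine Finset.sum_le_sum_of_subset_of_nonneg ?_ (fun i _ _ => by positivity)
  intro s hs
  exact Finset.mem_range.2 (Finset.mem_filter.1 hs).2

theorem geo2 {r : ℝ} (hr : 2 ≤ r) (ss N : ℕ) :
    ∑ s ∈ Finset.range N, (if s < ss then 0 else 1 / r ^ s) ≤ 2 / r ^ ss := by
  have h : ∑ s ∈ Finset.range N, (if s < ss then 0 else 1 / r ^ s) + 2 / r ^ (max N ss) ≤ 2 / r ^ ss := by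
    induction N with
    | zero => simp
    | succ N ih =>
      rw [Finset.sum_range_succ]
      by_cases h : N < ss
      · rw [if_pos h, max_eq_right (by omega)]
        rw [max_eq_right (by omega)] at ih
        linarith
      · rw [if_neg h, max_eq_left (by omega)]
        rw [max_eq_left (by omega)] at ih
        have : 2 / r ^ (N + 1) ≤ 1 / r ^ N := by
          rw [div_le_div_iff₀ (by positivity) (by positivity), pow_succ]
          have : 0 < r ^ N := by positivity
          nlinarith
        have h2 : 2 / r ^ N = 1 / r ^ N + 1 / r ^ N := by ring
        linarith
  have : 0 ≤ 2 / r ^ (max N ss) := by positivity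
  linarith

/-- spacings -/
noncomputable def ddc (c : ℝ) (s : ℕ) : ℕ := ⌈(c ^ 2) ^ s⌉₊

theorem ddc_ge (c : ℝ) (s : ℕ) : (c ^ 2) ^ s ≤ ddc c s := Nat.le_ceil _

theorem ddc_le {c : ℝ} (hc : 2 ≤ c) (s : ℕ) : (ddc c s : ℝ) ≤ 2 * (c ^ 2) ^ s := by
  have h1 : 1 ≤ (c ^ 2) ^ s := one_le_pow₀ (by nlinarith)
  have := Nat.ceil_lt_add_one (show 0 ≤ (c ^ 2) ^ s by positivity)
  unfold ddc
  linarith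

theorem ddc_pos {c : ℝ} (hc : 2 ≤ c) (s : ℕ) : 0 < ddc c s := Nat.ceil_pos.2 (by positivity)

theorem ddc_two {c : ℝ} (hc : 2 ≤ c) (s : ℕ) : 2 * ddc c s ≤ ddc c (s + 1) := by
  have h1 := ddc_le hc s
  have h2 := ddc_ge c (s + 1)
  rw [pow_succ] at h2
  have h3 : 0 < (c ^ 2) ^ s := by positivity
  have h4 : 4 ≤ c ^ 2 := by nlinarith
  have : (2 * ddc c s : ℝ) ≤ ddc c (s + 1) := by nlinarith
  exact_mod_cast this

theorem ddc_lin {c : ℝ} (hc : 2 ≤ c) (s : ℕ) : s + 1 ≤ ddc c s := by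
  induction s with
  | zero => exact ddc_pos hc 0
  | succ s ih => have := ddc_two hc s; omega

noncomputable def levs (p : ℕ) [NeZero p] (s : ℕ) : Lev V3 := clev (p ^ (2 * s))

theorem card_levK (p : ℕ) [NeZero p] (s : ℕ) : (Fintype.card (levs p s).K : ℝ) = (((p:ℝ) ^ 3) ^ 2) ^ s := by
  unfold levs
  rw [card_K]
  push_cast
  ring

theorem card_levZZ (p : ℕ) [NeZero p] (s : ℕ) : (Fintype.card (ZZ (levs p s)) : ℝ) = 512 * (((p:ℝ) ^ 3) ^ 2) ^ s := by
  have h : Fintype.card (ZZ (levs p s)) = Fintype.card (levs p s).Y * (Fintype.card V3 * Fintype.card V3) := by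
    unfold ZZ
    rw [Fintype.card_prod, Fintype.card_prod]
  rw [h, card_V3]
  unfold levs
  rw [card_Y]
  push_cast
  ring

noncomputable def kc (c : ℝ) (s : ℕ) : ℕ := 4 * ddc c s

theorem kc_pos {c : ℝ} (hc : 2 ≤ c) (s : ℕ) : 0 < kc c s := by
  have := ddc_pos hc s; unfold kc; omega

section
variable {L : Type} [CommGroup L] (lam : Bool → L) {p : ℕ} [NeZero p] {c : ℝ}

noncomputable def Wn (p : ℕ) [NeZero p] (c : ℝ) (ss n : ℕ) (l : List (Stp V3)) : ℕ :=
  (∑ s ∈ Finset.range n, WL (ddc c) (levs p) ss s (uu lam l)) + (14 * Ru (uu lam l) + 6)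

noncomputable def Jn (nm : L → ℕ) (p : ℕ) [NeZero p] (c : ℝ) (ss n : ℕ) (l : List (Stp V3)) : ℕ :=
  (∑ s ∈ Finset.range n, JL (ddc c) (levs p) (kc c) nm ss s (uu lam l)) +
        ∑ x ∈ Finset.Icc (-(Ru (uu lam l) : ℤ)) (Ru (uu lam l)), nm (Pt (uu lam l) x).2.2

theorem Rep_n {nm : L → ℕ} (hnm : nm 1 = 0) (hnm2 : ∀ a, nm a⁻¹ = nm a) (hc : 2 ≤ c) (ss n : ℕ)
    (l : List (Stp V3)) (hl : l.length = n) :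
    Rep (kc c) nm (Wn lam p c ss n l) (Jn lam nm p c ss n l) (XX (aval (lev := levs p) (kc c)) (uu lam l)) := by
  refine Rep_main hnm hnm2 (ddc_pos hc) (ddc_two hc) (fun _ => rfl) ss _ n ?_
  intro s hs
  have h1 := Ru_le lam l
  have h2 := ddc_lin hc s
  omega

theorem EW (hc : 2 ≤ c) (hp : 2 ≤ p) (n ss : ℕ) {y z : ℝ} (hy : 1 ≤ y) (hz : 1 ≤ z) (hn : (n:ℝ) = y ^ 4 * z ^ 4)
    (hsq : Real.sqrt n = y ^ 2 * z ^ 2) (h1 : ((p:ℝ) ^ 3) ^ ss ≤ (p:ℝ) ^ 3 * y) (h2 : z ≤ c ^ ss) :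
    EE n (fun l => (Wn lam p c ss n l : ℝ)) ≤ (442368 * (p:ℝ) ^ 6 + 656) * (y ^ 4 * z ^ 2) := by
  have hpr : (2:ℝ) ≤ p := by exact_mod_cast hp
  have h := E_W (lev := levs p) lam (ddc_pos hc) ss n n
  refine h.trans ?_
  rw [hsq]
  have hP : 2 ≤ ((p:ℝ) ^ 3) ^ 2 := by
    have : (1:ℝ) ≤ (p:ℝ) ^ 5 := one_le_pow₀ (by linarith)
    calc (2:ℝ) ≤ p * 1 := by linarith
      _ ≤ p * p ^ 5 := by gcongr
      _ = _ := by ring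
  have s1 : ∑ s ∈ Finset.range n, (if s < ss then (Fintype.card (ZZ (levs p s)) : ℝ) else 0) ≤ 512 * ((p:ℝ) ^ 6 * y ^ 2) := by
    have : ∀ s, (if s < ss then (Fintype.card (ZZ (levs p s)) : ℝ) else 0) = 512 * (if s < ss then (((p:ℝ) ^ 3) ^ 2) ^ s else 0) := by
      intro s; rw [card_levZZ]; split_ifs <;> simp
    simp only [this]
    rw [← Finset.mul_sum]
    gcongr
    refine (geo1 hP ss n).trans ?_
    calc (((p:ℝ) ^ 3) ^ 2) ^ ss = (((p:ℝ) ^ 3) ^ ss) ^ 2 := by ring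
      _ ≤ ((p:ℝ) ^ 3 * y) ^ 2 := by gcongr
      _ = _ := by ring
  have s2 : ∑ s ∈ Finset.range n, (if s < ss then 0 else 1 / (ddc c s : ℝ)) ≤ 2 / z ^ 2 := by
    have hc2 : 2 ≤ c ^ 2 := by nlinarith
    have h3 : ∑ s ∈ Finset.range n, (if s < ss then 0 else 1 / (ddc c s : ℝ)) ≤
        ∑ s ∈ Finset.range n, (if s < ss then 0 else 1 / (c ^ 2) ^ s) := by
      refine Finset.sum_le_sum fun s _ => ?_
      split_ifs
      · exact le_rfl
      · exact one_div_le_one_div_of_le (by positivity) (ddc_ge c s)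
    refine h3.trans ((geo2 hc2 ss n).trans ?_)
    have : z ^ 2 ≤ (c ^ 2) ^ ss := by
      rw [← pow_mul, mul_comm, pow_mul]; gcongr
    gcongr
  have s3 : (304 * ∑ s ∈ Finset.range n, (if s < ss then 0 else 1 / (ddc c s : ℝ))) * n ≤ 608 * (y ^ 4 * z ^ 2) := by
    rw [hn]
    calc _ ≤ (304 * (2 / z ^ 2)) * (y ^ 4 * z ^ 4) := by gcongr
      _ = _ := by field_simp; ring
  have s4 : (864 * ∑ s ∈ Finset.range n, (if s < ss then (Fintype.card (ZZ (levs p s)) : ℝ) else 0)) * (y ^ 2 * z ^ 2) ≤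
      442368 * (p:ℝ) ^ 6 * (y ^ 4 * z ^ 2) := by
    calc _ ≤ (864 * (512 * ((p:ℝ) ^ 6 * y ^ 2))) * (y ^ 2 * z ^ 2) := by gcongr
      _ = _ := by ring
  have hy2 : 1 ≤ y ^ 2 := one_le_pow₀ hy
  have hz2 : 1 ≤ z ^ 2 := one_le_pow₀ hz
  have s5 : y ^ 2 * z ^ 2 ≤ y ^ 4 * z ^ 2 := by
    gcongr
    norm_num
  have s6 : 1 ≤ y ^ 2 * z ^ 2 := by nlinarith
  linarith

theorem Gb (hc : 2 ≤ c) (hp : 2 ≤ p) (n ss : ℕ) {y z : ℝ} (hy : 1 ≤ y) (hz : 1 ≤ z)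
    (hsq : Real.sqrt n = y ^ 2 * z ^ 2) (h1 : y ≤ ((p:ℝ) ^ 3) ^ ss) (h2 : c ^ ss ≤ c * z) :
    ∑ j ∈ Finset.range n, pp (kc c) lam (levs p) ss j ≤ (20736 * c ^ 2 + 128) * z ^ 2 := by
  have h := G_bound (lev := levs p) (kc c) lam (kc_pos hc) ss ((p ^ (2 * ss)) ^ 2) n 648 (64 / ((p ^ (2 * ss) : ℕ) : ℝ) ^ 3)
    (hh_sum (p ^ (2 * ss))) (fun y => hh_last (p ^ (2 * ss)) y) (by positivity)
  refine h.trans ?_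
  rw [hsq]
  have e1 : ((p ^ (2 * ss) : ℕ) : ℝ) ^ 3 = (((p:ℝ) ^ 3) ^ ss) ^ 2 := by push_cast; ring
  have e2 : 64 / ((p ^ (2 * ss) : ℕ) : ℝ) ^ 3 * (2 * (y ^ 2 * z ^ 2)) ≤ 128 * z ^ 2 := by
    rw [e1]
    calc _ ≤ 64 / y ^ 2 * (2 * (y ^ 2 * z ^ 2)) := by gcongr
      _ = _ := by field_simp; ring
  have e3 : (kc c ss : ℝ) ≤ 8 * (c ^ 2 * z ^ 2) := by
    have h3 := ddc_le hc ss
    have h4 : (c ^ 2) ^ ss ≤ (c * z) ^ 2 := by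
      rw [← pow_mul, mul_comm, pow_mul]; gcongr
    rw [mul_pow] at h4
    unfold kc
    push_cast
    linarith
  linarith

end
end SE

/-! ## Part P10 -/
namespace SE

theorem comb {a b C D : ℝ} (hb : 0 ≤ b) (h : a ≤ C * b) (hCD : C ≤ D) : a ≤ D * b :=
  h.trans (mul_le_mul_of_nonneg_right hCD hb)

theorem atG_triv {V L : Type} [CommGroup V] [CommGroup L] {lev : ℕ → Lev V} (k : ℕ → ℕ) (lam : Bool → L)
    (e : Bool) (he : lam e = 1) : atG (lev := lev) k lam (((1, 1), (1, 1), true, true), e) = 1 := by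
  refine Subtype.ext ?_
  show stepv (lev := lev) k lam (((1, 1), (1, 1), true, true), e) = 1
  have h1 : (Ed k ((1:V), (1:V), (1:L)) : GG lev L) = 1 := Ed_one k
  simp [stepv, mm, aval, he, h1]

abbrev LA := Multiplicative (ZMod 2)
def lamA (e : Bool) : LA := Multiplicative.ofAdd (if e then 1 else 0)

theorem lamA_surj : ∀ z : LA, ∃ e, lamA e = z := by decide
theorem lamA_inv : ∀ e : Bool, lamA (id e) = (lamA e)⁻¹ := by decide
theorem lamA_ne : lamA false ≠ lamA true := by decide

set_option maxHeartbeats 1600000 in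
/-- group with speed and entropy both of exponent `e` -/
theorem thmA (e : ℝ) (he1 : 1 / 2 < e) (he2 : e < 1) :
    ∃ (Γ : Type) (_ : Group Γ) (at' : Stp V3 → Γ) (inv : Stp V3 → Stp V3),
      (∀ a, inv (inv a) = a) ∧ (∀ a, at' (inv a) = (at' a)⁻¹) ∧ Subgroup.closure (Set.range at') = ⊤ ∧
      (∃ a, at' a = 1) ∧ ∃ C : ℝ, 0 < C ∧ ∀ n : ℕ, 1 ≤ n →
        (speed (Set.range at') (mu at') n ≤ C * (n : ℝ) ^ e ∧ (n : ℝ) ^ e ≤ C * speed (Set.range at') (mu at') n) ∧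
        (entropy (convPow (mu at') n) ≤ C * (n : ℝ) ^ e ∧ (n : ℝ) ^ e ≤ C * entropy (convPow (mu at') n)) := by
  obtain ⟨p, hp, c, hc, hpar⟩ := params e he1 he2
  haveI : NeZero p := ⟨by omega⟩
  refine ⟨Gam (levs p) (kc c) lamA, inferInstance, atG (kc c) lamA, sinv id, sinv_sinv id fun _ => rfl,
    atG_inv _ _ (kc_pos hc) id lamA_inv, atG_gen _ _, ⟨_, atG_triv _ _ false rfl⟩, ?_⟩
  have hl2 : 0 < Real.log 2 := Real.log_pos (by norm_num)
  set CW : ℝ := 442368 * (p:ℝ) ^ 6 + 656 with hCW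
  set CG : ℝ := 20736 * c ^ 2 + 128 with hCG
  set K0 : ℝ := Real.log (2 * (2 + (Fintype.card V3 : ℝ) ^ 2 * (Finset.univ : Finset LA).card)) with hK0
  have hK0p : 0 ≤ K0 := Real.log_nonneg (by
    have : 0 ≤ (Fintype.card V3 : ℝ) ^ 2 * (Finset.univ : Finset LA).card := by positivity
    linarith)
  set K1 : ℝ := Real.log (2 * Fintype.card (Stp V3)) with hK1
  have hK1p : 0 ≤ K1 := Real.log_nonneg (by
    have : 0 < Fintype.card (Stp V3) := Fintype.card_pos
    have : (1:ℝ) ≤ Fintype.card (Stp V3) := by exact_mod_cast this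
    linarith)
  have hCWp : 0 < CW := by positivity
  have hCGp : 0 < CG := by positivity
  set K2 : ℝ := 4 * (2 * CG + 1) / Real.log 2 with hK2
  have hK2p : 0 < K2 := by positivity
  refine ⟨2 * CW + (K0 * CW + 1) + K2 + K2 * (K1 + 2), by positivity, ?_⟩
  intro n hn
  obtain ⟨y, z, hy, hz, ss, hn4, hsq, hne, -, a1, a2, a3, a4⟩ := hpar n hn
  have hw := EW lamA (p := p) hc hp n ss hy hz hn4 hsq a2 a3
  have hg := Gb lamA (p := p) hc hp n ss hy hz hsq a1 a4
  have hL : ∀ z : LA, ∃ bs : List Bool, bs ≠ [] ∧ bs.length ≤ (fun _ : LA => 0) z + 2 ∧ (bs.map lamA).prod = z := by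
    intro z
    obtain ⟨b, hb⟩ := lamA_surj z
    exact ⟨[b], by simp, by simp, by simpa using hb⟩
  have hR : ∀ l : List (Stp V3), l.length = n → Rep (kc c) (fun _ : LA => 0) (Wn lamA p c ss n l) ((fun _ => 0) l)
      (XX (aval (lev := levs p) (kc c)) (uu lamA l)) := by
    intro l hl
    obtain ⟨w, h1, h2, h3⟩ := Rep_n (p := p) lamA (nm := fun _ : LA => 0) rfl (fun _ => rfl) hc ss n l hl
    refine ⟨w, h1, ?_, h3⟩
    have : w.map (anm (V := V3) (fun _ : LA => 0)) = w.map (fun _ => 0) := by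
      apply List.map_congr_left
      rintro (b | d) _ <;> rfl
    rw [this]
    simp
  have hsp := speed_up (kc c) lamA (kc_pos hc) hL n _ _ hR
  have hen := ent_up (kc c) lamA (kc_pos hc) hL n _ _ hR 0 (fun _ _ => le_rfl) Finset.univ (fun _ _ => Finset.mem_univ _)
  have hlo := ent_low (lev := levs p) (kc c) lamA ss (atG (kc c) lamA) (kc_pos hc) lamA_ne Subtype.val
    (XX_atG _ _) n _ hg
  have hes := ent_speed (lev := levs p) (kc c) lamA n
  have hsh := speed_half (lev := levs p) (kc c) lamA n hn
  rw [hne]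
  set X : ℝ := y ^ 4 * z ^ 2 with hX
  have hX1 : 1 ≤ X := by
    have h4 := one_le_pow₀ (n := 4) hy
    have h5 := one_le_pow₀ (n := 2) hz
    exact one_le_mul_of_one_le_of_one_le h4 h5
  set H := entropy (convPow (mu (atG (lev := levs p) (kc c) lamA)) n)
  set sp := speed (Set.range (atG (lev := levs p) (kc c) lamA)) (mu (atG (kc c) lamA)) n
  simp only [Nat.cast_zero, EE_const, add_zero] at hsp
  have hz2 : 1 ≤ z ^ 2 := one_le_pow₀ hz
  have hn0 : (0:ℝ) < n := by exact_mod_cast hn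
  have hH0 : 0 ≤ H := by
    by_contra h
    push Not at h
    have h1 : 0 < (n:ℝ) / 4 * Real.log 2 := by positivity
    have h2 : 0 < 2 * (CG * z ^ 2) + 1 := by positivity
    have h3 := mul_neg_of_pos_of_neg h2 h
    linarith
  have b1 : sp ≤ (2 * CW) * X := by linarith
  have b2 : H ≤ (K0 * CW + 1) * X := by
    have := mul_le_mul_of_nonneg_left hw hK0p
    linarith
  have b3 : X ≤ K2 * H := by
    have h1 : (n:ℝ) / 4 * Real.log 2 ≤ ((2 * CG + 1) * z ^ 2) * H := by
      refine hlo.trans (mul_le_mul_of_nonneg_right ?_ hH0)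
      linarith
    have h2 : (n:ℝ) = X * z ^ 2 := by rw [hn4, hX]; ring
    rw [h2] at h1
    have h3 : z ^ 2 * (X / 4 * Real.log 2) ≤ z ^ 2 * ((2 * CG + 1) * H) := by linarith
    have h4 := le_of_mul_le_mul_left h3 (by positivity)
    rw [hK2, div_mul_eq_mul_div, le_div_iff₀ hl2]
    linarith
  have b4 : X ≤ (K2 * (K1 + 2)) * sp := by
    have h1 : H ≤ (K1 + 2) * sp := by linarith
    have := mul_le_mul_of_nonneg_left h1 hK2p.le
    linarith
  have hsp0 : 0 ≤ sp := by linarith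
  have q1 : 0 ≤ K0 * CW := by positivity
  have q2 : 0 ≤ K2 * (K1 + 2) := by positivity
  refine ⟨⟨comb (by linarith) b1 ?_, comb hsp0 b4 ?_⟩, comb (by linarith) b2 ?_, comb hH0 b3 ?_⟩ <;> linarith

theorem lamB_inv : ∀ e : Bool, lamB (!e) = (lamB e)⁻¹ := by decide

theorem lamB_words (z : ZL) : ∃ bs : List Bool, bs ≠ [] ∧ bs.length ≤ nmB z + 2 ∧ (bs.map lamB).prod = z := by
  by_cases h0 : z = 1
  · subst h0
    exact ⟨[true, false], by simp, by simp, by decide⟩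
  · have hpos : nmB z ≠ 0 := by
      intro h
      apply h0
      unfold nmB at h
      exact Multiplicative.toAdd.injective (Int.natAbs_eq_zero.1 h)
    have hz : (Multiplicative.toAdd z : ℤ) = nmB z ∨ (Multiplicative.toAdd z : ℤ) = - nmB z := by
      unfold nmB; exact Int.natAbs_eq _
    rcases hz with hz | hz
    · refine ⟨List.replicate (nmB z) true, by simpa using hpos, by simp, ?_⟩
      apply Multiplicative.toAdd.injective
      rw [List.map_replicate, List.prod_replicate, toAdd_pow, hz]
      simp [lamB]
    · refine ⟨List.replicate (nmB z) false, by simpa using hpos, by simp, ?_⟩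
      apply Multiplicative.toAdd.injective
      rw [List.map_replicate, List.prod_replicate, toAdd_pow, hz]
      simp [lamB]

theorem Jn_le {p : ℕ} [NeZero p] {c : ℝ} (hc : 2 ≤ c) (ss n : ℕ) (l : List (Stp V3)) (hl : l.length = n) :
    Jn lamB nmB p c ss n l ≤ 2 * n ^ 2 + n := by
  have hR : Ru (uu lamB l) ≤ n := hl ▸ Ru_le lamB l
  have hP := (QP_acc (V := V3) n).abs_le l
  rw [hl] at hP
  have hP' : ∑ x ∈ Finset.Icc (-(Ru (uu lamB l) : ℤ)) (Ru (uu lamB l)), nmB (Pt (uu lamB l) x).2.2 ≤ n := by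
    refine (Finset.sum_le_sum_of_subset (Icc_sub hR)).trans ?_
    have : ((∑ x ∈ Finset.Icc (-(n:ℤ)) n, nmB (Pt (uu lamB l) x).2.2 : ℕ) : ℝ) ≤ n := by
      push_cast; simp only [nmB_abs]; exact hP
    exact_mod_cast this
  have h2 : ∑ s ∈ Finset.range n, JL (ddc c) (levs p) (kc c) nmB ss s (uu lamB l) ≤ ∑ s ∈ Finset.range n, 2 * n :=
    Finset.sum_le_sum fun s _ => JL_le (kc c) (kc_pos hc) (ddc_pos hc) ss s n l hl
  rw [Finset.sum_const, Finset.card_range, smul_eq_mul] at h2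
  unfold Jn
  nlinarith

theorem EJ {p : ℕ} [NeZero p] {c : ℝ} (hc : 2 ≤ c) (hp : 2 ≤ p) (n ss : ℕ) (hn1 : 1 ≤ n)
    {y z : ℝ} (hy : 1 ≤ y) (hz : 1 ≤ z) (hn : (n:ℝ) = y ^ 4 * z ^ 4)
    (hsq : Real.sqrt n = y ^ 2 * z ^ 2) (h1 : ((p:ℝ) ^ 3) ^ ss ≤ (p:ℝ) ^ 3 * y) (h2 : z ≤ c ^ ss) :
    EE n (fun l => (Jn lamB nmB p c ss n l : ℝ)) ≤ (9 * (p:ℝ) ^ 3 + 17) * (y ^ 4 * z ^ 3) := by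
  have hpr : (2:ℝ) ≤ p := by exact_mod_cast hp
  have hP : 2 ≤ (p:ℝ) ^ 3 := by
    calc (2:ℝ) ≤ p ^ 1 := by linarith
      _ ≤ p ^ 3 := pow_le_pow_right₀ (by linarith) (by norm_num)
  have hy0 : 0 < y := by linarith
  have hz0 : 0 < z := by linarith
  have e0 : EE n (fun l => (Jn lamB nmB p c ss n l : ℝ)) =
      ∑ s ∈ Finset.range n, EE n (fun l => (JL (ddc c) (levs p) (kc c) nmB ss s (uu lamB l) : ℝ)) +
      EE n (fun l : List (Stp V3) => ((∑ x ∈ Finset.Icc (-(Ru (uu lamB l) : ℤ)) (Ru (uu lamB l)),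
      nmB (Pt (uu lamB l) x).2.2 : ℕ) : ℝ)) := by
    rw [← EE_sum, ← EE_add]
    congr 1
    ext l
    unfold Jn
    push_cast
    rfl
  rw [e0]
  have eP := E_P (V := V3) (mul_pos hy0 hz0) n hn1
  have eP' : (n:ℝ) / (2 * (y * z)) + 4 * (y * z) * Real.sqrt n ≤ 5 * (y ^ 4 * z ^ 3) := by
    rw [hsq, hn]
    have : y ^ 4 * z ^ 4 / (2 * (y * z)) + 4 * (y * z) * (y ^ 2 * z ^ 2) = 9 / 2 * (y ^ 3 * z ^ 3) := by
      field_simp; ring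
    rw [this]
    have : y ^ 3 * z ^ 3 ≤ y ^ 4 * z ^ 3 := by gcongr <;> norm_num
    have : 0 ≤ y ^ 3 * z ^ 3 := by positivity
    linarith
  have hs : ∀ s ∈ Finset.range n, EE n (fun l => (JL (ddc c) (levs p) (kc c) nmB ss s (uu lamB l) : ℝ)) ≤
      9 * (y ^ 3 * z ^ 3) * (if s < ss then ((p:ℝ) ^ 3) ^ s else 0) + 6 * n * (if s < ss then 0 else 1 / c ^ s) := by
    intro s _
    by_cases h : s < ss
    · rw [if_pos h, if_pos h]
      have hPs : 0 < ((p:ℝ) ^ 3) ^ s := by positivity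
      have ht : 0 < y * z / ((p:ℝ) ^ 3) ^ s := by positivity
      refine (E_Jtour (kc c) (kc_pos hc) ht ss s n hn1 h).trans ?_
      rw [card_levK, hsq, hn]
      apply le_of_eq
      rw [← pow_mul ((p:ℝ) ^ 3), mul_comm 2 s, pow_mul]
      generalize ((p:ℝ) ^ 3) ^ s = Q at *
      field_simp
      ring
    · rw [if_neg h, if_neg h]
      have hcs : 0 < c ^ s := by positivity
      refine (E_Jseg (kc c) (ddc_pos hc) hcs ss s n h).trans ?_
      have h3 := ddc_ge c s
      have h4 : 5 * c ^ s * n / (ddc c s : ℝ) ≤ 5 * c ^ s * n / (c ^ 2) ^ s := by gcongr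
      have h5 : 5 * c ^ s * n / (c ^ 2) ^ s = 5 * (n / c ^ s) := by
        rw [← pow_mul, mul_comm 2 s, pow_mul]
        field_simp
      rw [h5] at h4
      have : 9 * (y ^ 3 * z ^ 3) * 0 + 6 * (n:ℝ) * (1 / c ^ s) = 6 * (n / c ^ s) := by ring
      rw [this]
      linarith
  have hs2 := Finset.sum_le_sum hs
  rw [Finset.sum_add_distrib, ← Finset.mul_sum, ← Finset.mul_sum] at hs2
  have g1 := geo1 hP ss n
  have g2 := geo2 hc ss n
  have i1 : 9 * (y ^ 3 * z ^ 3) * ∑ s ∈ Finset.range n, (if s < ss then ((p:ℝ) ^ 3) ^ s else 0) ≤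
      9 * (p:ℝ) ^ 3 * (y ^ 4 * z ^ 3) := by
    calc _ ≤ 9 * (y ^ 3 * z ^ 3) * ((p:ℝ) ^ 3 * y) := by gcongr; exact g1.trans h1
      _ = _ := by ring
  have i2 : 6 * (n:ℝ) * ∑ s ∈ Finset.range n, (if s < ss then 0 else 1 / c ^ s) ≤ 12 * (y ^ 4 * z ^ 3) := by
    have : 2 / c ^ ss ≤ 2 / z := by gcongr
    calc _ ≤ 6 * (n:ℝ) * (2 / z) := by gcongr; exact g2.trans this
      _ = _ := by rw [hn]; field_simp; ring
  linarith

set_option maxHeartbeats 1600000 in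
/-- group with speed exponent `(1+e)/2` and entropy at most `n^δ` for `δ > e` -/
theorem thmB (e δ : ℝ) (he1 : 1 / 2 < e) (he2 : e < 1) (hδ : e < δ) :
    ∃ (Γ : Type) (_ : Group Γ) (at' : Stp V3 → Γ) (inv : Stp V3 → Stp V3),
      (∀ a, inv (inv a) = a) ∧ (∀ a, at' (inv a) = (at' a)⁻¹) ∧ Subgroup.closure (Set.range at') = ⊤ ∧
      ∃ C : ℝ, 0 < C ∧ ∀ n : ℕ, 1 ≤ n →
        (speed (Set.range at') (mu at') n ≤ C * (n : ℝ) ^ ((1 + e) / 2) ∧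
          (n : ℝ) ^ ((1 + e) / 2) ≤ C * speed (Set.range at') (mu at') n) ∧
        entropy (convPow (mu at') n) ≤ C * (n : ℝ) ^ δ := by
  obtain ⟨p, hp, c, hc, hpar⟩ := params e he1 he2
  haveI : NeZero p := ⟨by omega⟩
  refine ⟨Gam (levs p) (kc c) lamB, inferInstance, atG (kc c) lamB, sinv not, sinv_sinv not (by simp),
    atG_inv _ _ (kc_pos hc) not lamB_inv, atG_gen _ _, ?_⟩
  set CW : ℝ := 442368 * (p:ℝ) ^ 6 + 656 with hCW
  set CG : ℝ := 20736 * c ^ 2 + 128 with hCG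
  set CJ : ℝ := 9 * (p:ℝ) ^ 3 + 17 with hCJ
  have hCWp : 0 < CW := by positivity
  have hCGp : 0 < CG := by positivity
  have hCJp : 0 < CJ := by positivity
  set K2 : ℝ := 12 * (2 * CG + 1) with hK2
  have hK2p : 1 ≤ K2 := by rw [hK2]; linarith
  set η : ℝ := (δ - e) / 2 with hη
  have hηp : 0 < η := by rw [hη]; linarith
  set A : ℝ := (904:ℝ) ^ η / η with hA
  have hAp : 0 < A := by positivity
  refine ⟨(2 * CW + CJ) + 4 * K2 + (A * CW + 1), by positivity, ?_⟩
  intro n hn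
  obtain ⟨y, z, hy, hz, ss, hn4, hsq, hne, hne2, a1, a2, a3, a4⟩ := hpar n hn
  have hw := EW lamB (p := p) hc hp n ss hy hz hn4 hsq a2 a3
  have hj := EJ (p := p) hc hp n ss hn hy hz hn4 hsq a2 a3
  have hg := Gb lamB (p := p) hc hp n ss hy hz hsq a1 a4
  have hR : ∀ l : List (Stp V3), l.length = n → Rep (kc c) nmB (Wn lamB p c ss n l) (Jn lamB nmB p c ss n l)
      (XX (aval (lev := levs p) (kc c)) (uu lamB l)) :=
    fun l hl => Rep_n (p := p) lamB nmB_one nmB_inv hc ss n l hl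
  have hsp := speed_up (kc c) lamB (kc_pos hc) lamB_words n _ _ hR
  set Z : Finset ZL := (Finset.Icc (-((2 * n ^ 2 + n : ℕ) : ℤ)) (2 * n ^ 2 + n : ℕ)).image Multiplicative.ofAdd with hZdef
  have hZ : ∀ z, nmB z ≤ 2 * n ^ 2 + n → z ∈ Z := by
    intro z h
    rw [hZdef, Finset.mem_image]
    refine ⟨Multiplicative.toAdd z, ?_, rfl⟩
    unfold nmB at h
    rw [Finset.mem_Icc]
    omega
  have hZc : (Z.card : ℝ) ≤ 7 * (n:ℝ) ^ 2 := by
    have h1 : Z.card ≤ 2 * (2 * n ^ 2 + n) + 1 := by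
      refine Finset.card_image_le.trans ?_
      rw [Int.card_Icc]
      omega
    have h2 : Z.card ≤ 7 * n ^ 2 := by nlinarith
    exact_mod_cast h2
  have hen := ent_up (kc c) lamB (kc_pos hc) lamB_words n _ _ hR (2 * n ^ 2 + n) (fun l hl => Jn_le hc ss n l hl) Z hZ
  have hn1 : (1:ℝ) ≤ n := by exact_mod_cast hn
  have hz2 : 1 ≤ z ^ 2 := one_le_pow₀ hz
  have hlow := E_pz (lev := levs p) (kc c) ss (kc_pos hc) n _ (K2 * z) hg (by positivity) (by
    have : K2 ≤ K2 ^ 2 := le_self_pow₀ hK2p (by norm_num)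
    calc _ ≤ K2 * z ^ 2 := by rw [hK2]; linarith
      _ ≤ K2 ^ 2 * z ^ 2 := by gcongr
      _ = _ := by ring)
  have hsB := speed_B (lev := levs p) (kc c) ss (kc_pos hc) n
  have hlog : Real.log (2 * (2 + (Fintype.card V3 : ℝ) ^ 2 * Z.card)) ≤ A * (n:ℝ) ^ (δ - e) := by
    have hb : 2 * (2 + (Fintype.card V3 : ℝ) ^ 2 * Z.card) ≤ 904 * (n:ℝ) ^ 2 := by
      rw [card_V3]
      push_cast
      nlinarith
    have hpos : 0 < 2 * (2 + (Fintype.card V3 : ℝ) ^ 2 * Z.card) := by positivity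
    refine (Real.log_le_log hpos hb).trans ((Real.log_le_rpow_div (by positivity) hηp).trans ?_)
    rw [Real.mul_rpow (by norm_num) (by positivity), ← Real.rpow_natCast, ← Real.rpow_mul (by positivity)]
    have : ((2:ℕ):ℝ) * η = δ - e := by rw [hη]; push_cast; ring
    rw [this, hA]
    apply le_of_eq
    ring
  set H := entropy (convPow (mu (atG (lev := levs p) (kc c) lamB)) n)
  set sp := speed (Set.range (atG (lev := levs p) (kc c) lamB)) (mu (atG (kc c) lamB)) n
  set EWn := EE n (fun l => (Wn lamB p c ss n l : ℝ)) with hEWn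
  have hW0 : 0 ≤ EWn := EE_nonneg fun l _ => by positivity
  have hnd : (n:ℝ) ^ δ = (n:ℝ) ^ (δ - e) * (y ^ 4 * z ^ 2) := by
    rw [← hne, ← Real.rpow_add (by linarith)]
    congr 1; ring
  have hnd1 : 1 ≤ (n:ℝ) ^ δ := Real.one_le_rpow hn1 (by linarith)
  have b1 : H ≤ (A * CW + 1) * (n:ℝ) ^ δ := by
    have h0 : 0 ≤ A * (n:ℝ) ^ (δ - e) := by positivity
    have h1 := mul_le_mul hlog hw hW0 h0
    have h2 : A * (n:ℝ) ^ (δ - e) * (CW * (y ^ 4 * z ^ 2)) = A * CW * (n:ℝ) ^ δ := by rw [hnd]; ring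
    rw [h2] at h1
    linarith
  rw [hne2]
  set X : ℝ := y ^ 4 * z ^ 3 with hX
  have hX0 : 0 < X := by positivity
  have b2 : sp ≤ (2 * CW + CJ) * X := by
    have : y ^ 4 * z ^ 2 ≤ X := by rw [hX]; gcongr <;> norm_num
    have := mul_le_mul_of_nonneg_left this hCWp.le
    linarith
  have b3 : X ≤ (4 * K2) * sp := by
    have h1 : (n:ℝ) / 4 ≤ K2 * z * sp := hlow.trans (mul_le_mul_of_nonneg_left hsB (by positivity))
    have h2 : (n:ℝ) = z * X := by rw [hn4, hX]; ring
    rw [h2] at h1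
    have h3 : z * X ≤ z * (4 * K2 * sp) := by linarith
    exact le_of_mul_le_mul_left h3 (by positivity)
  have hsp0 : 0 ≤ sp := nonneg_of_mul_nonneg_right (hX0.le.trans b3) (by positivity)
  have q : 0 ≤ A * CW := by positivity
  refine ⟨⟨comb hX0.le b2 ?_, comb hsp0 b3 ?_⟩, comb (by linarith) b1 ?_⟩ <;> linarith

end SE

/-! ## Part P11 -/
namespace SE

section
variable {G H : Type} [Group G] [Group H] {α β : Type} [Fintype α] [Fintype β] [Nonempty α] [Nonempty β]
variable (f : α → G) (g : β → H)

def pat (a : α × β) : G × H := (f a.1, g a.2)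

def pS : Set (G × H) := {x | (x.1 ∈ Set.range f ∧ x.2 = 1) ∨ (x.1 = 1 ∧ x.2 ∈ Set.range g)}

theorem XX_pat : ∀ (la : List α) (lb : List β), la.length = lb.length →
    XX (pat f g) (la.zip lb) = (XX f la, XX g lb)
  | [], [], _ => rfl
  | [], _ :: _, h => by simp at h
  | _ :: _, [], h => by simp at h
  | a :: la, b :: lb, h => by
    simp only [List.zip_cons_cons, XX]
    rw [XX_pat la lb (by simpa using h)]
    rfl

theorem wl_pS_le (la : List α) (lb : List β) : wordLength (pS f g) (XX f la, XX g lb) ≤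
    wordLength (Set.range f) (XX f la) + wordLength (Set.range g) (XX g lb) := by
  obtain ⟨l1, h1, h1'⟩ := wl_spec f la
  obtain ⟨l2, h2, h2'⟩ := wl_spec g lb
  rw [← h1', ← h2', ← h1, ← h2]
  refine Nat.sInf_le ⟨l1.reverse.map (fun a => ((f a, 1) : G × H)) ++ l2.reverse.map (fun b => ((1, g b) : G × H)), by simp, ?_, ?_⟩
  · intro x hx
    rw [List.mem_append] at hx
    rcases hx with hx | hx
    · obtain ⟨a, _, rfl⟩ := List.mem_map.1 hx
      exact Or.inl ⟨⟨a, rfl⟩, rfl⟩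
    · obtain ⟨a, _, rfl⟩ := List.mem_map.1 hx
      exact Or.inr ⟨rfl, ⟨a, rfl⟩⟩
  · rw [XX_eq_rev, XX_eq_rev, List.prod_append]
    have e1 : ∀ l : List α, (l.map (fun a => ((f a, 1) : G × H))).prod = ((l.map f).prod, 1) := by
      intro l
      induction l with
      | nil => rfl
      | cons a l ih => simp [ih]
    have e2 : ∀ l : List β, (l.map (fun a => ((1, g a) : G × H))).prod = (1, (l.map g).prod) := by
      intro l
      induction l with
      | nil => rfl
      | cons a l ih => simp [ih]
    rw [e1, e2]
    simp

theorem le_wl_pS (la : List α) (lb : List β) :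
    wordLength (Set.range g) (XX g lb) ≤ wordLength (pS f g) (XX f la, XX g lb) := by
  have hne : {n | ∃ l : List (G × H), l.length = n ∧ (∀ x ∈ l, x ∈ pS f g) ∧ l.prod = (XX f la, XX g lb)}.Nonempty := by
    have e : ∀ la : List α, ∃ l : List (G × H), (∀ x ∈ l, x ∈ pS f g) ∧ l.prod = (XX f la, 1) := by
      intro la
      induction la with
      | nil => exact ⟨[], by simp, rfl⟩
      | cons a la ih =>
        obtain ⟨l, h1, h2⟩ := ih
        refine ⟨l ++ [(f a, 1)], ?_, by rw [List.prod_append, h2]; simp [XX]⟩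
        intro x hx
        rw [List.mem_append, List.mem_singleton] at hx
        rcases hx with hx | rfl
        · exact h1 x hx
        · exact Or.inl ⟨⟨a, rfl⟩, rfl⟩
    have e' : ∀ lb : List β, ∃ l : List (G × H), (∀ x ∈ l, x ∈ pS f g) ∧ l.prod = (1, XX g lb) := by
      intro lb
      induction lb with
      | nil => exact ⟨[], by simp, rfl⟩
      | cons a la ih =>
        obtain ⟨l, h1, h2⟩ := ih
        refine ⟨l ++ [(1, g a)], ?_, by rw [List.prod_append, h2]; simp [XX]⟩
        intro x hx
        rw [List.mem_append, List.mem_singleton] at hx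
        rcases hx with hx | rfl
        · exact h1 x hx
        · exact Or.inr ⟨rfl, ⟨a, rfl⟩⟩
    obtain ⟨l1, h1, h1'⟩ := e la
    obtain ⟨l2, h2, h2'⟩ := e' lb
    refine ⟨_, l1 ++ l2, rfl, ?_, by rw [List.prod_append, h1', h2']; simp⟩
    intro x hx
    rw [List.mem_append] at hx
    exact hx.elim (h1 x) (h2 x)
  obtain ⟨w, hw1, hw2, hw3⟩ := Nat.sInf_mem hne
  have key : ∀ w : List (G × H), (∀ x ∈ w, x ∈ pS f g) → ∃ w' : List H, w'.length ≤ w.length ∧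
      (∀ x ∈ w', x ∈ Set.range g) ∧ w'.prod = w.prod.2 := by
    intro w
    induction w with
    | nil => intro _; exact ⟨[], by simp, by simp, rfl⟩
    | cons x w ih =>
      intro h
      obtain ⟨w', h1, h2, h3⟩ := ih fun y hy => h y (List.mem_cons_of_mem _ hy)
      rcases h x List.mem_cons_self with ⟨_, hx⟩ | ⟨_, hx⟩
      · refine ⟨w', by simp; omega, h2, ?_⟩
        rw [h3, List.prod_cons, Prod.snd_mul, hx, one_mul]
      · refine ⟨x.2 :: w', by simpa using h1, ?_, ?_⟩
        · intro y hy
          rcases List.mem_cons.1 hy with rfl | hy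
          · exact hx
          · exact h2 y hy
        · rw [List.prod_cons, h3, List.prod_cons, Prod.snd_mul]
  obtain ⟨w', h1, h2, h3⟩ := key w hw2
  have h4 : wordLength (Set.range g) (XX g lb) ≤ w'.length :=
    Nat.sInf_le ⟨w', rfl, h2, by rw [h3, hw3]⟩
  have h5 : w.length = wordLength (pS f g) (XX f la, XX g lb) := hw1
  omega

theorem speed_pat (S : Set (G × H)) (n : ℕ) : speed S (mu (pat f g)) n =
    EE n (fun la : List α => EE n (fun lb : List β => (wordLength S (XX f la, XX g lb) : ℝ))) := by
  rw [speed_eq, EE_prod]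
  refine EE_congr fun la hla => EE_congr fun lb hlb => ?_
  rw [XX_pat f g la lb (hla.trans hlb.symm)]

theorem speed_pat_le (n : ℕ) : speed (pS f g) (mu (pat f g)) n ≤
    speed (Set.range f) (mu f) n + speed (Set.range g) (mu g) n := by
  rw [speed_pat]
  refine (EE_mono (G := fun la : List α => EE n (fun lb : List β => (wordLength (Set.range f) (XX f la) : ℝ) +
    (wordLength (Set.range g) (XX g lb) : ℝ))) fun la _ => EE_mono fun lb _ => ?_).trans (le_of_eq ?_)
  · exact_mod_cast wl_pS_le f g la lb
  · simp only [EE_add, EE_const]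
    rw [← speed_eq, ← speed_eq]

theorem speed_pat_ge (n : ℕ) : speed (Set.range g) (mu g) n ≤ speed (pS f g) (mu (pat f g)) n := by
  rw [speed_pat, speed_eq]
  rw [← EE_const (α := α) n (EE n fun l => (wordLength (Set.range g) (XX g l) : ℝ))]
  refine EE_mono fun la _ => EE_mono fun lb _ => ?_
  exact_mod_cast le_wl_pS f g la lb

theorem convPow_pat (n : ℕ) (x : G × H) : convPow (mu (pat f g)) n x =
    convPow (mu f) n x.1 * convPow (mu g) n x.2 := by
  rw [convPow_mu, EE_prod, convPow_mu, convPow_mu, ← EE_mul_const]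
  refine EE_congr fun la hla => ?_
  rw [← EE_smul]
  refine EE_congr fun lb hlb => ?_
  rw [XX_pat f g la lb (hla.trans hlb.symm)]
  rcases x with ⟨x, y⟩
  by_cases h1 : XX f la = x <;> by_cases h2 : XX g lb = y <;> simp [h1, h2, Prod.ext_iff]

theorem convPow_le_one (n : ℕ) (x : G) : convPow (mu f) n x ≤ 1 := by
  rw [convPow_mu]
  exact EE_le_const fun l _ => by split_ifs <;> norm_num

theorem entropy_nonneg' (n : ℕ) : 0 ≤ entropy (convPow (mu f) n) :=
  tsum_nonneg fun x => Real.negMulLog_nonneg (convPow_nonneg f n x) (convPow_le_one f n x)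

theorem entropy_pat (n : ℕ) : entropy (convPow (mu (pat f g)) n) =
    entropy (convPow (mu f) n) + entropy (convPow (mu g) n) := by
  obtain ⟨s, hs⟩ := convPow_support_finite f n
  obtain ⟨t, ht⟩ := convPow_support_finite g n
  have hs1 : ∑ x ∈ s, convPow (mu f) n x = 1 := by
    have h := (tsum_convPow f n (fun _ => 1)).tsum_eq
    rw [EE_const, tsum_eq_sum (s := s) (fun x hx => by rw [hs x hx, zero_mul])] at h
    simpa using h
  have ht1 : ∑ x ∈ t, convPow (mu g) n x = 1 := by
    have h := (tsum_convPow g n (fun _ => 1)).tsum_eq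
    rw [EE_const, tsum_eq_sum (s := t) (fun x hx => by rw [ht x hx, zero_mul])] at h
    simpa using h
  unfold entropy
  rw [tsum_eq_sum (s := s) (fun x hx => by rw [hs x hx, Real.negMulLog_zero]),
    tsum_eq_sum (s := t) (fun x hx => by rw [ht x hx, Real.negMulLog_zero]),
    tsum_eq_sum (s := s ×ˢ t) (fun x hx => by
      rw [convPow_pat]
      rw [Finset.mem_product, not_and_or] at hx
      rcases hx with hx | hx
      · rw [hs _ hx, zero_mul, Real.negMulLog_zero]
      · rw [ht _ hx, mul_zero, Real.negMulLog_zero])]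
  rw [Finset.sum_product]
  simp only [convPow_pat, Real.negMulLog_mul, Finset.sum_add_distrib, ← Finset.sum_mul, ← Finset.mul_sum]
  rw [hs1, ht1, one_mul, one_mul]

theorem pS_gen (hf : Subgroup.closure (Set.range f) = ⊤) (hg : Subgroup.closure (Set.range g) = ⊤)
    (K : Subgroup (G × H)) (h1 : ∀ a, (f a, 1) ∈ K) (h2 : ∀ b, (1, g b) ∈ K) : K = ⊤ := by
  rw [eq_top_iff]
  rintro ⟨x, y⟩ _
  have hx : (x, (1:H)) ∈ K := by
    have : Subgroup.closure (Set.range f) ≤ K.comap (MonoidHom.inl G H) := by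
      rw [Subgroup.closure_le]
      rintro _ ⟨a, rfl⟩
      exact h1 a
    exact this (hf ▸ Subgroup.mem_top x)
  have hy : ((1:G), y) ∈ K := by
    have : Subgroup.closure (Set.range g) ≤ K.comap (MonoidHom.inr G H) := by
      rw [Subgroup.closure_le]
      rintro _ ⟨a, rfl⟩
      exact h2 a
    exact this (hg ▸ Subgroup.mem_top y)
  have := K.mul_mem hx hy
  simpa using this

theorem pS_isGenSet (hf : Subgroup.closure (Set.range f) = ⊤) (hg : Subgroup.closure (Set.range g) = ⊤)
    (i : α → α) (hi : ∀ a, f (i a) = (f a)⁻¹) (j : β → β) (hj : ∀ b, g (j b) = (g b)⁻¹) : IsGenSet (pS f g) where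
  finite := by
    have h1 : (Set.range fun a : α => ((f a, 1) : G × H)).Finite := Set.finite_range _
    have h2 : (Set.range fun b : β => ((1, g b) : G × H)).Finite := Set.finite_range _
    refine (h1.union h2).subset ?_
    rintro ⟨x, y⟩ (⟨⟨a, ha⟩, hy⟩ | ⟨hx, ⟨b, hb⟩⟩)
    · exact Or.inl ⟨a, Prod.ext ha hy.symm⟩
    · exact Or.inr ⟨b, Prod.ext hx.symm hb⟩
  symm := by
    rintro ⟨x, y⟩ (⟨⟨a, ha⟩, hy⟩ | ⟨hx, ⟨b, hb⟩⟩)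
    · exact Or.inl ⟨⟨i a, by rw [hi, ha]; rfl⟩, by simpa using hy⟩
    · exact Or.inr ⟨by simpa using hx, ⟨j b, by rw [hj, hb]; rfl⟩⟩
  gen := pS_gen f g hf hg _ (fun a => Subgroup.subset_closure (Or.inl ⟨⟨a, rfl⟩, rfl⟩))
    (fun b => Subgroup.subset_closure (Or.inr ⟨rfl, ⟨b, rfl⟩⟩))

theorem pat_isStepDist (hf : Subgroup.closure (Set.range f) = ⊤) (hg : Subgroup.closure (Set.range g) = ⊤)
    (i : α → α) (hi2 : ∀ a, i (i a) = a) (hi : ∀ a, f (i a) = (f a)⁻¹)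
    (j : β → β) (hj2 : ∀ a, j (j a) = a) (hj : ∀ b, g (j b) = (g b)⁻¹) (a0 : α) (ha0 : f a0 = 1) :
    IsStepDist (mu (pat f g)) := by
  have h2 : ∀ b, ((1, g b) : G × H) ∈ Subgroup.closure (Set.range (pat f g)) := fun b =>
    Subgroup.subset_closure ⟨(a0, b), by simp [pat, ha0]⟩
  refine mu_isStepDist _ (fun a => (i a.1, j a.2)) (fun a => by simp [hi2, hj2])
    (fun a => by simp [pat, hi, hj]) (pS_gen f g hf hg _ (fun a => ?_) h2)
  have b : β := Classical.arbitrary β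
  have h3 : pat f g (a, b) ∈ Subgroup.closure (Set.range (pat f g)) := Subgroup.subset_closure ⟨_, rfl⟩
  have := Subgroup.mul_mem _ h3 (Subgroup.inv_mem _ (h2 b))
  simpa [pat] using this

end
end SE

/-- For every pair of exponents `3/4 ≤ δ ≤ β < 1` with `β < (1+δ)/2`, there exist a
finitely generated group `Γ` with a finite symmetric generating set and a symmetric,
finitely supported random walk `X_n` on `Γ` with `E|X_n| ≍ n^β` and `H(X_n) ≍ n^δ`. -/
theorem speed_entropy_exponents
    (β δ : ℝ) (hδ : 3 / 4 ≤ δ) (hδβ : δ ≤ β) (hβ : β < 1) (hrel : β < (1 + δ) / 2) :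
    ∃ (Γ : Type) (_ : Group Γ) (S : Set Γ) (μ : Γ → ℝ),
      IsGenSet S ∧ IsStepDist μ ∧
      ∃ C : ℝ, 0 < C ∧
        ∀ n : ℕ, 1 ≤ n →
          (speed S μ n ≤ C * (n : ℝ) ^ β ∧ (n : ℝ) ^ β ≤ C * speed S μ n) ∧
          (entropy (convPow μ n) ≤ C * (n : ℝ) ^ δ ∧
            (n : ℝ) ^ δ ≤ C * entropy (convPow μ n)) := by
  have hpw : ∀ n : ℕ, 1 ≤ n → (n:ℝ) ^ δ ≤ (n:ℝ) ^ β := fun n hn =>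
    Real.rpow_le_rpow_of_exponent_le (by exact_mod_cast hn) hδβ
  obtain ⟨ΓA, iA, f, invA, hA1, hA2, hA3, ⟨a0, ha0⟩, C, hC, hA⟩ := SE.thmA δ (by linarith) (by linarith)
  rcases eq_or_lt_of_le hδβ with rfl | hlt
  · refine ⟨ΓA, iA, Set.range f, SE.mu f, ⟨Set.finite_range _, ?_, hA3⟩, SE.mu_isStepDist f invA hA1 hA2 hA3, C, hC, hA⟩
    rintro _ ⟨a, rfl⟩
    exact ⟨invA a, hA2 a⟩
  · obtain ⟨ΓB, iB, g, invB, hB1, hB2, hB3, D, hD, hB⟩ := SE.thmB (2 * β - 1) δ (by linarith) (by linarith) (by linarith)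
    refine ⟨ΓA × ΓB, inferInstance, SE.pS f g, SE.mu (SE.pat f g), SE.pS_isGenSet f g hA3 hB3 invA hA2 invB hB2,
      SE.pat_isStepDist f g hA3 hB3 invA hA1 hA2 invB hB1 hB2 a0 ha0, C + D, by positivity, ?_⟩
    intro n hn
    obtain ⟨⟨a1, a2⟩, a3, a4⟩ := hA n hn
    obtain ⟨⟨b1, b2⟩, b3⟩ := hB n hn
    have hβe : (1 + (2 * β - 1)) / 2 = β := by ring
    rw [hβe] at b1 b2
    have h1 := SE.speed_pat_le f g n
    have h2 := SE.speed_pat_ge f g n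
    have h3 := SE.entropy_pat f g n
    have h4 := SE.entropy_nonneg' g n
    have h5 := SE.entropy_nonneg' f n
    have h6 : 0 ≤ (n:ℝ) ^ β := by positivity
    have h7 : 0 ≤ (n:ℝ) ^ δ := by positivity
    have h8 := mul_le_mul_of_nonneg_left (hpw n hn) hC.le
    have h9 : 0 ≤ speed (Set.range g) (SE.mu g) n := nonneg_of_mul_nonneg_right (h6.trans b2) hD
    rw [h3]
    refine ⟨⟨by linarith, ?_⟩, by linarith, ?_⟩
    · have := mul_le_mul_of_nonneg_left h2 hD.le
      have : 0 ≤ C * speed (SE.pS f g) (SE.mu (SE.pat f g)) n := mul_nonneg hC.le (h9.trans h2)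
      linarith
    · have i1 : 0 ≤ C * entropy (convPow (SE.mu g) n) := by positivity
      have i2 : 0 ≤ D * (entropy (convPow (SE.mu f) n) + entropy (convPow (SE.mu g) n)) := by positivity
      linarith
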